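/- Fix α ∈ [1, 2) and a one-dimensional linear subspace L ⊂ ℝ². For any β < (2/α) − 1 there exist a set E ⊆ L^⊥ with Hausdorff dimension strictly greater than β and a quasiconformal homeomorphism f : ℝ² → ℝ² such that for every a ∈ E and every Borel subset F of the affine line a + L, the Hausdorff dimension of f(F) equals α times the Hausdorff dimension of F. -/

import Mathlib

open Set Metric Filter MeasureTheory
open scoped ENNReal Topology NNReal

noncomputable section

/-- `L_Φ(x,r) = sup {|Φ(x) - Φ(y)| : y ∈ Ω, |x - y| ≤ r}`. -/
noncomputable def linDil {X : Type*} [MetricSpace X] (Ω : Set X) (Φ : X → X) (x : X) (r : ℝ) :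
    ℝ≥0∞ :=
  ⨆ y ∈ {y | y ∈ Ω ∧ dist x y ≤ r}, edist (Φ x) (Φ y)

/-- `l_Φ(x,r) = inf {|Φ(x) - Φ(y)| : y ∈ Ω, |x - y| ≥ r}`. -/
noncomputable def linCon {X : Type*} [MetricSpace X] (Ω : Set X) (Φ : X → X) (x : X) (r : ℝ) :
    ℝ≥0∞ :=
  ⨅ y ∈ {y | y ∈ Ω ∧ r ≤ dist x y}, edist (Φ x) (Φ y)

/-- `H_Φ(x) = limsup_{r → 0⁺} L_Φ(x,r) / l_Φ(x,r)`. -/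
noncomputable def qcH {X : Type*} [MetricSpace X] (Ω : Set X) (Φ : X → X) (x : X) : ℝ≥0∞ :=
  Filter.limsup (fun r : ℝ => linDil Ω Φ x r / linCon Ω Φ x r) (𝓝[>] (0 : ℝ))

/-- A map `Φ`, viewed as a map of `Ω` into `X`, is quasiconformal if `H_Φ(x) ≤ H` for all
`x ∈ Ω`, for some finite `H ≥ 1`. -/
def QuasiconformalOn {X : Type*} [MetricSpace X] (Ω : Set X) (Φ : X → X) : Prop :=
  ∃ H : ℝ, 1 ≤ H ∧ ∀ x ∈ Ω, qcH Ω Φ x ≤ ENNReal.ofReal H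

/-- `Φ` restricts to a homeomorphism of `Ω` onto `Ω'`. -/
def IsHomeoOn {X : Type*} [TopologicalSpace X] (Φ : X → X) (Ω Ω' : Set X) : Prop :=
  ∃ e : Ω ≃ₜ Ω', ∀ x : Ω, (e x : X) = Φ (x : X)

/-- `f` is a similarity with ratio `r`. -/
def IsSimilarityWith {X : Type*} [MetricSpace X] (r : ℝ) (f : X → X) : Prop :=
  0 < r ∧ ∀ x y, dist (f x) (f y) = r * dist x y

/-- The strong separation condition for the iterated function system `f` on the set `Q`:
each `f i` maps the closure of `Q` into `Q`, and the images of the closure of `Q` are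
pairwise disjoint. -/
def StrongSeparation {X : Type*} [MetricSpace X] {ι : Type*} (f : ι → X → X) (Q : Set X) :
    Prop :=
  (∀ i, f i '' closure Q ⊆ Q) ∧
    ∀ i j, i ≠ j → Disjoint (f i '' closure Q) (f j '' closure Q)

/-- `f_σ = f_{σ₁} ∘ ⋯ ∘ f_{σ_k}` for a finite word `σ`. -/
def iterComp {X ι : Type*} (f : ι → X → X) : List ι → X → X
  | [] => id
  | i :: w => f i ∘ iterComp f w

/-- The invariant set `K = ⋂_k ⋃_{|σ| = k} f_σ(closure Q)` of an iterated function system. -/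
def invariantSet {X : Type*} [MetricSpace X] {ι : Type*} (f : ι → X → X) (Q : Set X) :
    Set X :=
  ⋂ k : ℕ, ⋃ w : Fin k → ι, iterComp f (List.ofFn w) '' closure Q

/-- The distance between two subsets of a metric space. -/
noncomputable def setDist {X : Type*} [MetricSpace X] (A B : Set X) : ℝ :=
  sInf ((fun p : X × X => dist p.1 p.2) '' A ×ˢ B)

end

-- ===== Part 1 =====
open Set Metric Filter MeasureTheory
open scoped ENNReal Topology NNReal

namespace BHW

/-- Two by two matrices acting on the plane. -/
@[ext] structure Mt where
  a : ℝ
  b : ℝ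
  c : ℝ
  d : ℝ

def Mt.ap (M : Mt) (z : ℝ × ℝ) : ℝ × ℝ := (M.a * z.1 + M.b * z.2, M.c * z.1 + M.d * z.2)

def Mt.mu (M N : Mt) : Mt :=
  ⟨M.a * N.a + M.b * N.c, M.a * N.b + M.b * N.d, M.c * N.a + M.d * N.c, M.c * N.b + M.d * N.d⟩

def Mt.sc (t : ℝ) (M : Mt) : Mt := ⟨t * M.a, t * M.b, t * M.c, t * M.d⟩

theorem Mt.ap_mu (M N : Mt) (z : ℝ × ℝ) : (M.mu N).ap z = M.ap (N.ap z) := by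
  simp only [Mt.ap, Mt.mu, Prod.mk.injEq]; constructor <;> ring

theorem Mt.ap_sc (t : ℝ) (M : Mt) (z : ℝ × ℝ) : (M.sc t).ap z = t • M.ap z := by
  simp only [Mt.ap, Mt.sc, Prod.smul_mk, smul_eq_mul, Prod.mk.injEq]; constructor <;> ring

theorem Mt.ap_add (M : Mt) (z w : ℝ × ℝ) : M.ap (z + w) = M.ap z + M.ap w := by
  simp only [Mt.ap, Prod.fst_add, Prod.snd_add, Prod.mk_add_mk, Prod.mk.injEq]; constructor <;> ring

theorem Mt.ap_sub (M : Mt) (z w : ℝ × ℝ) : M.ap (z - w) = M.ap z - M.ap w := by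
  simp only [Mt.ap, Prod.fst_sub, Prod.snd_sub, Prod.mk_sub_mk, Prod.mk.injEq]; constructor <;> ring

theorem Mt.ap_smul (M : Mt) (t : ℝ) (z : ℝ × ℝ) : M.ap (t • z) = t • M.ap z := by
  simp only [Mt.ap, Prod.smul_fst, Prod.smul_snd, smul_eq_mul, Prod.smul_mk, Prod.mk.injEq]
  constructor <;> ring

/-- The shear matrix `I + η (1,e) ⊗ (1,-e)`. -/
def Bm (e η : ℝ) : Mt := ⟨1 + η, -(e * η), e * η, 1 - η⟩

/-- bend map: identity on `x ≤ e y`, shear on `x ≥ e y`. -/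
noncomputable def bd (e η : ℝ) (z : ℝ × ℝ) : ℝ × ℝ :=
  (z.1 + η * max 0 (z.1 - e * z.2), z.2 + e * η * max 0 (z.1 - e * z.2))

theorem bd_act {e η : ℝ} (he : e = 1 ∨ e = -1) {z : ℝ × ℝ} (h : e * z.2 ≤ z.1) :
    bd e η z = (Bm e η).ap z := by
  have h0 : max 0 (z.1 - e * z.2) = z.1 - e * z.2 := max_eq_right (by linarith)
  simp only [bd, Bm, Mt.ap, h0, Prod.mk.injEq]
  rcases he with rfl | rfl <;> constructor <;> ring

theorem bd_inact {e η : ℝ} {z : ℝ × ℝ} (h : z.1 ≤ e * z.2) : bd e η z = z := by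
  have h0 : max 0 (z.1 - e * z.2) = 0 := max_eq_left (by linarith)
  simp [bd, h0]

theorem bd_zero (e : ℝ) (z : ℝ × ℝ) : bd e 0 z = z := by simp [bd]

theorem Bm_zero (e : ℝ) (M : Mt) : M.mu (Bm e 0) = M := by
  ext <;> simp [Mt.mu, Bm]

theorem bd_smul (e η : ℝ) {t : ℝ} (ht : 0 ≤ t) (z : ℝ × ℝ) : bd e η (t • z) = t • bd e η z := by
  have : max 0 (t * z.1 - e * (t * z.2)) = t * max 0 (z.1 - e * z.2) := by
    rw [mul_max_of_nonneg _ _ ht]; congr 1 <;> ring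
  simp only [bd, Prod.smul_fst, Prod.smul_snd, smul_eq_mul, this, Prod.smul_mk, Prod.mk.injEq]
  constructor <;> ring

theorem bd_sub (e η : ℝ) (z w : ℝ × ℝ) : ∃ τ : ℝ, 0 ≤ τ ∧ τ ≤ 1 ∧
    bd e η w - bd e η z = (Bm e (τ * η)).ap (w - z) + (0, τ * η * (1 - e * e) * (w.2 - z.2)) := by
  obtain ⟨τ, h0, h1, h2⟩ : ∃ τ : ℝ, 0 ≤ τ ∧ τ ≤ 1 ∧
      max 0 (w.1 - e * w.2) - max 0 (z.1 - e * z.2) =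
        τ * ((w.1 - e * w.2) - (z.1 - e * z.2)) := by
    set p := w.1 - e * w.2
    set q := z.1 - e * z.2
    rcases eq_or_ne p q with h | h
    · exact ⟨0, le_rfl, zero_le_one, by rw [h]; ring⟩
    · refine ⟨(max 0 p - max 0 q) / (p - q), ?_, ?_, ?_⟩
      · rcases lt_or_gt_of_ne h with h | h
        · exact div_nonneg_of_nonpos (by have := max_le_max (le_refl (0:ℝ)) h.le; linarith)
            (by linarith)
        · exact div_nonneg (by have := max_le_max (le_refl (0:ℝ)) h.le; linarith) (by linarith)
      · rcases lt_or_gt_of_ne h with h | h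
        · rw [div_le_one_of_neg (by linarith)]
          rcases max_cases 0 p with ⟨h1, h2⟩ | ⟨h1, h2⟩ <;>
          rcases max_cases 0 q with ⟨h3, h4⟩ | ⟨h3, h4⟩ <;> rw [h1, h3] <;> linarith
        · rw [div_le_one (by linarith)]
          rcases max_cases 0 p with ⟨h1, h2⟩ | ⟨h1, h2⟩ <;>
          rcases max_cases 0 q with ⟨h3, h4⟩ | ⟨h3, h4⟩ <;> rw [h1, h3] <;> linarith
      · rw [div_mul_cancel₀ _ (sub_ne_zero.2 h)]
  refine ⟨τ, h0, h1, ?_⟩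
  ext
  · simp only [bd, Bm, Mt.ap, Prod.fst_sub, Prod.snd_sub, Prod.fst_add]
    linear_combination η * h2
  · simp only [bd, Bm, Mt.ap, Prod.fst_sub, Prod.snd_sub, Prod.snd_add]
    linear_combination e * η * h2

/-- A row of tiles: `g` is on the tile centred at `(m,0)` a bend map. -/
structure TileRow (g : ℝ × ℝ → ℝ × ℝ) (D : ℤ → Mt) (e : ℤ → ℤ) (η : ℤ → ℝ) : Prop where
  he : ∀ l, e l = 1 ∨ e l = -1
  hD : ∀ l, D l = (D (l - 1)).mu (Bm (e l) (η l))
  hadj : ∀ l, η l = 0 ∨ η (l + 1) = 0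
  tile : ∀ (m : ℤ) (w : ℝ × ℝ), |w.1| ≤ 1/2 → |w.2| ≤ 1/2 →
    g (m + w.1, w.2) = g (m, 0) + (D (m - 1)).ap (bd (e m) (η m) w)

namespace TileRow
variable {g : ℝ × ℝ → ℝ × ℝ} {D : ℤ → Mt} {e : ℤ → ℤ} {η : ℤ → ℝ}

theorem heR (R : TileRow g D e η) (l : ℤ) : (e l : ℝ) = 1 ∨ (e l : ℝ) = -1 := by
  rcases R.he l with h | h <;> simp [h]

theorem emul (R : TileRow g D e η) (l : ℤ) {y b : ℝ} (h : |y| ≤ b) :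
    (e l : ℝ) * y ≤ b ∧ -b ≤ (e l : ℝ) * y := by
  have := abs_le.1 h
  rcases R.heR l with h | h <;> rw [h] <;> constructor <;> linarith

theorem right (R : TileRow g D e η) (m : ℤ) (w : ℝ × ℝ) (h1 : |w.1| ≤ 1/2) (h2 : |w.2| ≤ 1/2)
    (h3 : |w.2| ≤ w.1) : g (m + w.1, w.2) = g (m, 0) + (D m).ap w := by
  rw [R.tile m w h1 h2, bd_act (R.heR m) ((R.emul m h3).1), R.hD m, Mt.ap_mu]

theorem left (R : TileRow g D e η) (m : ℤ) (w : ℝ × ℝ) (h1 : |w.1| ≤ 1/2) (h2 : |w.2| ≤ 1/2)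
    (h3 : |w.2| ≤ -w.1) : g (m + w.1, w.2) = g (m, 0) + (D (m - 1)).ap w := by
  rw [R.tile m w h1 h2, bd_inact (by linarith [(R.emul m h3).2])]

theorem hP (R : TileRow g D e η) (m : ℤ) : g ((m : ℝ) + 1, 0) = g (m, 0) + (D m).ap (1, 0) := by
  have h1 := R.right m (1/2, 0) (by norm_num [abs_of_pos]) (by norm_num) (by norm_num)
  have h2 := R.left (m+1) (-1/2, 0) (by norm_num [abs_of_pos]) (by norm_num) (by norm_num)
  have e1 : ((m + 1 : ℤ) : ℝ) + -1/2 = m + 1/2 := by push_cast; ring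
  simp only [e1, add_sub_cancel_right] at h2
  rw [h1] at h2
  have h3 : ((m + 1 : ℤ) : ℝ) = (m : ℝ) + 1 := by push_cast; ring
  rw [h3] at h2
  have h4 : (D m).ap (1/2, 0) - (D m).ap (-1/2, 0) = (D m).ap (1, 0) := by
    rw [← Mt.ap_sub]; norm_num
  rw [← h4]
  have := congrArg (fun t => t - (D m).ap (-1/2, 0)) h2
  simp only [add_sub_cancel_right] at this
  rw [← this]; abel

/-- on the segment between consecutive centres, away from the bend lines, `g` is affine -/
theorem seg (R : TileRow g D e η) (m : ℤ) (w : ℝ × ℝ) (h1 : |w.2| ≤ w.1) (h2 : |w.2| ≤ 1 - w.1) :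
    g (m + w.1, w.2) = g (m, 0) + (D m).ap w := by
  have h0 := abs_nonneg w.2
  rcases le_total w.1 (1/2) with h | h
  · exact R.right m w (by rw [abs_le]; constructor <;> linarith) (by linarith) h1
  · have := R.left (m+1) (w.1 - 1, w.2) (by simp only [abs_le]; constructor <;> linarith)
      (by simp only; linarith) (by simp only; linarith)
    have e1 : ((m + 1 : ℤ) : ℝ) + (w.1 - 1) = m + w.1 := by push_cast; ring
    simp only [e1, add_sub_cancel_right] at this
    rw [this]
    have h3 : ((m + 1 : ℤ) : ℝ) = (m : ℝ) + 1 := by push_cast; ring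
    rw [h3, R.hP, add_assoc, ← Mt.ap_add]; simp

theorem LL1 (R : TileRow g D e η) (m : ℤ) (z w : ℝ × ℝ) (h1 : |z.1 - m| ≤ 1/2) (h2 : |z.2| ≤ 1/2)
    (h3 : |w.1 - (m + 1)| ≤ 1/2) (h4 : |w.2| ≤ 1/2) :
    ∃ l : ℤ, g z = g (l, 0) + (D (l-1)).ap (bd (e l) (η l) (z - ((l:ℝ), (0:ℝ)))) ∧
      g w = g (l, 0) + (D (l-1)).ap (bd (e l) (η l) (w - ((l:ℝ), (0:ℝ)))) := by
  have tz := R.tile m (z - ((m:ℝ), (0:ℝ))) (by simpa using h1) (by simpa using h2)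
  have tw := R.tile (m+1) (w - (((m+1 : ℤ):ℝ), (0:ℝ))) (by simpa using h3) (by simpa using h4)
  have ez : ((m:ℝ) + (z - ((m:ℝ), 0)).1, (z - ((m:ℝ), 0)).2) = z := by ext <;> simp
  have ew : (((m+1 : ℤ):ℝ) + (w - (((m+1:ℤ):ℝ), 0)).1, (w - (((m+1:ℤ):ℝ), 0)).2) = w := by
    ext <;> simp
  rw [ez] at tz; rw [ew] at tw
  have hP := R.hP m
  rcases R.hadj m with h | h
  · refine ⟨m + 1, ?_, tw⟩
    rw [h, bd_zero] at tz
    have hDm := R.hD m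
    rw [h, Bm_zero] at hDm
    rw [bd_inact, add_sub_cancel_right, tz, hDm]
    · push_cast
      rw [hP, hDm, add_assoc, ← Mt.ap_add]
      congr 2; ext <;> simp <;> try ring
    · have := (R.emul (m+1) h2).2
      have := (abs_le.1 h1).2
      simp only [Prod.fst_sub, Prod.snd_sub, sub_zero]; push_cast; linarith
  · refine ⟨m, tz, ?_⟩
    rw [h, bd_zero, add_sub_cancel_right] at tw
    rw [bd_act (R.heR m), ← Mt.ap_mu, ← R.hD m, tw]
    · push_cast
      rw [hP, add_assoc, ← Mt.ap_add]
      congr 2; ext <;> simp <;> try ring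
    · have := (R.emul m h4).1
      have := (abs_le.1 h3).1
      simp only [Prod.fst_sub, Prod.snd_sub, sub_zero]; linarith

theorem LL0 (R : TileRow g D e η) (z w : ℝ × ℝ) (h2 : |z.2| ≤ 1/2) (h4 : |w.2| ≤ 1/2)
    (h5 : |z.1 - w.1| ≤ 1/2) :
    ∃ l : ℤ, g z = g (l, 0) + (D (l-1)).ap (bd (e l) (η l) (z - ((l:ℝ), (0:ℝ)))) ∧
      g w = g (l, 0) + (D (l-1)).ap (bd (e l) (η l) (w - ((l:ℝ), (0:ℝ)))) := by
  have h1 : |z.1 - round z.1| ≤ 1/2 := abs_sub_round z.1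
  set m := round z.1
  have a1 := abs_le.1 h1
  have a5 := abs_le.1 h5
  by_cases c1 : |w.1 - m| ≤ 1/2
  · refine ⟨m, ?_, ?_⟩
    · have tz := R.tile m (z - ((m:ℝ), (0:ℝ))) (by simpa using h1) (by simpa using h2)
      have ez : ((m:ℝ) + (z - ((m:ℝ), 0)).1, (z - ((m:ℝ), 0)).2) = z := by ext <;> simp
      rwa [ez] at tz
    · have tz := R.tile m (w - ((m:ℝ), (0:ℝ))) (by simpa using c1) (by simpa using h4)
      have ez : ((m:ℝ) + (w - ((m:ℝ), 0)).1, (w - ((m:ℝ), 0)).2) = w := by ext <;> simp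
      rwa [ez] at tz
  · rw [abs_le, not_and_or] at c1
    rcases c1 with c1 | c1
    · obtain ⟨l, A, B⟩ := R.LL1 (m-1) w z (by rw [abs_le]; push_cast; constructor <;> linarith) h4
        (by rw [abs_le]; push_cast; constructor <;> linarith) h2
      exact ⟨l, B, A⟩
    · exact R.LL1 m z w h1 h2 (by rw [abs_le]; constructor <;> linarith) h4

/-- local linearisation -/
theorem LL (R : TileRow g D e η) (z w : ℝ × ℝ) (h2 : |z.2| ≤ 1/2) (h4 : |w.2| ≤ 1/2)
    (h5 : |z.1 - w.1| ≤ 1/2) :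
    ∃ (l : ℤ) (τ : ℝ), 0 ≤ τ ∧ τ ≤ 1 ∧
      g w - g z = (D (l-1)).ap ((Bm (e l) (τ * η l)).ap (w - z)) := by
  obtain ⟨l, h1, h2⟩ := R.LL0 z w h2 h4 h5
  obtain ⟨τ, t0, t1, ht⟩ := bd_sub (e l) (η l) (z - ((l:ℝ), (0:ℝ))) (w - ((l:ℝ), (0:ℝ)))
  refine ⟨l, τ, t0, t1, ?_⟩
  rw [h1, h2, add_sub_add_left_eq_sub, ← Mt.ap_sub, ht]
  have : (1 : ℝ) - e l * e l = 0 := by rcases R.heR l with h | h <;> rw [h] <;> ring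
  rw [this]; simp only [mul_zero, zero_mul, sub_sub_sub_cancel_right]
  rw [show ((0:ℝ),(0:ℝ)) = 0 from rfl, add_zero]

end TileRow
end BHW

-- ===== Part 2 =====
open Set Metric Filter MeasureTheory
open scoped ENNReal Topology NNReal

namespace BHW

abbrev Pl := ℝ × ℝ

def Lip {X Y : Type*} [PseudoMetricSpace X] [PseudoMetricSpace Y] (C : ℝ) (f : X → Y) : Prop :=
  ∀ x y, dist (f x) (f y) ≤ C * dist x y

def BL (C : ℝ) (f : Pl ≃ Pl) : Prop := Lip C f ∧ Lip C f.symm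

theorem Lip.mono {X Y : Type*} [PseudoMetricSpace X] [PseudoMetricSpace Y] {C C' : ℝ} {f : X → Y}
    (h : Lip C f) (hC : C ≤ C') : Lip C' f :=
  fun x y => (h x y).trans (mul_le_mul_of_nonneg_right hC dist_nonneg)

theorem BL.mono {C C' : ℝ} {f : Pl ≃ Pl} (h : BL C f) (hC : C ≤ C') : BL C' f :=
  ⟨h.1.mono hC, h.2.mono hC⟩

theorem BL.low {C : ℝ} {f : Pl ≃ Pl} (h : BL C f) (x y : Pl) :
    dist x y ≤ C * dist (f x) (f y) := by
  have := h.2 (f x) (f y); simpa using this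

theorem Lip.comp {X Y Z : Type*} [PseudoMetricSpace X] [PseudoMetricSpace Y] [PseudoMetricSpace Z]
    {C C' : ℝ} {f : X → Y} {g : Y → Z} (hC : 0 ≤ C')
    (hg : Lip C' g) (hf : Lip C f) : Lip (C' * C) (g ∘ f) := fun x y => by
  calc dist (g (f x)) (g (f y)) ≤ C' * dist (f x) (f y) := hg _ _
    _ ≤ C' * (C * dist x y) := mul_le_mul_of_nonneg_left (hf _ _) hC
    _ = _ := by ring

theorem BL.trans {C C' : ℝ} {f g : Pl ≃ Pl} (h0 : 0 ≤ C) (h0' : 0 ≤ C') (hf : BL C f)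
    (hg : BL C' g) : BL (C * C') (f.trans g) := by
  constructor
  · have := Lip.comp h0' hg.1 hf.1
    rw [mul_comm]; exact this
  · have := Lip.comp h0 hf.2 hg.2
    exact this

theorem Lip.continuous {X Y : Type*} [PseudoMetricSpace X] [PseudoMetricSpace Y] {C : ℝ} {f : X → Y}
    (h : Lip C f) : Continuous f := by
  have : LipschitzWith (Real.toNNReal (max C 0)) f := by
    apply LipschitzWith.of_dist_le_mul
    intro x y
    rw [Real.coe_toNNReal _ (le_max_right _ _)]
    exact (h x y).trans (mul_le_mul_of_nonneg_right (le_max_left _ _) dist_nonneg)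
  exact this.continuous

theorem dist_pl (z w : Pl) : dist z w = max |z.1 - w.1| |z.2 - w.2| := by
  rw [Prod.dist_eq, Real.dist_eq, Real.dist_eq]

theorem d1 (z w : Pl) : |z.1 - w.1| ≤ dist z w := by rw [dist_pl]; exact le_max_left _ _
theorem d2 (z w : Pl) : |z.2 - w.2| ≤ dist z w := by rw [dist_pl]; exact le_max_right _ _

/-- chain lemma for upper bounds -/
theorem chain_upper {A : Set Pl} (hA : Convex ℝ A) (f : Pl → Pl) {C r : ℝ} (hr : 0 < r)
    (h : ∀ x ∈ A, ∀ y ∈ A, dist x y ≤ r → dist (f x) (f y) ≤ C * dist x y)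
    (x y : Pl) (hx : x ∈ A) (hy : y ∈ A) : dist (f x) (f y) ≤ C * dist x y := by
  obtain ⟨N, hN⟩ := exists_nat_gt (dist x y / r)
  have hN0 : (0:ℝ) < N := lt_of_le_of_lt (by positivity) hN
  have hN1 : dist x y ≤ N * r := by rw [div_lt_iff₀ hr] at hN; exact hN.le
  let p : ℕ → Pl := fun i => x + ((i:ℝ)/N) • (y - x)
  have hp : ∀ i ≤ N, p i ∈ A := by
    intro i hi
    apply hA.add_smul_sub_mem hx hy
    refine ⟨by positivity, ?_⟩
    rw [div_le_one hN0]; exact_mod_cast hi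
  have hd : ∀ i, dist (p i) (p (i+1)) = dist x y / N := by
    intro i
    simp only [p, dist_eq_norm]
    rw [add_sub_add_left_eq_sub, ← sub_smul, norm_smul, ← norm_neg (x - y), neg_sub]
    rw [show (i:ℝ)/N - ((i+1:ℕ):ℝ)/N = -(1/N) by push_cast; ring, norm_neg, Real.norm_of_nonneg (by positivity)]
    ring
  have h0 : p 0 = x := by simp [p]
  have h1 : p N = y := by
    simp only [p]; rw [div_self hN0.ne']; simp
  have key := dist_le_range_sum_of_dist_le (f := fun i => f (p i)) N
    (d := fun _ => C * (dist x y / N)) (fun {k} hk => by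
      have := h _ (hp k hk.le) _ (hp (k+1) hk) (by rw [hd, div_le_iff₀ hN0]; linarith)
      rwa [hd] at this)
  simp only [h0, h1] at key
  refine key.trans (le_of_eq ?_)
  simp; field_simp

theorem chain_mono (f : ℝ → ℝ) {c r : ℝ} (hr : 0 < r)
    (h : ∀ x y, x ≤ y → y ≤ x + r → c * (y - x) ≤ f y - f x) (x y : ℝ) (hxy : x ≤ y) :
    c * (y - x) ≤ f y - f x := by
  have key : ∀ n : ℕ, ∀ x y, x ≤ y → y ≤ x + n * r → c * (y - x) ≤ f y - f x := by
    intro n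
    induction n with
    | zero => intro x y h1 h2; have : y = x := by simp at h2; linarith
              rw [this]; simp
    | succ n ih =>
      intro x y h1 h2
      push_cast at h2
      rcases le_total y (x + r) with h3 | h3
      · exact h x y h1 h3
      · have := h x (x+r) (by linarith) le_rfl
        have := ih (x+r) y h3 (by linarith)
        linarith
  obtain ⟨N, hN⟩ := exists_nat_gt ((y - x) / r)
  rw [div_lt_iff₀ hr] at hN
  exact key N x y hxy (by linarith)

/-- fiber lemma, horizontal -/
theorem fiberH (L c : ℝ) (hL : 0 ≤ L) (hc : 0 < c) : ∃ C, 1 ≤ C ∧ ∀ X : Pl → ℝ, Lip L X →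
    (∀ x1 x2 y, x1 ≤ x2 → c * (x2 - x1) ≤ X (x2, y) - X (x1, y)) →
    ∃ F : Pl ≃ Pl, BL C F ∧ ∀ z, F z = (X z, z.2) := by
  refine ⟨max (max L 1) ((1 + L)/c), le_max_of_le_left (le_max_right _ _), ?_⟩
  intro X hX hm
  have habs : ∀ x1 x2 y, c * |x2 - x1| ≤ |X (x2, y) - X (x1, y)| := by
    intro x1 x2 y
    rcases le_total x1 x2 with h | h
    · rw [abs_of_nonneg (by linarith)]; exact (hm _ _ _ h).trans (le_abs_self _)
    · rw [abs_sub_comm, abs_of_nonneg (by linarith), abs_sub_comm]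
      exact (hm _ _ _ h).trans (le_abs_self _)
  have hlow : ∀ z w : Pl, dist z w ≤ max (max L 1) ((1 + L)/c) * dist (X z, z.2) (X w, w.2) := by
    intro z w
    set d := dist (X z, z.2) (X w, w.2) with hd
    have a1 : |X z - X w| ≤ d := d1 (X z, z.2) (X w, w.2)
    have a2 : |z.2 - w.2| ≤ d := d2 (X z, z.2) (X w, w.2)
    have hd0 : 0 ≤ d := dist_nonneg
    rw [dist_pl]
    apply max_le
    · have h1 := habs w.1 z.1 z.2
      have h2 : |X (z.1, z.2) - X (w.1, z.2)| ≤ |X z - X w| + |X w - X (w.1, z.2)| := abs_sub_le _ _ _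
      have h3 := hX w (w.1, z.2)
      rw [Real.dist_eq, dist_pl] at h3
      simp only [sub_self, abs_zero] at h3
      rw [max_eq_right (abs_nonneg _), abs_sub_comm w.2] at h3
      have h4 : c * |z.1 - w.1| ≤ (1 + L) * d := by nlinarith
      calc |z.1 - w.1| ≤ (1+L)/c * d := by
            rw [div_mul_eq_mul_div, le_div_iff₀ hc]; linarith
        _ ≤ _ := mul_le_mul_of_nonneg_right (le_max_right _ _) hd0
    · calc |z.2 - w.2| ≤ 1 * d := by linarith
        _ ≤ _ := mul_le_mul_of_nonneg_right (le_max_of_le_left (le_max_right _ _)) hd0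
  have hbij : Function.Bijective (fun z : Pl => ((X z, z.2) : Pl)) := by
    constructor
    · intro z w hzw
      have := hlow z w
      simp only at hzw
      rw [hzw, dist_self, mul_zero] at this
      exact dist_le_zero.1 this
    · rintro ⟨u, y⟩
      have hcont : Continuous (fun x => X (x, y)) := hX.continuous.comp (by fun_prop)
      have hs : Function.Surjective (fun x => X (x, y)) := by
        apply hcont.surjective
        · apply tendsto_atTop_mono' atTop (f₁ := fun x => X (0, y) + c * x)
          · filter_upwards [eventually_ge_atTop 0] with x hx
            have := hm 0 x y hx; linarith
          · exact tendsto_atTop_add_const_left _ _ (tendsto_id.const_mul_atTop hc)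
        · apply tendsto_atBot_mono' atBot (f₂ := fun x => X (x, y)) (f₁ := fun x => X (0, y) + c * x)
          · filter_upwards [eventually_le_atBot 0] with x hx
            have := hm x 0 y hx; linarith
          · exact tendsto_atBot_add_const_left _ _ (tendsto_id.const_mul_atBot hc)
      obtain ⟨x, hx⟩ := hs u
      exact ⟨(x, y), by simp only at hx ⊢; rw [hx]⟩
  refine ⟨Equiv.ofBijective _ hbij, ⟨?_, ?_⟩, fun z => rfl⟩
  · intro z w
    simp only [Equiv.ofBijective_apply]
    rw [dist_pl]
    have hd0 : 0 ≤ dist z w := dist_nonneg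
    apply max_le
    · have := hX z w
      rw [Real.dist_eq] at this
      exact this.trans (mul_le_mul_of_nonneg_right (le_max_of_le_left (le_max_left _ _)) hd0)
    · calc |z.2 - w.2| ≤ 1 * dist z w := by linarith [d2 z w]
        _ ≤ _ := mul_le_mul_of_nonneg_right (le_max_of_le_left (le_max_right _ _)) hd0
  · intro z w
    obtain ⟨z, rfl⟩ := (Equiv.ofBijective _ hbij).surjective z
    obtain ⟨w, rfl⟩ := (Equiv.ofBijective _ hbij).surjective w
    rw [Equiv.symm_apply_apply, Equiv.symm_apply_apply]
    exact hlow z w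

theorem dist_swap (z w : Pl) : dist z.swap w.swap = dist z w := by
  rw [dist_pl, dist_pl, max_comm]; rfl

/-- fiber lemma, vertical -/
theorem fiberV (L c : ℝ) (hL : 0 ≤ L) (hc : 0 < c) : ∃ C, 1 ≤ C ∧ ∀ Y : Pl → ℝ, Lip L Y →
    (∀ x y1 y2, y1 ≤ y2 → c * (y2 - y1) ≤ Y (x, y2) - Y (x, y1)) →
    ∃ F : Pl ≃ Pl, BL C F ∧ ∀ z, F z = (z.1, Y z) := by
  obtain ⟨C, hC, H⟩ := fiberH L c hL hc
  refine ⟨C, hC, fun Y hY hm => ?_⟩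
  obtain ⟨F, hF, hFz⟩ := H (fun z => Y z.swap) (fun z w => by
    have := hY z.swap w.swap; rwa [dist_swap] at this) (fun x1 x2 y h => hm y x1 x2 h)
  refine ⟨(Equiv.prodComm ℝ ℝ).trans (F.trans (Equiv.prodComm ℝ ℝ)), ⟨?_, ?_⟩, ?_⟩
  · intro z w
    simp only [Equiv.trans_apply, Equiv.coe_prodComm, dist_swap]
    have := hF.1 z.swap w.swap; rwa [dist_swap] at this
  · intro z w
    simp only [Equiv.symm_trans_apply, Equiv.prodComm_symm, Equiv.coe_prodComm, dist_swap]
    have := hF.2 z.swap w.swap; rwa [dist_swap] at this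
  · intro z
    simp [hFz]

/-- gluing rows of height `K` -/
theorem glue {K C : ℝ} (hK : 0 < K) (F : ℤ → Pl ≃ Pl) (hC : 0 ≤ C) (hF : ∀ j, BL C (F j))
    (hid : ∀ (j : ℤ) (z : Pl), K/2 ≤ |z.2 - K * j| → F j z = z) :
    ∃ Γ : Pl ≃ Pl, BL (2*C+1) Γ ∧ ∀ (j : ℤ) (z : Pl), |z.2 - K * j| ≤ K/2 → Γ z = F j z := by
  have hsep : ∀ (z : Pl) (i j : ℤ), |z.2 - K*i| ≤ K/2 → i ≠ j → K/2 ≤ |z.2 - K*j| := by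
    intro z i j h hij
    have h1 : (1:ℝ) ≤ |(i:ℝ) - j| := by
      have : 1 ≤ |i - j| := Int.one_le_abs (sub_ne_zero.2 hij)
      exact_mod_cast this
    have h2 : K ≤ |K * i - K * j| := by
      rw [← mul_sub, abs_mul, abs_of_pos hK]; nlinarith
    have h3 := abs_sub_abs_le_abs_sub (K*i - K*j) (K*i - z.2)
    rw [show K*i - K*j - (K*i - z.2) = z.2 - K*j by ring, abs_sub_comm (K*i : ℝ) z.2] at h3
    linarith
  have hround : ∀ z : Pl, |z.2 - K * (round (z.2 / K) : ℤ)| ≤ K/2 := by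
    intro z
    have := abs_sub_round (z.2 / K)
    have h2 : z.2 - K * (round (z.2 / K) : ℤ) = K * (z.2/K - round (z.2/K)) := by field_simp
    rw [h2, abs_mul, abs_of_pos hK]; nlinarith
  have hid' : ∀ (j : ℤ) (z : Pl), K/2 ≤ |z.2 - K * j| → (F j).symm z = z := by
    intro j z h
    rw [Equiv.symm_apply_eq, hid j z h]
  -- generic statement for families of functions
  have gen : ∀ f : ℤ → Pl → Pl, (∀ j, Lip C (f j)) → (∀ (j : ℤ) (z : Pl), K/2 ≤ |z.2 - K * j| → f j z = z) →
      (∀ (j : ℤ) (z : Pl), |z.2 - K * j| ≤ K/2 → f (round (z.2/K)) z = f j z) ∧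
      Lip (2*C+1) (fun z => f (round (z.2/K)) z) := by
    intro f hf hfid
    have A : (∀ (j : ℤ) (z : Pl), |z.2 - K * j| ≤ K/2 → f (round (z.2/K)) z = f j z) := by
      intro j z h
      by_cases hj : round (z.2/K) = j
      · rw [hj]
      · rw [hfid j z (hsep z _ _ (hround z) hj), hfid _ z (hsep z _ _ h (Ne.symm hj))]
    refine ⟨A, fun z w => ?_⟩
    simp only
    set j := round (z.2/K) with hj
    set i := round (w.2/K) with hi
    have hd : 0 ≤ dist z w := dist_nonneg
    by_cases hij : i = j
    · rw [hij]; have := hf j z w; nlinarith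
    · have e1 : f j w = w := hfid j w (hsep w _ _ (hround w) hij)
      have e2 : f i z = z := hfid i z (hsep z _ _ (hround z) (Ne.symm hij))
      have t := dist_triangle4 (f j z) w z (f i w)
      have h1 := hf j z w
      have h2 := hf i z w
      rw [e1] at h1; rw [e2] at h2
      rw [dist_comm w z] at t
      linarith
  have hpres : ∀ (j : ℤ) (z : Pl), |z.2 - K*j| ≤ K/2 → |(F j z).2 - K*j| ≤ K/2 := by
    intro j z h
    by_contra hc
    push Not at hc
    have := hid' j _ hc.le
    rw [Equiv.symm_apply_apply] at this
    rw [← this] at hc; linarith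
  have hpres' : ∀ (j : ℤ) (z : Pl), |z.2 - K*j| ≤ K/2 → |((F j).symm z).2 - K*j| ≤ K/2 := by
    intro j z h
    by_contra hc
    push Not at hc
    have := hid j _ hc.le
    rw [Equiv.apply_symm_apply] at this
    rw [← this] at hc; linarith
  obtain ⟨A, B⟩ := gen (fun j => F j) (fun j => (hF j).1) hid
  obtain ⟨A', B'⟩ := gen (fun j => (F j).symm) (fun j => (hF j).2) hid'
  refine ⟨⟨fun z => F (round (z.2/K)) z, fun z => (F (round (z.2/K))).symm z, ?_, ?_⟩, ⟨B, B'⟩, A⟩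
  · intro z
    simp only
    rw [A' _ _ (hpres _ z (hround z)), Equiv.symm_apply_apply]
  · intro z
    simp only
    rw [A _ _ (hpres' _ z (hround z)), Equiv.apply_symm_apply]

end BHW

-- ===== Part 3 =====
open Set Metric Filter MeasureTheory
open scoped ENNReal Topology NNReal

namespace BHW

def sg (b : Bool) : ℝ := if b then 1 else -1

@[simp] theorem sg_true : sg true = 1 := rfl
@[simp] theorem sg_false : sg false = -1 := rfl
theorem sg_not (b : Bool) : sg (!b) = - sg b := by cases b <;> simp

/-- quadratic form `q_σ` -/
def qf (h s : ℝ) (v : Pl) : ℝ := (1 - s * h) * v.1 ^ 2 + (1 + s * h) * v.2 ^ 2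

theorem qf_Bm {h s e : ℝ} (hs : s = 1 ∨ s = -1) (he : e = 1 ∨ e = -1) (v : Pl) :
    qf h s ((Bm e (s * h)).ap v) = qf h (-s) v := by
  simp only [qf, Bm, Mt.ap]
  rcases hs with rfl | rfl <;> rcases he with rfl | rfl <;> ring

theorem qf_Bm' {h : ℝ} (s : Bool) {e : ℝ} (he : e = 1 ∨ e = -1) (v : Pl) :
    qf h (sg s) ((Bm e (sg s * h)).ap v) = qf h (sg (!s)) v := by
  rw [sg_not]; exact qf_Bm (by cases s <;> simp) he v

theorem qf_smul (h s t : ℝ) (v : Pl) : qf h s (t • v) = t ^ 2 * qf h s v := by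
  simp only [qf, Prod.smul_fst, Prod.smul_snd, smul_eq_mul]; ring

theorem nrm1 (v : Pl) : |v.1| ≤ ‖v‖ := by
  rw [← Real.norm_eq_abs]; exact norm_fst_le v
theorem nrm2 (v : Pl) : |v.2| ≤ ‖v‖ := by
  rw [← Real.norm_eq_abs]; exact norm_snd_le v

theorem nrm_le (v : Pl) {b : ℝ} (h1 : |v.1| ≤ b) (h2 : |v.2| ≤ b) : ‖v‖ ≤ b := by
  rw [Prod.norm_def, Real.norm_eq_abs, Real.norm_eq_abs]; exact max_le h1 h2

theorem qf_le {h : ℝ} (h0 : 0 ≤ h) (h1 : h ≤ 3/4) (s : Bool) (v : Pl) :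
    qf h (sg s) v ≤ 4 * ‖v‖ ^ 2 := by
  have a1 := sq_le_sq' (abs_le.1 (nrm1 v)).1 (abs_le.1 (nrm1 v)).2
  have a2 := sq_le_sq' (abs_le.1 (nrm2 v)).1 (abs_le.1 (nrm2 v)).2
  cases s <;> simp only [qf, sg_true, sg_false] <;> nlinarith [sq_nonneg v.1, sq_nonneg v.2]

theorem qf_ge {h : ℝ} (h0 : 0 ≤ h) (h1 : h ≤ 3/4) (s : Bool) (v : Pl) :
    ‖v‖ ^ 2 ≤ 4 * qf h (sg s) v := by
  have key : v.1 ^ 2 ≤ 4 * qf h (sg s) v ∧ v.2 ^ 2 ≤ 4 * qf h (sg s) v := by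
    constructor <;> cases s <;> simp only [qf, sg_true, sg_false] <;>
      nlinarith [sq_nonneg v.1, sq_nonneg v.2]
  have hn : ‖v‖ = |v.1| ∨ ‖v‖ = |v.2| := by
    rw [Prod.norm_def, Real.norm_eq_abs, Real.norm_eq_abs]; exact max_choice _ _
  rcases hn with h | h <;> rw [h, sq_abs]
  exacts [key.1, key.2]

theorem Bm_up {e η : ℝ} (he : e = 1 ∨ e = -1) (hη : |η| ≤ 1) (v : Pl) :
    ‖(Bm e η).ap v‖ ≤ 3 * ‖v‖ := by
  have a1 := nrm1 v
  have a2 := nrm2 v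
  have hd : |v.1 - e * v.2| ≤ 2 * ‖v‖ := by
    rw [abs_le] at *
    rcases he with rfl | rfl <;> constructor <;> linarith
  have h3 : |η * (v.1 - e * v.2)| ≤ 2 * ‖v‖ := by
    rw [abs_mul]; nlinarith [abs_nonneg (v.1 - e * v.2)]
  have e1 : (Bm e η).ap v = (v.1 + η * (v.1 - e * v.2), v.2 + e * (η * (v.1 - e * v.2))) := by
    simp only [Bm, Mt.ap, Prod.mk.injEq]
    rcases he with rfl | rfl <;> constructor <;> ring
  rw [e1]
  apply nrm_le
  · exact (abs_add_le _ _).trans (by linarith)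
  · refine (abs_add_le _ _).trans ?_
    rw [abs_mul]
    have : |e| = 1 := by rcases he with rfl | rfl <;> simp
    rw [this]; linarith

theorem Bm_inv {e η : ℝ} (he : e = 1 ∨ e = -1) (v : Pl) : (Bm e (-η)).ap ((Bm e η).ap v) = v := by
  simp only [Bm, Mt.ap]
  rcases he with rfl | rfl <;> ext <;> simp <;> ring

theorem Bm_low {e η : ℝ} (he : e = 1 ∨ e = -1) (hη : |η| ≤ 1) (v : Pl) :
    ‖v‖ ≤ 3 * ‖(Bm e η).ap v‖ := by
  have := Bm_up he (η := -η) (by rwa [abs_neg]) ((Bm e η).ap v)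
  rwa [Bm_inv he] at this

/-- conformal row of scale `S` -/
structure ConfRow (h S : ℝ) (g : Pl → Pl) (D : ℤ → Mt) (e : ℤ → ℤ) (η : ℤ → ℝ) (σ : ℤ → Bool) :
    Prop where
  row : TileRow g D e η
  hη : ∀ l, (η l = 0 ∧ σ l = σ (l - 1)) ∨ (η l = sg (σ (l - 1)) * h ∧ σ l = !(σ (l - 1)))
  hq : ∀ l v, qf h 1 ((D l).ap v) = S ^ 2 * qf h (sg (σ l)) v

namespace ConfRow
variable {h S : ℝ} {g : Pl → Pl} {D : ℤ → Mt} {e : ℤ → ℤ} {η : ℤ → ℝ} {σ : ℤ → Bool}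

theorem D_bds (R : ConfRow h S g D e η σ) (h0 : 0 ≤ h) (h1 : h ≤ 3/4) (hS : 0 < S) (l : ℤ) (v : Pl) :
    ‖(D l).ap v‖ ≤ 4 * S * ‖v‖ ∧ S * ‖v‖ ≤ 4 * ‖(D l).ap v‖ := by
  have hq := R.hq l v
  have a1 := qf_le h0 h1 (σ l) v
  have a2 := qf_ge h0 h1 (σ l) v
  have b1 := qf_le h0 h1 true ((D l).ap v)
  have b2 := qf_ge h0 h1 true ((D l).ap v)
  simp only [sg_true] at b1 b2
  have hS2 : 0 < S ^ 2 := by positivity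
  constructor
  · apply le_of_sq_le_sq₀ _ (by positivity)
    nlinarith
  · apply le_of_sq_le_sq₀ _ (by positivity)
    nlinarith
where
  le_of_sq_le_sq₀ {a b : ℝ} (hh : a ^ 2 ≤ b ^ 2) (hb : 0 ≤ b) : a ≤ b := by
    exact le_of_abs_le (abs_le_of_sq_le_sq hh hb)

theorem loc (R : ConfRow h S g D e η σ) (h0 : 0 ≤ h) (h1 : h ≤ 3/4) (hS : 0 < S) (z w : Pl)
    (h2 : |z.2| ≤ 1/2) (h4 : |w.2| ≤ 1/2) (h5 : |z.1 - w.1| ≤ 1/2) :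
    dist (g z) (g w) ≤ 12 * S * dist z w ∧ S * dist z w ≤ 12 * dist (g z) (g w) := by
  obtain ⟨l, τ, t0, t1, ht⟩ := R.row.LL z w h2 h4 h5
  rw [dist_comm (g z), dist_comm z, dist_eq_norm, dist_eq_norm, ht]
  have hη : |τ * η l| ≤ 1 := by
    rcases R.hη l with ⟨h, _⟩ | ⟨h, _⟩
    · rw [h]; simp
    · rw [h, abs_mul, abs_of_nonneg t0, abs_mul]
      have : |sg (σ (l-1))| = 1 := by cases σ (l-1) <;> simp
      rw [this, abs_of_nonneg h0]; nlinarith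
  obtain ⟨a1, a2⟩ := R.D_bds h0 h1 hS (l-1) ((Bm (e l) (τ * η l)).ap (w - z))
  have b1 := Bm_up (R.row.heR l) hη (w - z)
  have b2 := Bm_low (R.row.heR l) hη (w - z)
  constructor <;> nlinarith

theorem up (R : ConfRow h S g D e η σ) (h0 : 0 ≤ h) (h1 : h ≤ 3/4) (hS : 0 < S) (z w : Pl)
    (h2 : |z.2| ≤ 1/2) (h4 : |w.2| ≤ 1/2) :
    dist (g z) (g w) ≤ 12 * S * dist z w := by
  have hconv : Convex ℝ {z : Pl | |z.2| ≤ 1/2} := by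
    have : {z : Pl | |z.2| ≤ 1/2} = (univ : Set ℝ) ×ˢ (Icc (-(1/2)) (1/2) : Set ℝ) := by
      ext z; simp only [mem_setOf_eq, abs_le, mem_prod, mem_univ, true_and, mem_Icc]
    rw [this]; exact convex_univ.prod (convex_Icc _ _)
  refine chain_upper hconv g (r := 1/2) (by norm_num) ?_ z w h2 h4
  intro x hx y hy hxy
  exact (R.loc h0 h1 hS x y hx hy ((d1 x y).trans hxy)).1

end ConfRow
end BHW

-- ===== Part 4 =====
open Set Metric Filter MeasureTheory
open scoped ENNReal Topology NNReal

namespace BHW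

/-- tile map from data -/
noncomputable def mk (P : ℤ → Pl) (D : ℤ → Mt) (e : ℤ → ℤ) (η : ℤ → ℝ) (z : Pl) : Pl :=
  P (round z.1) + (D (round z.1 - 1)).ap (bd (e (round z.1)) (η (round z.1)) (z.1 - round z.1, z.2))

theorem mk_row {P : ℤ → Pl} {D : ℤ → Mt} {e : ℤ → ℤ} {η : ℤ → ℝ}
    (he : ∀ l, e l = 1 ∨ e l = -1)
    (hD : ∀ l, D l = (D (l - 1)).mu (Bm (e l) (η l)))
    (hadj : ∀ l, η l = 0 ∨ η (l + 1) = 0)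
    (hP : ∀ l, P (l + 1) = P l + (D l).ap (1, 0)) :
    TileRow (mk P D e η) D e η ∧ ∀ l : ℤ, mk P D e η (l, 0) = P l := by
  have hc : ∀ l : ℤ, mk P D e η (l, 0) = P l := by
    intro l
    simp only [mk, round_intCast, sub_self]
    simp [bd, Mt.ap]
  have heR : ∀ l, (e l : ℝ) = 1 ∨ (e l : ℝ) = -1 := by
    intro l; rcases he l with h | h <;> simp [h]
  refine ⟨⟨he, hD, hadj, ?_⟩, hc⟩
  intro m w h1 h2
  rw [hc]
  rw [abs_le] at h1
  rcases eq_or_lt_of_le h1.2 with h3 | h3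
  · have hr : round ((m:ℝ) + w.1) = m + 1 := by
      rw [round_eq, Int.floor_eq_iff, h3]; push_cast; constructor <;> linarith
    have hb : |(e m : ℝ) * w.2| ≤ 1/2 := by
      rw [abs_mul]; rcases heR m with h | h <;> rw [h] <;> simpa using h2
    have hb' : |(e (m+1) : ℝ) * w.2| ≤ 1/2 := by
      rw [abs_mul]; rcases heR (m+1) with h | h <;> rw [h] <;> simpa using h2
    rw [abs_le] at hb hb'
    simp only [mk, hr]
    rw [bd_inact (by push_cast; linarith [hb'.1]), bd_act (heR m) (by linarith [hb.2]),
      ← Mt.ap_mu, ← hD, hP, add_sub_cancel_right, add_assoc, ← Mt.ap_add]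
    congr 2
    ext <;> simp <;> try ring
  · have hr : round ((m:ℝ) + w.1) = m := by
      rw [round_eq, Int.floor_eq_iff]; constructor <;> linarith
    simp only [mk, hr, add_sub_cancel_left]

/-- letters -/
inductive St | I | P | U | M | V

def mat (t : ℝ) : St → Mt
  | .I => ⟨1, 0, 0, 1⟩
  | .P => Bm 1 t
  | .U => (Bm 1 t).mu (Bm (-1) (-t))
  | .M => Bm (-1) t
  | .V => (Bm (-1) t).mu (Bm 1 (-t))

def sgn (s : Bool) : St → Bool
  | .I => s
  | .P => !s
  | .U => s
  | .M => !s
  | .V => s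

def tr : St → St → ℤ × ℤ
  | .I, .P => (1, 1)
  | .P, .U => (-1, -1)
  | .U, .P => (-1, 1)
  | .P, .I => (1, -1)
  | .I, .M => (-1, 1)
  | .M, .V => (1, -1)
  | .V, .M => (1, 1)
  | .M, .I => (-1, -1)
  | _, _ => (1, 0)

def ok (a b : St) : Prop := a = b ∨ (tr a b).2 ≠ 0

theorem tr_e (a b : St) : (tr a b).1 = 1 ∨ (tr a b).1 = -1 := by
  cases a <;> cases b <;> simp [tr]

theorem tr_self (a : St) : tr a a = (1, 0) := by cases a <;> rfl

theorem tr_mat (t : ℝ) {a b : St} (h : ok a b) :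
    mat t b = (mat t a).mu (Bm ((tr a b).1 : ℤ) (((tr a b).2 : ℤ) * t)) := by
  rcases h with rfl | h
  · rw [tr_self]; simp [Bm_zero]
  · cases a <;> cases b <;> simp [tr] at h <;> ext <;> simp [tr, mat, Mt.mu, Bm] <;> ring

theorem tr_sgn (h : ℝ) (s : Bool) {a b : St} (hab : ok a b) :
    ((((tr a b).2 : ℤ) : ℝ) * (sg s * h) = 0 ∧ sgn s b = sgn s a) ∨
    ((((tr a b).2 : ℤ) : ℝ) * (sg s * h) = sg (sgn s a) * h ∧ sgn s b = !(sgn s a)) := by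
  rcases hab with rfl | hab
  · left; rw [tr_self]; simp
  · right; cases a <;> cases b <;> simp [tr] at hab <;> simp [tr, sgn, sg_not]

theorem qf_mat (h : ℝ) (s : Bool) (a : St) (v : Pl) :
    qf h (sg s) ((mat (sg s * h) a).ap v) = qf h (sg (sgn s a)) v := by
  cases a
  · simp [mat, sgn, Mt.ap]
  · exact qf_Bm' s (by norm_num) v
  · have h2 := qf_Bm' (h := h) (!s) (e := -1) (by norm_num) v
    have h1 := qf_Bm' (h := h) s (e := 1) (by norm_num) ((Bm (-1) (-(sg s * h))).ap v)
    rw [sg_not, neg_mul, Bool.not_not, ← sg_not] at h2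
    simp only [mat, sgn]
    rw [Mt.ap_mu, h1, h2]
  · exact qf_Bm' s (by norm_num) v
  · have h2 := qf_Bm' (h := h) (!s) (e := 1) (by norm_num) v
    have h1 := qf_Bm' (h := h) s (e := -1) (by norm_num) ((Bm 1 (-(sg s * h))).ap v)
    rw [sg_not, neg_mul, Bool.not_not, ← sg_not] at h2
    simp only [mat, sgn]
    rw [Mt.ap_mu, h1, h2]

theorem mat_bd {t : ℝ} (ht : 2 * t ^ 2 < 1) (a : St) : |(mat t a).a| ≤ 3 ∧ |(mat t a).b| ≤ 3 ∧
    |(mat t a).c| ≤ 3 ∧ |(mat t a).d| ≤ 3 := by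
  have h1 : t ≤ 3/4 := by nlinarith
  have h2 : -(3/4) ≤ t := by nlinarith
  have h3 := sq_nonneg t
  cases a <;> simp only [mat, Bm, Mt.mu, abs_le] <;> refine ⟨⟨?_, ?_⟩, ⟨?_, ?_⟩, ⟨?_, ?_⟩, ?_, ?_⟩ <;>
    nlinarith

theorem mat_pos {t : ℝ} (ht : 2 * t ^ 2 < 1) (a : St) : (1 - 2 * t ^ 2) / 4 ≤ (mat t a).a := by
  have h1 : t ≤ 3/4 := by nlinarith
  have h2 : -(3/4) ≤ t := by nlinarith
  cases a <;> simp only [mat, Bm, Mt.mu] <;> nlinarith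

theorem mat_det (t : ℝ) (a : St) : (mat t a).a * (mat t a).d - (mat t a).b * (mat t a).c = 1 := by
  cases a <;> simp only [mat, Bm, Mt.mu] <;> ring

/-- first column -/
def col (t : ℝ) (a : St) : Pl := (mat t a).ap (1, 0)

noncomputable def Ts (t : ℝ) (st : ℕ → St) (k : ℕ) : Pl := ∑ m ∈ Finset.range k, col t (st m)

/-- fine partial sum -/
noncomputable def Ss (t : ℝ) (st : ℕ → St) (o : ℕ) : Pl :=
  ∑ m ∈ Finset.range o, col t (st (m / 3))

theorem Ss_three (t : ℝ) (st : ℕ → St) (k : ℕ) : Ss t st (3 * k) = (3:ℝ) • Ts t st k := by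
  induction k with
  | zero => simp [Ss, Ts]
  | succ k ih =>
    have : 3 * (k+1) = 3 * k + 1 + 1 + 1 := by ring
    unfold Ss Ts at *
    rw [this, Finset.sum_range_succ, Finset.sum_range_succ, Finset.sum_range_succ, ih,
      Finset.sum_range_succ, smul_add, show (3 * k) / 3 = k by omega,
      show (3 * k + 1) / 3 = k by omega, show (3 * k + 1 + 1) / 3 = k by omega]
    rw [add_assoc, add_assoc]; congr 1
    module

structure WD (h lam : ℝ) (Kp : ℕ) (s : Bool) (A : ℕ) (b : ℝ) (st : ℕ → St) : Prop where
  ok : ∀ k, ok (st k) (st (k + 1))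
  fst : ∀ k, k ≤ A → st k = .I
  lst : ∀ k, Kp ≤ k + A + 1 → st k = .I
  tot : lam • Ts (sg s * h) st Kp = ((Kp : ℝ), 0)
  ybd : ∀ k, k ≤ Kp → |(Ts (sg s * h) st k).2| ≤ b
  bA : 3 * b + 12 ≤ 3 * A
  big : 2 * A + 1 ≤ Kp
  lam1 : 1 ≤ lam

end BHW

-- ===== Part 5 =====
open Set Metric Filter MeasureTheory
open scoped ENNReal Topology NNReal

namespace BHW

theorem col_I (t : ℝ) : col t .I = (1, 0) := by simp [col, mat, Mt.ap]

theorem Ss_succ (t : ℝ) (st : ℕ → St) (o : ℕ) : Ss t st (o+1) = Ss t st o + col t (st (o/3)) := by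
  simp [Ss, Finset.sum_range_succ]

theorem Ts_succ (t : ℝ) (st : ℕ → St) (o : ℕ) : Ts t st (o+1) = Ts t st o + col t (st o) := by
  simp [Ts, Finset.sum_range_succ]

theorem Ss_mono {t : ℝ} (ht : 2 * t ^ 2 < 1) (st : ℕ → St) : Monotone (fun o => (Ss t st o).1) := by
  apply monotone_nat_of_le_succ
  intro o
  rw [Ss_succ]
  have := mat_pos ht (st (o/3))
  simp only [col, Mt.ap, Prod.fst_add]
  linarith

namespace WD
variable {h lam b : ℝ} {Kp : ℕ} {s : Bool} {A : ℕ} {st : ℕ → St}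

theorem fstS (W : WD h lam Kp s A b st) (o : ℕ) (ho : o ≤ 3 * A + 3) :
    Ss (sg s * h) st o = ((o:ℝ), 0) := by
  induction o with
  | zero => simp [Ss]; rfl
  | succ o ih =>
    rw [Ss_succ, ih (by omega), W.fst _ (by omega), col_I]
    simp

theorem SK (W : WD h lam Kp s A b st) : lam • Ss (sg s * h) st (3*Kp) = ((3 * Kp : ℝ), 0) := by
  rw [Ss_three, smul_comm, W.tot]; simp

theorem lstS (W : WD h lam Kp s A b st) (j : ℕ) (hj : j ≤ 3 * A + 3) (hj2 : j ≤ 3 * Kp) :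
    Ss (sg s * h) st (3*Kp - j) = Ss (sg s * h) st (3*Kp) - ((j:ℝ), 0) := by
  induction j with
  | zero => simp only [Nat.sub_zero, Nat.cast_zero]; rw [show ((0:ℝ),(0:ℝ)) = 0 from rfl, sub_zero]
  | succ j ih =>
    have h1 := ih (by omega) (by omega)
    have h2 := Ss_succ (sg s * h) st (3*Kp - (j+1))
    rw [show 3*Kp - (j+1) + 1 = 3*Kp - j by omega, W.lst _ (by omega), col_I, h1] at h2
    have h3 : Ss (sg s * h) st (3*Kp - (j+1)) = Ss (sg s * h) st (3*Kp) - ((j:ℝ), 0) - (1, 0) := by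
      rw [h2]; abel
    rw [h3]; ext <;> simp; ring

theorem yS (W : WD h lam Kp s A b st) (o : ℕ) (ho : o < 3 * Kp) :
    |(Ss (sg s * h) st o).2| ≤ 3 * b := by
  have a1 := W.ybd (o/3) (by omega)
  have a2 := W.ybd (o/3+1) (by omega)
  set T := Ts (sg s * h) st with hT
  have hs : T (o/3+1) = T (o/3) + col (sg s * h) (st (o/3)) := Ts_succ _ _ _
  have h3 := Ss_three (sg s * h) st (o/3)
  have hs2 : (T (o/3+1)).2 = (T (o/3)).2 + (col (sg s * h) (st (o/3))).2 := by rw [hs]; rfl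
  rw [abs_le] at *
  have hr : o % 3 = 0 ∨ o % 3 = 1 ∨ o % 3 = 2 := by omega
  rcases hr with hr | hr | hr
  · rw [show o = 3 * (o/3) by omega, h3]
    simp only [Prod.smul_snd, smul_eq_mul]
    constructor <;> linarith
  · have e1 : Ss (sg s * h) st o = (3:ℝ) • T (o/3) + col (sg s * h) (st (o/3)) := by
      conv_lhs => rw [show o = 3 * (o/3) + 1 by omega]
      rw [Ss_succ, h3, show (3 * (o/3))/3 = o/3 by omega]
    rw [e1]
    simp only [Prod.snd_add, Prod.smul_snd, smul_eq_mul]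
    constructor <;> linarith
  · have e1 : Ss (sg s * h) st o = (3:ℝ) • T (o/3) + col (sg s * h) (st (o/3))
        + col (sg s * h) (st (o/3)) := by
      conv_lhs => rw [show o = 3 * (o/3) + 1 + 1 by omega]
      rw [Ss_succ, Ss_succ, h3, show (3 * (o/3))/3 = o/3 by omega,
        show (3 * (o/3) + 1)/3 = o/3 by omega]
    rw [e1]
    simp only [Prod.snd_add, Prod.smul_snd, smul_eq_mul]
    constructor <;> linarith

theorem sq_lt {h : ℝ} (s : Bool) (hh : 2 * h ^ 2 < 1) : 2 * (sg s * h) ^ 2 < 1 := by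
  cases s <;> simpa using hh

theorem totx (W : WD h lam Kp s A b st) (hh : 2 * h ^ 2 < 1) :
    6 * A + 3 ≤ (Ss (sg s * h) st (3*Kp)).1 := by
  have h1 := W.fstS (3*A) (by omega)
  have h2 := W.lstS (3*A+3) le_rfl (by have := W.big; omega)
  have h3 := Ss_mono (sq_lt s hh) st (show 3*A ≤ 3*Kp - (3*A+3) by have := W.big; omega)
  simp only [h1, h2] at h3
  simp at h3
  linarith

theorem region (W : WD h lam Kp s A b st) (hh : 2 * h ^ 2 < 1) (o : ℕ) (h1 : 1 ≤ o)
    (h2 : o < 3 * Kp) (k : ℕ) (hk : k = (o-1)/3 ∨ k = o/3) (w : Pl) (hw1 : |w.1| ≤ 1/2)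
    (hw2 : |w.2| ≤ 1/2) (Q : Pl)
    (hQ : Q = lam • Ss (sg s * h) st o + (Mt.sc lam (mat (sg s * h) (st k))).ap w) :
    |Q.2| ≤ Q.1 ∧ |Q.2| ≤ 3 * Kp - Q.1 ∧ |Q.2| ≤ (3 * Kp - 3 * lam) / 2 := by
  have l1 := W.lam1
  have htot := W.totx hh
  have hSK := congrArg Prod.fst W.SK
  simp only [Prod.smul_fst, smul_eq_mul] at hSK
  have fS := W.fstS
  have lS := W.lstS
  have yS0 := W.yS
  have SK0 := W.SK
  have hmono := Ss_mono (sq_lt s hh) st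
  set S := Ss (sg s * h) st with hS
  have hcore : ∀ R : Pl, Q = lam • R → |R.2| ≤ R.1 → |R.2| ≤ (S (3*Kp)).1 - R.1 →
      |R.2| ≤ 3 * A → |Q.2| ≤ Q.1 ∧ |Q.2| ≤ 3 * Kp - Q.1 ∧ |Q.2| ≤ (3 * Kp - 3 * lam) / 2 := by
    intro R hR r1 r2 r3
    have hl : 0 ≤ lam := by linarith
    rw [hR]
    simp only [Prod.smul_fst, Prod.smul_snd, smul_eq_mul, abs_mul, abs_of_nonneg hl]
    refine ⟨mul_le_mul_of_nonneg_left r1 hl, ?_, ?_⟩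
    · rw [← hSK]; nlinarith
    · rw [← hSK]; nlinarith
  have hA : (0:ℝ) ≤ A := by positivity
  have h1R : (1:ℝ) ≤ o := by exact_mod_cast h1
  have w1 := abs_le.1 hw1
  have b0 : 0 ≤ b := (abs_nonneg _).trans (W.ybd 0 (by omega))
  have hA12 := W.bA
  rcases le_or_gt o (3 * A + 2) with c1 | c1
  · rw [W.fst k (by omega), fS o (by omega)] at hQ
    refine hcore ((o:ℝ) + w.1, w.2) ?_ ?_ ?_ ?_
    · rw [hQ]; simp [mat, Mt.sc, Mt.ap]; ring
    · simp only; linarith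
    · simp only
      have : (o:ℝ) ≤ 3 * A + 2 := by exact_mod_cast c1
      linarith
    · simp only; linarith
  rcases le_or_gt (3*Kp) (o + 3 * A + 2) with c2 | c2
  · have e1 := lS (3*Kp - o) (by omega) (by omega)
    rw [show 3*Kp - (3*Kp - o) = o by omega] at e1
    rw [W.lst k (by omega), e1] at hQ
    have hj : (1:ℝ) ≤ ((3*Kp - o : ℕ) : ℝ) := by exact_mod_cast (show 1 ≤ 3*Kp - o by omega)
    have hj2 : ((3*Kp - o : ℕ) : ℝ) ≤ 3 * A + 2 := by
      exact_mod_cast (show 3*Kp - o ≤ 3 * A + 2 by omega)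
    have hy0 : (S (3*Kp)).2 = 0 := by
      have := congrArg Prod.snd SK0
      simp only [Prod.smul_snd, smul_eq_mul] at this
      rcases mul_eq_zero.1 this with h | h
      · linarith
      · exact h
    refine hcore ((S (3*Kp)).1 - ((3*Kp - o : ℕ) : ℝ) + w.1, w.2) ?_ ?_ ?_ ?_
    · rw [hQ]; simp only [mat, Mt.sc, Mt.ap, smul_sub]
      ext
      · simp; ring
      · simp [hy0]
    · simp only; linarith
    · simp only; linarith
    · simp only; linarith
  · have m1 := hmono (show 3 * A + 3 ≤ o by omega)
    have m2 := hmono (show o ≤ 3*Kp - (3*A+3) by omega)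
    simp only at m1 m2
    rw [fS _ le_rfl] at m1
    rw [lS (3*A+3) le_rfl (by omega)] at m2
    simp at m1 m2
    have yS := yS0 o h2
    obtain ⟨q1, q2, q3, q4⟩ := mat_bd (sq_lt s hh) (st k)
    set N := mat (sg s * h) (st k)
    have hx : |N.a * w.1 + N.b * w.2| ≤ 3 := by
      refine (abs_add_le _ _).trans ?_
      rw [abs_mul, abs_mul]
      nlinarith [abs_nonneg w.1, abs_nonneg w.2, abs_nonneg N.a, abs_nonneg N.b]
    have hy : |N.c * w.1 + N.d * w.2| ≤ 3 := by
      refine (abs_add_le _ _).trans ?_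
      rw [abs_mul, abs_mul]
      nlinarith [abs_nonneg w.1, abs_nonneg w.2, abs_nonneg N.c, abs_nonneg N.d]
    have hY : |(S o + N.ap w).2| ≤ 3 * b + 3 := by
      exact (abs_add_le _ _).trans (add_le_add yS hy)
    have hx' := abs_le.1 hx
    have hX : (S o + N.ap w).1 = (S o).1 + (N.a * w.1 + N.b * w.2) := rfl
    refine hcore (S o + N.ap w) ?_ ?_ ?_ ?_
    · rw [hQ, Mt.ap_sc, smul_add]
    · rw [hX]; linarith
    · rw [hX]; linarith
    · linarith

end WD
end BHW

-- ===== Part 6 =====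
open Set Metric Filter MeasureTheory
open scoped ENNReal Topology NNReal

namespace BHW

structure WRow (h lam : ℝ) (K : ℕ) (σ : ℤ → Bool) (G : Pl → Pl) (D : ℤ → Mt) (e : ℤ → ℤ)
    (η : ℤ → ℝ) (σ' : ℤ → Bool) : Prop where
  row : TileRow G D e η
  hη : ∀ (i : ℤ) (o : ℕ), 1 ≤ o → o < K →
    (η (K * i + o) = 0 ∧ σ' (K * i + o) = σ' (K * i + o - 1)) ∨
    (η (K * i + o) = sg (σ' (K * i + o - 1)) * h ∧ σ' (K * i + o) = !(σ' (K * i + o - 1)))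
  hη0 : ∀ i : ℤ, η (K * i) = 0
  D0 : ∀ (i : ℤ) (v : Pl), (D (K * i)).ap v = lam • v
  s0 : ∀ i : ℤ, σ' (K * i) = σ i
  s1 : ∀ i : ℤ, σ' (K * i - 1) = σ (i - 1)
  hq : ∀ (i : ℤ) (o : ℕ), o < K → ∀ v, qf h (sg (σ i)) ((D (K * i + o)).ap v) =
    lam ^ 2 * qf h (sg (σ' (K * i + o))) v
  cen : ∀ i : ℤ, G ((K:ℝ) * (i:ℝ), 0) = ((K:ℝ) * (i:ℝ), (0:ℝ))
  reg : ∀ (i : ℤ) (o : ℕ), 1 ≤ o → o < K → ∀ w : Pl, |w.1| ≤ 1/2 → |w.2| ≤ 1/2 →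
    |(G (K * i + o + w.1, w.2)).2| ≤ (G (K * i + o + w.1, w.2)).1 - K * i ∧
    |(G (K * i + o + w.1, w.2)).2| ≤ K * i + K - (G (K * i + o + w.1, w.2)).1
  ybd : ∀ z : Pl, |z.2| ≤ 1/2 → |(G z).2| ≤ (K - 3 * lam) / 2
  xbd : ∀ z : Pl, |z.2| ≤ 1/2 → |(G z).1 - z.1| ≤ K
  Da : ∀ l, lam * ((1 - 2 * h ^ 2) / 4) ≤ (D l).a
  Db : ∀ l, |(D l).a| ≤ lam * 3 ∧ |(D l).b| ≤ lam * 3 ∧ |(D l).c| ≤ lam * 3 ∧ |(D l).d| ≤ lam * 3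
  Dd : ∀ l, (D l).a * (D l).d - (D l).b * (D l).c = lam ^ 2
  ηn : ∀ i : ℤ, η (K * i + 1) = 0 ∧ η (K * i - 1) = 0
  lK : 4 * lam ≤ K

theorem dec (K : ℕ) (hK : 0 < K) (l : ℤ) : ∃ (i : ℤ) (o : ℕ), o < K ∧ l = K * i + o := by
  refine ⟨l / K, (l % K).toNat, ?_, ?_⟩
  · have h1 := Int.emod_nonneg l (show (K:ℤ) ≠ 0 by omega)
    have h2 := Int.emod_lt_of_pos l (show (0:ℤ) < K by omega)
    omega
  · have h1 := Int.emod_nonneg l (show (K:ℤ) ≠ 0 by omega)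
    rw [Int.toNat_of_nonneg h1]
    exact (Int.mul_ediv_add_emod l K).symm

theorem dec_div (K : ℕ) (i : ℤ) (o : ℕ) (ho : o < K) : (K * i + o : ℤ) / K = i := by
  rw [Int.add_comm, Int.add_mul_ediv_left _ _ (by omega), Int.ediv_eq_zero_of_lt (by omega) (by omega)]
  simp

theorem dec_mod (K : ℕ) (i : ℤ) (o : ℕ) (ho : o < K) : ((K * i + o : ℤ) % K).toNat = o := by
  rw [Int.add_comm, Int.add_mul_emod_self_left, Int.emod_eq_of_lt (by omega) (by omega)]
  simp

/-- build the word row -/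
theorem exists_WRow {h lam b : ℝ} {Kp : ℕ} {A : Bool → ℕ} {st : Bool → ℕ → St}
    (hh : 2 * h ^ 2 < 1) (W : ∀ s, WD h lam Kp s (A s) b (st s)) (hlK : lam ≤ 3 * Kp)
    (σ : ℤ → Bool) :
    ∃ G D e η σ', WRow h lam (3 * Kp) σ G D e η σ' := by
  have hK : 0 < 3 * Kp := by have := (W true).big; omega
  set K := 3 * Kp with hKdef
  have hKR : (K : ℝ) = 3 * Kp := by rw [hKdef]; push_cast; ring
  have l1 := (W true).lam1
  let s : ℤ → Bool := fun l => σ (l / K)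
  let n : ℤ → ℕ := fun l => (l % K).toNat
  let S : ℤ → St := fun l => st (s l) (n l / 3)
  let D : ℤ → Mt := fun l => Mt.sc lam (mat (sg (s l) * h) (S l))
  let P : ℤ → Pl := fun l => ((K:ℝ) * ((l / K : ℤ) : ℝ), 0) + lam • Ss (sg (s l) * h) (st (s l)) (n l)
  let T : ℤ → ℤ × ℤ := fun l => if n l = 0 then (1, 0) else tr (S (l - 1)) (S l)
  let e : ℤ → ℤ := fun l => (T l).1
  let η : ℤ → ℝ := fun l => ((T l).2 : ℝ) * (sg (s l) * h)
  let σ' : ℤ → Bool := fun l => sgn (s l) (S l)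
  have es : ∀ (i : ℤ) (o : ℕ), o < K → s (K * i + o) = σ i := fun i o ho => by
    simp only [s]; rw [dec_div K i o ho]
  have en : ∀ (i : ℤ) (o : ℕ), o < K → n (K * i + o) = o := fun i o ho => dec_mod K i o ho
  have eS : ∀ (i : ℤ) (o : ℕ), o < K → S (K * i + o) = st (σ i) (o / 3) := fun i o ho => by
    simp only [S]; rw [es i o ho, en i o ho]
  have em : ∀ (i : ℤ) (o : ℕ), 1 ≤ o → (K * i + o - 1 : ℤ) = K * i + (o - 1 : ℕ) :=
    fun i o ho => by omega
  have em0 : ∀ (i : ℤ), (K * i - 1 : ℤ) = K * (i - 1) + (K - 1 : ℕ) := fun i => by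
    rw [mul_sub]; omega
  have ec : ∀ (i : ℤ), (K * i : ℤ) = K * i + (0 : ℕ) := fun i => by simp
  have eT0 : ∀ i : ℤ, T (K * i) = (1, 0) := fun i => by
    simp only [T]; rw [ec i, en i 0 hK]; simp
  have eT : ∀ (i : ℤ) (o : ℕ), 1 ≤ o → o < K →
      T (K * i + o) = tr (st (σ i) ((o-1)/3)) (st (σ i) (o/3)) := fun i o h1 h2 => by
    simp only [T]
    rw [en i o h2, if_neg (by omega), eS i o h2, em i o h1, eS i _ (by omega)]
  have eη : ∀ (i : ℤ) (o : ℕ), 1 ≤ o → o < K → η (K * i + o) =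
      ((tr (st (σ i) ((o-1)/3)) (st (σ i) (o/3))).2 : ℝ) * (sg (σ i) * h) := fun i o h1 h2 => by
    simp only [η]; rw [eT i o h1 h2, es i o h2]
  have eη0 : ∀ i : ℤ, η (K * i) = 0 := fun i => by simp only [η]; rw [eT0]; simp
  have eD : ∀ (i : ℤ) (o : ℕ), o < K → D (K * i + o) =
      Mt.sc lam (mat (sg (σ i) * h) (st (σ i) (o/3))) := fun i o ho => by
    simp only [D]; rw [es i o ho, eS i o ho]
  have eD0 : ∀ i : ℤ, D (K * i) = Mt.sc lam ⟨1, 0, 0, 1⟩ := fun i => by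
    rw [ec i, eD i 0 hK, (W (σ i)).fst _ (by omega)]; rfl
  have eD1 : ∀ i : ℤ, D (K * i - 1) = Mt.sc lam ⟨1, 0, 0, 1⟩ := fun i => by
    rw [em0 i, eD _ _ (by omega), (W (σ (i-1))).lst _ (by omega)]; rfl
  have eσ : ∀ (i : ℤ) (o : ℕ), o < K → σ' (K * i + o) = sgn (σ i) (st (σ i) (o/3)) :=
    fun i o ho => by simp only [σ']; rw [es i o ho, eS i o ho]
  have eP : ∀ (i : ℤ) (o : ℕ), o < K → P (K * i + o) =
      ((K:ℝ) * i, 0) + lam • Ss (sg (σ i) * h) (st (σ i)) o := fun i o ho => by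
    simp only [P]; rw [es i o ho, en i o ho, dec_div K i o ho]
  have hok : ∀ (i : ℤ) (o : ℕ), 1 ≤ o → ok (st (σ i) ((o-1)/3)) (st (σ i) (o/3)) := by
    intro i o h1
    by_cases h3 : o % 3 = 0
    · have := (W (σ i)).ok ((o-1)/3)
      rwa [show (o-1)/3 + 1 = o/3 by omega] at this
    · rw [show (o-1)/3 = o/3 by omega]; left; rfl
  have he : ∀ l, e l = 1 ∨ e l = -1 := by
    intro l
    simp only [e, T]
    split_ifs
    · left; rfl
    · exact tr_e _ _
  have hD : ∀ l, D l = (D (l - 1)).mu (Bm (e l) (η l)) := by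
    intro l
    obtain ⟨i, o, ho, rfl⟩ := dec K hK l
    rcases Nat.eq_zero_or_pos o with rfl | h1
    · rw [← ec i, eη0, Bm_zero, eD0, eD1]
    · rw [eη i o h1 ho, em i o h1, eD i o ho, eD i _ (by omega), tr_mat _ (hok i o h1)]
      simp only [e]
      rw [eT i o h1 ho]
      ext <;> simp only [Mt.sc, Mt.mu] <;> ring
  have hz : ∀ l : ℤ, ¬ (3:ℤ) ∣ l → η l = 0 := by
    intro l h3
    obtain ⟨i, o, ho, rfl⟩ := dec K hK l
    rcases Nat.eq_zero_or_pos o with rfl | h1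
    · rw [← ec i, eη0]
    · have : ¬ 3 ∣ o := by
        intro hd
        apply h3
        apply dvd_add
        · apply Dvd.dvd.mul_right; rw [hKdef]; push_cast; exact Dvd.intro _ rfl
        · exact_mod_cast hd
      rw [eη i o h1 ho, show (o-1)/3 = o/3 by omega, tr_self]; simp
  have hadj : ∀ l, η l = 0 ∨ η (l + 1) = 0 := by
    intro l
    by_cases h3 : (3:ℤ) ∣ l
    · right; exact hz _ (by omega)
    · left; exact hz _ h3
  have hP : ∀ l, P (l + 1) = P l + (D l).ap (1, 0) := by
    intro l
    obtain ⟨i, o, ho, rfl⟩ := dec K hK l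
    rw [eP i o ho, eD i o ho, Mt.ap_sc, add_assoc (((K:ℝ) * i, 0) : Pl), ← smul_add]
    have hsucc := Ss_succ (sg (σ i) * h) (st (σ i)) o
    rw [col] at hsucc
    rw [← hsucc]
    rcases Nat.lt_or_ge (o+1) K with h1 | h1
    · rw [show (K * i + o + 1 : ℤ) = K * i + (o + 1 : ℕ) by push_cast; ring, eP i _ h1]
    · have ho' : o + 1 = K := by omega
      rw [show (K * i + o + 1 : ℤ) = K * (i + 1) + (0 : ℕ) by rw [← ho']; push_cast; ring,
        eP _ 0 hK, ho', hKdef, (W (σ i)).SK]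
      ext
      · simp [Ss]; ring
      · simp [Ss]
  obtain ⟨R, hc⟩ := mk_row he hD hadj hP
  set G := mk P D e η with hG
  -- region
  have reg : ∀ (i : ℤ) (o : ℕ), 1 ≤ o → o < K → ∀ w : Pl, |w.1| ≤ 1/2 → |w.2| ≤ 1/2 →
      |(G (K * i + o + w.1, w.2)).2| ≤ (G (K * i + o + w.1, w.2)).1 - K * i ∧
      |(G (K * i + o + w.1, w.2)).2| ≤ K * i + K - (G (K * i + o + w.1, w.2)).1 ∧
      |(G (K * i + o + w.1, w.2)).2| ≤ (K - 3 * lam) / 2 := by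
    intro i o h1 h2 w hw1 hw2
    have t := R.tile (K * i + o) w hw1 hw2
    rw [hc, eP i o h2] at t
    push_cast at t
    have key : ∃ k, (k = (o-1)/3 ∨ k = o/3) ∧
        (D (K * i + o - 1)).ap (bd (e (K * i + o)) (η (K * i + o)) w) =
          (Mt.sc lam (mat (sg (σ i) * h) (st (σ i) k))).ap w := by
      rcases le_total ((e (K * i + o) : ℝ) * w.2) w.1 with c | c
      · refine ⟨o/3, Or.inr rfl, ?_⟩
        rw [bd_act (R.heR _) c, ← Mt.ap_mu, ← hD, eD i o h2]
      · refine ⟨(o-1)/3, Or.inl rfl, ?_⟩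
        rw [bd_inact c, em i o h1, eD i _ (by omega)]
    obtain ⟨k, hk, ek⟩ := key
    rw [ek, add_assoc (((K:ℝ) * i, 0) : Pl)] at t
    rw [t]
    have := (W (σ i)).region hh o h1 h2 k hk w hw1 hw2 _ rfl
    rw [← hKR] at this
    obtain ⟨r1, r2, r3⟩ := this
    simp only [Prod.snd_add, Prod.fst_add, zero_add] at r1 r2 r3 ⊢
    refine ⟨by linarith, by linarith, by linarith⟩
  have reg0 : ∀ (i : ℤ) (w : Pl), |w.1| ≤ 1/2 → |w.2| ≤ 1/2 →
      G (K * i + w.1, w.2) = ((K:ℝ) * (i:ℝ), (0:ℝ)) + lam • w := by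
    intro i w hw1 hw2
    have t := R.tile (K * i) w hw1 hw2
    rw [hc, eη0, bd_zero, eD1, ec i, eP i 0 hK] at t
    push_cast at t
    rw [add_zero] at t
    rw [t, Mt.ap_sc]
    simp [Ss, Mt.ap]
  have big : 3 * lam + lam ≤ K := by
    have h1 := (W true).totx hh
    have h2 := congrArg Prod.fst (W true).SK
    simp only [Prod.smul_fst, smul_eq_mul] at h2
    have h3 : (4:ℝ) ≤ A true := by
      have := (W true).bA
      have h4 := (abs_nonneg _).trans ((W true).ybd 0 (by omega))
      linarith
    rw [hKR, ← h2]; nlinarith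
  have all : ∀ z : Pl, |z.2| ≤ 1/2 → |(G z).2| ≤ (K - 3 * lam) / 2 ∧ |(G z).1 - z.1| ≤ K := by
    intro z hz
    have hr := abs_sub_round z.1
    obtain ⟨i, o, ho, hio⟩ := dec K hK (round z.1)
    have hioR : ((round z.1 : ℤ) : ℝ) = K * i + o := by rw [hio]; push_cast; ring
    rw [hioR] at hr
    have ez : z = ((K:ℝ) * i + o + (z.1 - (K * i + o)), z.2) := by ext <;> simp
    have a := abs_le.1 hr
    rcases Nat.eq_zero_or_pos o with rfl | h1
    · have t := reg0 i (z.1 - (K * i), z.2) (by simpa using hr) hz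
      simp only [add_sub_cancel] at t
      rw [show z = (z.1, z.2) from rfl, t]
      simp only [Prod.smul_mk, smul_eq_mul, Prod.mk_add_mk, zero_add]
      push_cast at a
      rw [add_zero] at a
      have hz' := abs_le.1 hz
      constructor
      · rw [abs_mul, abs_of_nonneg (by linarith)]; nlinarith
      · rw [abs_le]; constructor <;> nlinarith
    · have t := reg i o h1 ho (z.1 - (K * i + o), z.2) hr hz
      rw [← ez] at t
      obtain ⟨r1, r2, r3⟩ := t
      refine ⟨r3, ?_⟩
      have h0 := abs_nonneg (G z).2
      have ho1 : (1:ℝ) ≤ o := by exact_mod_cast h1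
      have ho2 : (o:ℝ) + 1 ≤ K := by exact_mod_cast ho
      rw [abs_le]; constructor <;> linarith
  refine ⟨G, D, e, η, σ', R, ?_, eη0, ?_, ?_, ?_, ?_, ?_, ?_, fun z hz => (all z hz).1,
    fun z hz => (all z hz).2, ?_, ?_, ?_, ?_, ?_⟩
  · intro i o h1 h2
    rw [eη i o h1 h2, em i o h1, eσ i o h2, eσ i _ (by omega)]
    exact tr_sgn h (σ i) (hok i o h1)
  · intro i v; rw [eD0, Mt.ap_sc]; simp [Mt.ap]
  · intro i; rw [ec i, eσ i 0 hK, (W (σ i)).fst _ (by omega)]; rfl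
  · intro i; rw [em0 i, eσ _ _ (by omega), (W (σ (i-1))).lst _ (by omega)]; rfl
  · intro i o ho v
    rw [eD i o ho, eσ i o ho, Mt.ap_sc, qf_smul, qf_mat]
  · intro i
    have := reg0 i (0, 0) (by norm_num) (by norm_num)
    simpa using this
  · intro i o h1 h2 w hw1 hw2
    have := reg i o h1 h2 w hw1 hw2
    exact ⟨this.1, this.2.1⟩
  · intro l
    simp only [D, Mt.sc]
    have := mat_pos (WD.sq_lt (s l) hh) (S l)
    apply mul_le_mul_of_nonneg_left _ (by linarith)
    have e2 : (sg (s l) * h) ^ 2 = h ^ 2 := by cases s l <;> simp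
    rwa [e2] at this
  · intro l
    simp only [D, Mt.sc, abs_mul]
    have hl : |lam| = lam := abs_of_nonneg (by linarith)
    rw [hl]
    obtain ⟨q1, q2, q3, q4⟩ := mat_bd (WD.sq_lt (s l) hh) (S l)
    have : 0 ≤ lam := by linarith
    refine ⟨?_, ?_, ?_, ?_⟩ <;> apply mul_le_mul_of_nonneg_left _ this <;> assumption
  · intro l
    simp only [D, Mt.sc]
    have := mat_det (sg (s l) * h) (S l)
    linear_combination lam ^ 2 * this
  · intro i
    have h3 : (3:ℤ) ∣ K * i := by
      apply Dvd.dvd.mul_right; rw [hKdef]; push_cast; exact Dvd.intro _ rfl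
    exact ⟨hz _ (by omega), hz _ (by omega)⟩
  · linarith

end BHW

-- ===== Part 7 =====
open Set Metric Filter MeasureTheory
open scoped ENNReal Topology NNReal

namespace BHW

theorem pell (N : ℕ) : ∃ p q : ℕ, q ^ 2 = 2 * p ^ 2 + 1 ∧ 2 ≤ p ∧ N ≤ p := by
  induction N with
  | zero => exact ⟨2, 3, by norm_num, le_rfl, by norm_num⟩
  | succ N ih =>
    obtain ⟨p, q, h1, h2, h3⟩ := ih
    refine ⟨2 * q + 3 * p, 3 * q + 4 * p, ?_, by omega, by omega⟩
    nlinarith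

def run : St → List St → Prop
  | a, [] => a = .I
  | a, b :: l => ok a b ∧ run b l

theorem run_append {a : St} {l1 l2 : List St} (h1 : run a l1) (h2 : run .I l2) :
    run a (l1 ++ l2) := by
  induction l1 generalizing a with
  | nil => simp only [run] at h1; subst h1; simpa using h2
  | cons b l ih => exact ⟨h1.1, ih h1.2⟩

theorem run_rep {a : St} {l : List St} (k : ℕ) (h : run a l) : run a (List.replicate k a ++ l) := by
  induction k with
  | zero => simpa using h
  | succ k ih => rw [List.replicate_succ]; exact ⟨Or.inl rfl, ih⟩

theorem run_getD {a : St} {l : List St} (h : run a l) (k : ℕ) :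
    ok ((a :: l).getD k .I) ((a :: l).getD (k+1) .I) := by
  induction l generalizing a k with
  | nil =>
    simp only [run] at h; subst h
    cases k <;> simp [ok]
  | cons b l ih =>
    cases k with
    | zero => simpa using h.1
    | succ k => simpa using ih h.2 k

noncomputable def Tsum (t : ℝ) (l : List St) : Pl := (l.map (col t)).sum

theorem Tsum_append (t : ℝ) (l1 l2 : List St) : Tsum t (l1 ++ l2) = Tsum t l1 + Tsum t l2 := by
  simp [Tsum]
theorem Tsum_cons (t : ℝ) (a : St) (l : List St) : Tsum t (a :: l) = col t a + Tsum t l := by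
  simp [Tsum]
theorem Tsum_nil (t : ℝ) : Tsum t [] = 0 := by simp [Tsum]
theorem Tsum_rep (t : ℝ) (k : ℕ) (a : St) : Tsum t (List.replicate k a) = (k:ℝ) • col t a := by
  simp [Tsum, ← Nat.cast_smul_eq_nsmul ℝ]
theorem Tsum_flat (t : ℝ) (k : ℕ) (l : List St) :
    Tsum t (List.replicate k l).flatten = (k:ℝ) • Tsum t l := by
  induction k with
  | zero => simp [Tsum]
  | succ k ih => rw [List.replicate_succ, List.flatten_cons, Tsum_append, ih]; push_cast; module

theorem Ts_eq (t : ℝ) (l : List St) (k : ℕ) (hk : k ≤ l.length) :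
    Ts t (fun m => l.getD m .I) k = Tsum t (l.take k) := by
  induction l generalizing k with
  | nil => simp at hk; subst hk; simp [Ts, Tsum]
  | cons a l ih =>
    cases k with
    | zero => simp [Ts, Tsum]
    | succ k =>
      have := ih k (by simpa using hk)
      rw [List.take_succ_cons, Tsum_cons, ← this]
      simp only [Ts]
      rw [Finset.sum_range_succ', add_comm]
      simp

def Good (t b : ℝ) (l : List St) : Prop := (Tsum t l).2 = 0 ∧ ∀ k, |(Tsum t (l.take k)).2| ≤ b

theorem Good.append {t b : ℝ} {l1 l2 : List St} (h1 : Good t b l1) (h2 : Good t b l2) :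
    Good t b (l1 ++ l2) := by
  refine ⟨by rw [Tsum_append, Prod.snd_add, h1.1, h2.1, add_zero], fun k => ?_⟩
  rw [List.take_append, Tsum_append, Prod.snd_add]
  rcases le_total k l1.length with h | h
  · rw [Nat.sub_eq_zero_of_le h]
    simp only [List.take_zero, Tsum_nil, Prod.snd_zero, add_zero]
    exact h1.2 k
  · rw [List.take_of_length_le h, h1.1, zero_add]; exact h2.2 _

theorem Good.flat {t b : ℝ} (hb : 0 ≤ b) {l : List St} (h : Good t b l) (n : ℕ) :
    Good t b (List.replicate n l).flatten := by
  induction n with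
  | zero => simp [Good, Tsum, hb]
  | succ n ih => rw [List.replicate_succ, List.flatten_cons]; exact h.append ih

theorem Good.rep {t b : ℝ} (hb : 0 ≤ b) (n : ℕ) : Good t b (List.replicate n .I) := by
  refine ⟨by simp [Tsum_rep, col_I], fun k => ?_⟩
  rw [List.take_replicate, Tsum_rep, col_I]; simpa using hb

theorem Tsum_len {t : ℝ} (ht : 2 * t ^ 2 < 1) (l : List St) : |(Tsum t l).2| ≤ 3 * l.length := by
  induction l with
  | nil => simp [Tsum]
  | cons a l ih =>
    rw [Tsum_cons, Prod.snd_add]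
    refine (abs_add_le _ _).trans ?_
    have : |(col t a).2| ≤ 3 := by
      have := (mat_bd ht a).2.2.1
      simpa [col, Mt.ap] using this
    simp only [List.length_cons]; push_cast; linarith

theorem Good.of_len {t b : ℝ} (ht : 2 * t ^ 2 < 1) {l : List St} (h0 : (Tsum t l).2 = 0)
    (hl : 3 * (l.length : ℝ) ≤ b) : Good t b l := by
  refine ⟨h0, fun k => (Tsum_len ht _).trans (le_trans ?_ hl)⟩
  have : ((l.take k).length : ℝ) ≤ l.length := by exact_mod_cast List.length_take_le' _ _
  linarith

def tooth0 (ℓ : ℕ) : List St :=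
  [.P] ++ List.replicate ℓ .U ++ [.P, .I, .M] ++ List.replicate ℓ .V ++ [.M]

def wd (A n ℓ : ℕ) : List St :=
  List.replicate (A+1) .I ++ ((List.replicate n (tooth0 ℓ ++ [.I])).flatten ++
    (tooth0 ℓ ++ List.replicate (A+1) .I))

theorem Tsum_tooth0 (t : ℝ) (ℓ : ℕ) : Tsum t (tooth0 ℓ) = (5 + 4*t + 2 * ℓ * (1 - 2 * t^2), 0) := by
  simp only [tooth0, Tsum_append, Tsum_cons, Tsum_nil, Tsum_rep]
  simp only [col, mat, Bm, Mt.mu, Mt.ap]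
  ext <;> simp <;> ring

theorem run_tooth0 {ℓ : ℕ} (hℓ : 1 ≤ ℓ) (l : List St) (hl : run .I l) :
    run .I (tooth0 ℓ ++ (.I :: l)) := by
  obtain ⟨k, rfl⟩ : ∃ k, ℓ = k + 1 := ⟨ℓ - 1, by omega⟩
  have e : tooth0 (k+1) ++ (.I :: l) = .P :: .U :: (List.replicate k .U ++ (.P :: .I :: .M :: .V ::
      (List.replicate k .V ++ (.M :: .I :: l)))) := by
    simp [tooth0, List.replicate_succ]
  rw [e]
  refine ⟨by simp [ok, tr], by simp [ok, tr], run_rep _ ⟨by simp [ok, tr], by simp [ok, tr],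
    by simp [ok, tr], by simp [ok, tr], run_rep _ ⟨by simp [ok, tr], by simp [ok, tr], hl⟩⟩⟩

theorem run_flat {ℓ : ℕ} (hℓ : 1 ≤ ℓ) (n : ℕ) (l : List St) (hl : run .I l) :
    run .I ((List.replicate n (tooth0 ℓ ++ [.I])).flatten ++ l) := by
  induction n with
  | zero => simpa using hl
  | succ n ih =>
    rw [List.replicate_succ, List.flatten_cons]
    have := run_tooth0 hℓ _ ih
    simpa using this

theorem run_wd (A n : ℕ) {ℓ : ℕ} (hℓ : 1 ≤ ℓ) : run .I (wd A n ℓ) := by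
  have h0 : run .I (List.replicate A .I ++ []) := run_rep A rfl
  rw [List.append_nil] at h0
  have h1 := run_tooth0 hℓ _ h0
  rw [← List.replicate_succ] at h1
  exact run_rep _ (run_flat hℓ n _ h1)

theorem len_tooth0 (ℓ : ℕ) : (tooth0 ℓ).length = 5 + 2 * ℓ := by
  simp [tooth0]; ring

theorem len_wd (A n ℓ : ℕ) : (wd A n ℓ).length = 2 * A + 1 + (n+1) * (6 + 2 * ℓ) := by
  have : (List.replicate n (tooth0 ℓ ++ [St.I])).flatten.length = n * (6 + 2 * ℓ) := by
    simp [List.length_flatten, len_tooth0]; left; ring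
  simp only [wd, List.length_append, this, len_tooth0, List.length_replicate]
  ring

theorem wd_WD {h lam : ℝ} (hh : 2 * h^2 < 1) (s : Bool) (A n ℓ : ℕ) (hℓ : 1 ≤ ℓ) (l1 : 1 ≤ lam)
    (htot : lam * (2 * A + 1 + (n + 1) * (6 + 4 * (sg s * h) + 2 * ℓ * (1 - 2 * h^2))) =
      ((2 * A + 1 + (n+1) * (6 + 2 * ℓ) : ℕ) : ℝ))
    {b : ℝ} (hb : b = 3 * (6 + 2 * ℓ)) (hbA : 3 * b + 12 ≤ 3 * A) :
    WD h lam (2 * A + 1 + (n+1) * (6 + 2 * ℓ)) s A b (fun m => (wd A n ℓ).getD m .I) := by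
  have hb0 : 0 ≤ b := by rw [hb]; positivity
  have ht := WD.sq_lt s hh
  have ht2 : (sg s * h) ^ 2 = h ^ 2 := by cases s <;> simp
  have g0 : Good (sg s * h) b (tooth0 ℓ) := by
    apply Good.of_len ht
    · rw [Tsum_tooth0]
    · rw [len_tooth0, hb]; push_cast; linarith
  have g1 : Good (sg s * h) b (tooth0 ℓ ++ [.I]) := g0.append (Good.rep hb0 1)
  have g2 : Good (sg s * h) b (wd A n ℓ) :=
    (Good.rep hb0 _).append ((g1.flat hb0 n).append (g0.append (Good.rep hb0 _)))
  refine ⟨?_, ?_, ?_, ?_, ?_, hbA, by omega, l1⟩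
  · intro k
    have := run_getD (run_wd A n hℓ) (k+1)
    simpa using this
  · intro k hk
    simp only [wd]
    rw [List.getD_append _ _ _ _ (by simp; omega)]
    rw [List.getD_replicate _ (by omega)]
  · intro k hk
    have hl := len_wd A n ℓ
    rcases Nat.lt_or_ge k (wd A n ℓ).length with h1 | h1
    · have e : wd A n ℓ = (List.replicate (A+1) .I ++ ((List.replicate n (tooth0 ℓ ++ [.I])).flatten ++
        tooth0 ℓ)) ++ List.replicate (A+1) .I := by simp [wd]
      have hl2 : (List.replicate (A+1) St.I ++ ((List.replicate n (tooth0 ℓ ++ [St.I])).flatten ++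
        tooth0 ℓ)).length + (A + 1) = (wd A n ℓ).length := by
        simp only [e, List.length_append, List.length_replicate]
      rw [e, List.getD_append_right _ _ _ _ (by omega), List.getD_replicate _ (by omega)]
    · exact List.getD_eq_default _ _ h1
  · have := Ts_eq (sg s * h) (wd A n ℓ) (wd A n ℓ).length le_rfl
    rw [List.take_length, len_wd] at this
    rw [this, ← htot]
    simp only [wd, Tsum_append, Tsum_rep, Tsum_flat, Tsum_tooth0, Tsum_cons, Tsum_nil, col_I, ht2]
    ext
    · simp; left; ring
    · simp
  · intro k hk
    rw [Ts_eq _ _ _ (by rw [len_wd]; exact hk)]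
    exact g2.2 k

set_option maxHeartbeats 2000000 in
theorem exists_words (Q : ℝ) : ∃ (h lam b : ℝ) (Kp : ℕ) (A : Bool → ℕ) (st : Bool → ℕ → St),
    0 ≤ h ∧ 2 * h ^ 2 < 1 ∧ (∀ s, WD h lam Kp s (A s) b (st s)) ∧ Q ≤ lam ∧ Odd Kp ∧
    3 * (Kp : ℝ) ≤ 32400 * lam ^ 2 ∧ lam ≤ Kp := by
  obtain ⟨N, hN⟩ := exists_nat_ge (max Q 1)
  obtain ⟨p, q, hpq, hp2, hpN⟩ := pell (3 * N)
  have hq3 : 3 ≤ q := by nlinarith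
  have hpltq : p + 1 ≤ q := by nlinarith
  have hq2p : q ≤ 2 * p := by nlinarith
  have qR : (3:ℝ) ≤ q := by exact_mod_cast hq3
  have pR : (2:ℝ) ≤ p := by exact_mod_cast hp2
  have pqR : (p:ℝ) + 1 ≤ q := by exact_mod_cast hpltq
  have q2pR : (q:ℝ) ≤ 2 * p := by exact_mod_cast hq2p
  have pellR : (q:ℝ) ^ 2 = 2 * (p:ℝ) ^ 2 + 1 := by exact_mod_cast hpq
  set h : ℝ := p / q with hh
  have hC : 1 - 2 * h ^ 2 = 1 / (q:ℝ) ^ 2 := by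
    rw [hh]; field_simp; linarith
  have hqh : (q:ℝ) * h = p := by rw [hh]; field_simp
  set ℓ := 16 * q ^ 2 with hℓ
  set n0 := 16 * p * q with hn0
  have hn02 : 2 ≤ n0 := by rw [hn0]; nlinarith
  set A1 := 256 * p * q with hA1
  set Kp := 2 * A1 + 1 + (n0 + 1) * (6 + 2 * ℓ) with hKp
  have lC : (2:ℝ) * ℓ * (1 - 2 * h ^ 2) = 32 := by
    rw [hC, hℓ]; push_cast; field_simp; norm_num
  set Tot : ℝ := 2 * A1 + 1 + (n0 + 1) * (38 + 4 * h) with hTot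
  have h0 : 0 ≤ h := by positivity
  have h34 : h ≤ 3/4 := by
    have : 0 < 1 / (q:ℝ)^2 := by positivity
    nlinarith
  have n0R : (n0:ℝ) = 16 * p * q := by rw [hn0]; push_cast; ring
  have A1R : (A1:ℝ) = 256 * p * q := by rw [hA1]; push_cast; ring
  have lR : (ℓ:ℝ) = 16 * q ^ 2 := by rw [hℓ]; push_cast; ring
  have KpR : (Kp:ℝ) = 2 * A1 + 1 + (n0 + 1) * (6 + 2 * ℓ) := by rw [hKp]; push_cast; ring
  have hpq6 : (6:ℝ) ≤ p * q := by nlinarith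
  have Tot1 : 1 ≤ Tot := by rw [hTot, A1R, n0R]; nlinarith
  have TotU : Tot ≤ 1175 * (p * q) := by rw [hTot, A1R, n0R]; nlinarith
  set lam : ℝ := Kp / Tot with hlam
  have hlT : lam * Tot = Kp := by rw [hlam]; field_simp
  have hlamq : (q:ℝ)^2 / 3 ≤ lam := by
    rw [hlam, le_div_iff₀ (by linarith)]
    have : (q:ℝ)^2 / 3 * Tot ≤ (q:ℝ)^2 / 3 * (1175 * (p * q)) :=
      mul_le_mul_of_nonneg_left TotU (by positivity)
    refine this.trans ?_
    rw [KpR, A1R, n0R, lR]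
    have e0 : 0 ≤ (q:ℝ)^2 * (p * q) := by positivity
    have e1 : 0 ≤ (q:ℝ)^2 := by positivity
    have e : 2 * (256 * (p:ℝ) * q) + 1 + (16 * p * q + 1) * (6 + 2 * (16 * (q:ℝ)^2)) =
      512 * ((q:ℝ)^2 * (p * q)) + (608 * (p * q) + 32 * (q:ℝ)^2 + 7) := by ring
    rw [e]
    have e3 : (q:ℝ)^2 / 3 * (1175 * (p * q)) = 1175 / 3 * ((q:ℝ)^2 * (p * q)) := by ring
    rw [e3]
    linarith
  have hlQ : max Q 1 ≤ lam := by
    refine hN.trans (le_trans ?_ hlamq)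
    have : (3:ℝ) * N ≤ p := by exact_mod_cast hpN
    nlinarith
  have hKq : 3 * (Kp:ℝ) ≤ 3600 * (q:ℝ)^4 := by
    rw [KpR, A1R, n0R, lR]
    have e1 : (p:ℝ) * q ≤ q^2 := by nlinarith
    have e2 : (9:ℝ) ≤ q^2 := by nlinarith
    have e3 : (q:ℝ)^4 = q^2 * q^2 := by ring
    rw [e3]
    set x := (q:ℝ)^2
    set y := (p:ℝ) * q
    have : 3 * (2 * (256 * p * q) + 1 + (16 * p * q + 1) * (6 + 2 * (16 * x))) =
      3 * (512 * y + 1 + (16 * y + 1) * (6 + 32 * x)) := by ring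
    rw [this]
    have : (16 * y + 1) * (6 + 32 * x) ≤ (16 * x + 1) * (6 + 32 * x) := by
      apply mul_le_mul_of_nonneg_right <;> linarith
    have e9 : 9 * x ≤ x * x := mul_le_mul_of_nonneg_right e2 (by linarith)
    have e10 : (16 * x + 1) * (6 + 32 * x) = 512 * (x * x) + 128 * x + 6 := by ring
    linarith
  refine ⟨h, lam, 3 * (6 + 2 * ℓ), Kp, fun s => if s then A1 else A1 + (6 + 2 * ℓ),
    fun s m => (wd (if s then A1 else A1 + (6 + 2 * ℓ)) (if s then n0 else n0 - 2) ℓ).getD m .I,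
    h0, ?_, ?_, (le_max_left _ _).trans hlQ, ?_, ?_, ?_⟩
  · have : 0 < 1 / (q:ℝ)^2 := by positivity
    linarith
  · have hh2 : 2 * h ^ 2 < 1 := by
      have : 0 < 1 / (q:ℝ)^2 := by positivity
      linarith
    have hℓ1 : 1 ≤ ℓ := by rw [hℓ]; nlinarith
    have bA : 3 * (3 * (6 + 2 * (ℓ:ℝ))) + 12 ≤ 3 * A1 := by
      rw [lR, A1R]; nlinarith
    intro s
    cases s
    · obtain ⟨m, hm⟩ : ∃ m, n0 = m + 2 := ⟨n0 - 2, by omega⟩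
      have hmR : (n0:ℝ) = m + 2 := by rw [hm]; push_cast; ring
      have e : Kp = 2 * (A1 + (6 + 2*ℓ)) + 1 + (m + 1) * (6 + 2 * ℓ) := by
        rw [hKp, hm]; ring
      have := wd_WD hh2 false (A1 + (6 + 2*ℓ)) m ℓ hℓ1 ((le_max_right _ _).trans hlQ) (by
        rw [← e, ← hlT, lC, hTot]
        congr 1
        push_cast
        simp only [sg_false]
        have : (n0:ℝ) * h = ℓ * h * h := by rw [n0R, lR]; rw [← hqh]; ring
        have h2 : (ℓ:ℝ) * h * h = (ℓ - 16)/2 := by nlinarith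
        rw [h2] at this
        rw [hmR] at this ⊢
        linarith) (b := 3 * (6 + 2 * ℓ)) rfl (by push_cast; nlinarith)
      rw [← e] at this
      simp only [Bool.false_eq_true, if_false]
      rw [show n0 - 2 = m by omega]
      exact this
    · have := wd_WD hh2 true A1 n0 ℓ hℓ1 ((le_max_right _ _).trans hlQ) (by
        rw [← hKp, ← hlT, lC, hTot]
        congr 1
        simp only [sg_true]
        ring) (b := 3 * (6 + 2 * ℓ)) rfl bA
      simpa using this
  · rw [hKp]
    refine ⟨A1 + (n0+1) * (3 + ℓ), by ring⟩
  · refine hKq.trans ?_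
    have : (q:ℝ)^4 = 9 * ((q:ℝ)^2/3)^2 := by ring
    rw [this]
    have : ((q:ℝ)^2/3)^2 ≤ lam^2 := pow_le_pow_left₀ (by positivity) hlamq 2
    linarith
  · rw [hlam]; exact div_le_self (by positivity) Tot1

end BHW

-- ===== Part 8 =====
open Set Metric Filter MeasureTheory
open scoped ENNReal Topology NNReal

namespace BHW

theorem WRow.LLm {h lam : ℝ} {K : ℕ} {σ : ℤ → Bool} {G : Pl → Pl} {D : ℤ → Mt} {e : ℤ → ℤ}
    {η : ℤ → ℝ} {σ' : ℤ → Bool} (W : WRow h lam K σ G D e η σ')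
    (z w : Pl) (h2 : |z.2| ≤ 1/2) (h4 : |w.2| ≤ 1/2) (h5 : |z.1 - w.1| ≤ 1/2) :
    ∃ N : Mt, G w - G z = N.ap (w - z) ∧ lam * ((1 - 2 * h ^ 2) / 4) ≤ N.a ∧
      |N.a| ≤ lam * 3 ∧ |N.b| ≤ lam * 3 ∧ |N.c| ≤ lam * 3 ∧ |N.d| ≤ lam * 3 ∧
      N.a * N.d - N.b * N.c = lam ^ 2 := by
  obtain ⟨l, τ, t0, t1, H⟩ := W.row.LL z w h2 h4 h5
  refine ⟨(D (l-1)).mu (Bm (e l) (τ * η l)), by rw [H, Mt.ap_mu], ?_⟩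
  have hD := W.row.hD l
  have a1 := W.Da (l-1)
  have a2 := W.Da l
  have b1 := W.Db (l-1)
  have b2 := W.Db l
  have d1 := W.Dd (l-1)
  have hea : (D l).a = (D (l-1)).a * (1 + η l) + (D (l-1)).b * (e l * η l) := by
    rw [hD]; simp [Mt.mu, Bm]
  have heb : (D l).b = (D (l-1)).a * (-(e l * η l)) + (D (l-1)).b * (1 - η l) := by
    rw [hD]; simp [Mt.mu, Bm]
  have hec : (D l).c = (D (l-1)).c * (1 + η l) + (D (l-1)).d * (e l * η l) := by
    rw [hD]; simp [Mt.mu, Bm]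
  have hed : (D l).d = (D (l-1)).c * (-(e l * η l)) + (D (l-1)).d * (1 - η l) := by
    rw [hD]; simp [Mt.mu, Bm]
  have ca : ((D (l-1)).mu (Bm (e l) (τ * η l))).a = (1 - τ) * (D (l-1)).a + τ * (D l).a := by
    rw [hea]; simp [Mt.mu, Bm]; ring
  have cb : ((D (l-1)).mu (Bm (e l) (τ * η l))).b = (1 - τ) * (D (l-1)).b + τ * (D l).b := by
    rw [heb]; simp [Mt.mu, Bm]; ring
  have cc : ((D (l-1)).mu (Bm (e l) (τ * η l))).c = (1 - τ) * (D (l-1)).c + τ * (D l).c := by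
    rw [hec]; simp [Mt.mu, Bm]; ring
  have cd : ((D (l-1)).mu (Bm (e l) (τ * η l))).d = (1 - τ) * (D (l-1)).d + τ * (D l).d := by
    rw [hed]; simp [Mt.mu, Bm]; ring
  have hc : ∀ x y : ℝ, |x| ≤ lam * 3 → |y| ≤ lam * 3 → |(1 - τ) * x + τ * y| ≤ lam * 3 := by
    intro x y hx hy
    calc _ ≤ |(1-τ) * x| + |τ * y| := abs_add_le _ _
      _ = (1 - τ) * |x| + τ * |y| := by
        rw [abs_mul, abs_mul, abs_of_nonneg t0, abs_of_nonneg (by linarith : 0 ≤ 1 - τ)]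
      _ ≤ (1 - τ) * (lam * 3) + τ * (lam * 3) := by
        gcongr
      _ = _ := by ring
  refine ⟨?_, ?_, ?_, ?_, ?_, ?_⟩
  · rw [ca]
    have u1 := mul_le_mul_of_nonneg_left a1 (by linarith : 0 ≤ 1 - τ)
    have u2 := mul_le_mul_of_nonneg_left a2 t0
    linarith
  · rw [ca]; exact hc _ _ b1.1 b2.1
  · rw [cb]; exact hc _ _ b1.2.1 b2.2.1
  · rw [cc]; exact hc _ _ b1.2.2.1 b2.2.2.1
  · rw [cd]; exact hc _ _ b1.2.2.2 b2.2.2.2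
  · rw [← d1]
    have : (e l : ℝ) * e l = 1 := by rcases W.row.heR l with h | h <;> rw [h] <;> norm_num
    simp only [Mt.mu, Bm]
    linear_combination ((D (l-1)).a * (D (l-1)).d - (D (l-1)).b * (D (l-1)).c) * (τ * η l)^2 * this

/-- clamping -/
noncomputable def cl (b y : ℝ) : ℝ := max (-b) (min b y)

theorem cl_abs {b : ℝ} (hb : 0 ≤ b) (y : ℝ) : |cl b y| ≤ b := by
  rw [cl, abs_le]
  exact ⟨le_max_left _ _, max_le (by linarith) (min_le_left _ _)⟩
theorem cl_of_abs {b y : ℝ} (h : |y| ≤ b) : cl b y = y := by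
  have := abs_le.1 h
  rw [cl, min_eq_right this.2, max_eq_right this.1]
theorem cl_of_ge {b y : ℝ} (hb : 0 ≤ b) (h : b ≤ y) : cl b y = b := by
  rw [cl, min_eq_left h, max_eq_right (by linarith)]
theorem cl_of_le {b y : ℝ} (hb : 0 ≤ b) (h : y ≤ -b) : cl b y = -b := by
  rw [cl, min_eq_right (by linarith), max_eq_left h]
theorem cl_lip (b y z : ℝ) : |cl b y - cl b z| ≤ |y - z| := by
  rw [cl, cl]
  refine (abs_max_sub_max_le_max _ _ _ _).trans ?_
  rw [sub_self, abs_zero]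
  refine max_le (abs_nonneg _) ((abs_min_sub_min_le_max _ _ _ _).trans ?_)
  rw [sub_self, abs_zero]; exact max_le (abs_nonneg _) le_rfl

noncomputable def th (K y : ℝ) : ℝ := max 0 (min 1 ((|y| - 1/2) * (2 / (K - 1))))

theorem th_nonneg (K y : ℝ) : 0 ≤ th K y := le_max_left _ _
theorem th_le (K y : ℝ) : th K y ≤ 1 := max_le zero_le_one (min_le_left _ _)
theorem th_in {K y : ℝ} (hK : 3 ≤ K) (h : |y| ≤ 1/2) : th K y = 0 := by
  rw [th, max_eq_left]
  refine (min_le_right _ _).trans ?_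
  exact mul_nonpos_of_nonpos_of_nonneg (by linarith) (div_nonneg (by norm_num) (by linarith))
theorem th_out {K y : ℝ} (hK : 3 ≤ K) (h : K/2 ≤ |y|) : th K y = 1 := by
  rw [th, min_eq_left, max_eq_right zero_le_one]
  rw [mul_div_assoc', le_div_iff₀ (by linarith)]; linarith
theorem th_mid {K y : ℝ} (hK : 3 ≤ K) (h : 1/2 ≤ |y|) (h2 : |y| ≤ K/2) :
    th K y = (|y| - 1/2) * (2 / (K - 1)) := by
  rw [th, min_eq_right, max_eq_right]
  · exact mul_nonneg (by linarith) (div_nonneg (by norm_num) (by linarith))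
  · rw [mul_div_assoc', div_le_iff₀ (by linarith)]; linarith
theorem th_lip {K : ℝ} (hK : 3 ≤ K) (y z : ℝ) : |th K y - th K z| ≤ |y - z| := by
  rw [th, th]
  refine (abs_max_sub_max_le_max _ _ _ _).trans ?_
  rw [sub_self, abs_zero]
  refine max_le (abs_nonneg _) ((abs_min_sub_min_le_max _ _ _ _).trans ?_)
  rw [sub_self, abs_zero]; refine max_le (abs_nonneg _) ?_
  rw [← sub_mul, abs_mul]
  have h1 : |2 / (K - 1)| ≤ 1 := by
    rw [abs_of_nonneg (div_nonneg (by norm_num) (by linarith)), div_le_one (by linarith)]; linarith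
  have h2 : |(|y| - 1/2) - (|z| - 1/2)| ≤ |y - z| := by
    rw [sub_sub_sub_cancel_right]; exact abs_abs_sub_abs_le _ _
  calc _ ≤ |y - z| * 1 := mul_le_mul h2 h1 (abs_nonneg _) (abs_nonneg _)
    _ = _ := mul_one _

def RateOn (c : ℝ) (f : ℝ → ℝ) (S : Set ℝ) : Prop :=
  ∀ x ∈ S, ∀ y ∈ S, x ≤ y → c * (y - x) ≤ f y - f x

theorem RateOn.glue {c : ℝ} {f : ℝ → ℝ} {S : Set ℝ} (a : ℝ) (ha : a ∈ S)
    (h1 : RateOn c f (S ∩ Iic a)) (h2 : RateOn c f (S ∩ Ici a)) : RateOn c f S := by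
  intro x hx y hy hxy
  rcases le_total y a with h | h
  · exact h1 x ⟨hx, hxy.trans h⟩ y ⟨hy, h⟩ hxy
  · rcases le_total x a with h' | h'
    · have := h1 x ⟨hx, h'⟩ a ⟨ha, le_refl a⟩ h'
      have := h2 a ⟨ha, le_refl a⟩ y ⟨hy, h⟩ h
      linarith
    · exact h2 x ⟨hx, h'⟩ y ⟨hy, h⟩ hxy

theorem RateOn.chain {c r : ℝ} (hr : 0 < r) {f : ℝ → ℝ} {a b : ℝ}
    (h : ∀ x y, x ∈ Icc a b → y ∈ Icc a b → x ≤ y → y ≤ x + r → c * (y - x) ≤ f y - f x) :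
    RateOn c f (Icc a b) := by
  have key : ∀ n : ℕ, ∀ x y, x ∈ Icc a b → y ∈ Icc a b → x ≤ y → y ≤ x + n * r →
      c * (y - x) ≤ f y - f x := by
    intro n
    induction n with
    | zero => intro x y _ _ h1 h2; have : y = x := by simp at h2; linarith
              rw [this]; simp
    | succ n ih =>
      intro x y hx hy h1 h2
      push_cast at h2
      rcases le_total y (x + r) with h3 | h3
      · exact h x y hx hy h1 h3
      · have hm : x + r ∈ Icc a b := ⟨by linarith [hx.1], h3.trans hy.2⟩
        have := h x (x+r) hx hm (by linarith) le_rfl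
        have := ih (x+r) y hm hy h3 (by linarith)
        linarith
  intro x hx y hy hxy
  obtain ⟨N, hN⟩ := exists_nat_gt ((y - x) / r)
  rw [div_lt_iff₀ hr] at hN
  exact key N x y hx hy hxy (by linarith)

theorem strip_convex (b : ℝ) : Convex ℝ {z : Pl | |z.2| ≤ b} := by
  intro x hx y hy s t hs ht hst
  simp only [mem_ofPred_eq] at *
  calc |(s • x + t • y).2| = |s * x.2 + t * y.2| := by simp
    _ ≤ |s * x.2| + |t * y.2| := abs_add_le _ _
    _ = s * |x.2| + t * |y.2| := by rw [abs_mul, abs_mul, abs_of_nonneg hs, abs_of_nonneg ht]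
    _ ≤ s * b + t * b := by gcongr
    _ = b := by rw [← add_mul, hst, one_mul]

theorem WRow.lipG {h lam : ℝ} {K : ℕ} {σ : ℤ → Bool} {G : Pl → Pl} {D : ℤ → Mt} {e : ℤ → ℤ}
    {η : ℤ → ℝ} {σ' : ℤ → Bool} (W : WRow h lam K σ G D e η σ')
    (z w : Pl) (h2 : |z.2| ≤ 1/2) (h4 : |w.2| ≤ 1/2) : dist (G z) (G w) ≤ 6 * lam * dist z w := by
  refine chain_upper (strip_convex (1/2)) G (r := 1/2) (by norm_num) ?_ z w h2 h4
  intro z hz w hw hd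
  obtain ⟨N, H, _, na, nb, nc, nd, _⟩ := W.LLm w z hw hz (by
    rw [abs_sub_comm]; exact (d1 z w).trans hd)
  rw [dist_eq_norm, H, dist_eq_norm]
  have e1 := nrm1 (z - w)
  have e2 := nrm2 (z - w)
  apply nrm_le
  · simp only [Mt.ap]
    calc _ ≤ |N.a| * |(z-w).1| + |N.b| * |(z-w).2| := by
          rw [← abs_mul, ← abs_mul]; exact abs_add_le _ _
      _ ≤ lam * 3 * ‖z-w‖ + lam * 3 * ‖z-w‖ := by gcongr <;> exact (abs_nonneg _).trans na
      _ = _ := by ring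
  · simp only [Mt.ap]
    calc _ ≤ |N.c| * |(z-w).1| + |N.d| * |(z-w).2| := by
          rw [← abs_mul, ← abs_mul]; exact abs_add_le _ _
      _ ≤ lam * 3 * ‖z-w‖ + lam * 3 * ‖z-w‖ := by gcongr <;> exact (abs_nonneg _).trans na
      _ = _ := by ring

end BHW

-- ===== Part 9 =====
open Set Metric Filter MeasureTheory
open scoped ENNReal Topology NNReal

namespace BHW

set_option maxHeartbeats 1000000 in
theorem row_ext (h lam : ℝ) (K : ℕ) (hh : 2 * h ^ 2 < 1) (l1 : 1 ≤ lam) (hK : 3 ≤ K) :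
    ∃ C, 1 ≤ C ∧ ∀ σ G D e η σ', WRow h lam K σ G D e η σ' → ∃ F : Pl ≃ Pl, BL C F ∧
      (∀ z, (K:ℝ)/2 ≤ |z.2| → F z = z) ∧ (∀ z : Pl, |z.2| ≤ 1/2 → F z = G z) ∧
      ∀ z, |(F z).1 - z.1| ≤ K := by
  have hKR : (3:ℝ) ≤ K := by exact_mod_cast hK
  set c0 := lam * ((1 - 2 * h ^ 2) / 4) with hc0
  have c0p : 0 < c0 := by rw [hc0]; apply mul_pos (by linarith); linarith
  obtain ⟨C1, hC1, H1⟩ := fiberH (6 * lam) c0 (by positivity) c0p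
  obtain ⟨C2, hC2, H2⟩ := fiberH (6 * lam + 2 + K) (min 1 c0) (by positivity) (lt_min one_pos c0p)
  set c3 : ℝ := min (min (lam/3) (3 * lam / K)) 1 with hc3
  have c3p : 0 < c3 := by
    rw [hc3]; refine lt_min (lt_min ?_ ?_) one_pos <;> positivity
  obtain ⟨C3, hC3, H3⟩ := fiberV (6 * lam * C1 + K + 6) c3 (by positivity) c3p
  refine ⟨C2 * C3, by nlinarith, fun σ G D e η σ' W => ?_⟩
  have half : (0:ℝ) ≤ 1/2 := by norm_num
  set Gc : Pl → Pl := fun z => G (z.1, cl (1/2) z.2) with hGc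
  have Gc_lip : ∀ z w, dist (Gc z) (Gc w) ≤ 6 * lam * dist z w := by
    intro z w
    refine (W.lipG _ _ (cl_abs half _) (cl_abs half _)).trans ?_
    gcongr
    rw [dist_pl, dist_pl]
    exact max_le_max le_rfl (cl_lip _ _ _)
  have g1_lip : Lip (6 * lam) (fun z => (Gc z).1) := by
    intro z w
    rw [Real.dist_eq]
    exact (d1 _ _).trans (Gc_lip z w)
  have g1_rate : ∀ x1 x2 y, x1 ≤ x2 → c0 * (x2 - x1) ≤ (Gc (x2, y)).1 - (Gc (x1, y)).1 := by
    intro x1 x2 y h12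
    refine chain_mono (fun x => (Gc (x, y)).1) (r := 1/2) (by norm_num) ?_ x1 x2 h12
    intro a b hab hab2
    obtain ⟨N, H, na, _⟩ := W.LLm (a, cl (1/2) y) (b, cl (1/2) y) (cl_abs half _) (cl_abs half _)
      (by simp only [abs_le]; constructor <;> linarith)
    have := congrArg Prod.fst H
    simp only [Mt.ap, Prod.fst_sub, Prod.snd_sub, sub_self, mul_zero, add_zero] at this
    simp only [hGc]
    rw [this]
    exact mul_le_mul_of_nonneg_right na (by linarith)
  have g1_disp : ∀ z, |(Gc z).1 - z.1| ≤ K := fun z => W.xbd (z.1, cl (1/2) z.2) (cl_abs half _)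
  obtain ⟨F1, hF1, F1z⟩ := H1 _ g1_lip g1_rate
  have F1s : ∀ z, (F1.symm z).2 = z.2 := by
    intro z
    have := F1z (F1.symm z)
    rw [Equiv.apply_symm_apply] at this
    exact (congrArg Prod.snd this).symm
  have F1g : ∀ z, (Gc (F1.symm z)).1 = z.1 := by
    intro z
    have := F1z (F1.symm z)
    rw [Equiv.apply_symm_apply] at this
    exact (congrArg Prod.fst this).symm
  -- horizontal map
  set X : Pl → ℝ := fun z => z.1 + (1 - th K z.2) * ((Gc z).1 - z.1) with hX
  have X_lip : Lip (6 * lam + 2 + K) X := by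
    intro z w
    rw [Real.dist_eq]
    have e : X z - X w = (z.1 - w.1) + (1 - th K z.2) * (((Gc z).1 - (Gc w).1) - (z.1 - w.1)) +
      (th K w.2 - th K z.2) * ((Gc w).1 - w.1) := by simp only [hX]; ring
    have t1 := th_nonneg K z.2
    have t2 := th_le K z.2
    have a1 := d1 z w
    have a2 := d2 z w
    have a3 := g1_lip z w
    rw [Real.dist_eq] at a3
    have a4 := th_lip hKR w.2 z.2
    rw [abs_sub_comm w.2 z.2] at a4
    have a5 := g1_disp w
    rw [e]
    calc _ ≤ |z.1 - w.1| + |1 - th K z.2| * |((Gc z).1 - (Gc w).1) - (z.1 - w.1)| +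
          |th K w.2 - th K z.2| * |(Gc w).1 - w.1| := by
          rw [← abs_mul, ← abs_mul]
          exact (abs_add_le _ _).trans (by gcongr; exact abs_add_le _ _)
      _ ≤ dist z w + 1 * (6 * lam * dist z w + dist z w) + dist z w * K := by
        gcongr
        · rw [abs_le]; constructor <;> linarith
        · exact (abs_sub _ _).trans (by gcongr)
        · exact a4.trans a2
      _ = _ := by ring
  have X_rate : ∀ x1 x2 y, x1 ≤ x2 → (min 1 c0) * (x2 - x1) ≤ X (x2, y) - X (x1, y) := by
    intro x1 x2 y h12
    have e : X (x2, y) - X (x1, y) = th K y * (x2 - x1) +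
      (1 - th K y) * ((Gc (x2, y)).1 - (Gc (x1, y)).1) := by simp only [hX]; ring
    have t1 := th_nonneg K y
    have t2 := th_le K y
    have h0 : 0 ≤ x2 - x1 := by linarith
    have a1 : min 1 c0 * (x2 - x1) ≤ 1 * (x2 - x1) :=
      mul_le_mul_of_nonneg_right (min_le_left _ _) h0
    have a2 : min 1 c0 * (x2 - x1) ≤ (Gc (x2, y)).1 - (Gc (x1, y)).1 :=
      (mul_le_mul_of_nonneg_right (min_le_right _ _) h0).trans (g1_rate x1 x2 y h12)
    rw [e]
    have u1 := mul_le_mul_of_nonneg_left a1 t1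
    have u2 := mul_le_mul_of_nonneg_left a2 (by linarith : 0 ≤ 1 - th K y)
    linarith
  obtain ⟨H, hH, Hz⟩ := H2 X X_lip X_rate
  -- vertical map
  set v : Pl → ℝ := fun z => (Gc (F1.symm z)).2 with hv
  have v_lip : ∀ z w, |v z - v w| ≤ 6 * lam * C1 * dist z w := by
    intro z w
    refine (d2 _ _).trans ((Gc_lip _ _).trans ?_)
    rw [mul_assoc (6 * lam)]
    exact mul_le_mul_of_nonneg_left (hF1.2 z w) (by positivity)
  have v_bd : ∀ z, |v z| ≤ (K - 3 * lam) / 2 := fun z => W.ybd _ (cl_abs half _)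
  have v_up : ∀ x y, 1/2 ≤ y → v (x, y) = v (x, 1/2) := by
    intro x y hy
    have e : F1.symm (x, y) = ((F1.symm (x, 1/2)).1, y) := by
      rw [Equiv.symm_apply_eq, F1z]
      ext
      · have := F1g (x, 1/2)
        simp only [hGc, F1s] at this ⊢
        rw [cl_of_ge half le_rfl] at this
        rw [cl_of_ge half hy, this]
      · rfl
    simp only [hv, hGc, e, F1s]
    rw [cl_of_ge half hy, cl_of_ge half le_rfl]
  have v_dn : ∀ x y, y ≤ -(1/2) → v (x, y) = v (x, -(1/2)) := by
    intro x y hy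
    have e : F1.symm (x, y) = ((F1.symm (x, -(1/2))).1, y) := by
      rw [Equiv.symm_apply_eq, F1z]
      ext
      · have := F1g (x, -(1/2))
        simp only [hGc, F1s] at this ⊢
        rw [cl_of_le half le_rfl] at this
        rw [cl_of_le half hy, this]
      · rfl
    simp only [hv, hGc, e, F1s]
    rw [cl_of_le half hy, cl_of_le half le_rfl]
  have v_mid : ∀ x, RateOn (lam/3) (fun y => v (x, y)) (Icc (-(1/2)) (1/2)) := by
    intro x
    refine RateOn.chain (r := 1/(2 * C1)) (by positivity) ?_
    intro y1 y2 hy1 hy2 h12 h12'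
    have b1 : |y1| ≤ 1/2 := abs_le.2 hy1
    have b2 : |y2| ≤ 1/2 := abs_le.2 hy2
    have hd : dist (F1.symm (x, y1)) (F1.symm (x, y2)) ≤ 1/2 := by
      refine (hF1.2 _ _).trans ?_
      rw [dist_pl]
      simp only [sub_self, abs_zero]
      rw [max_eq_right (abs_nonneg _), abs_sub_comm, abs_of_nonneg (by linarith)]
      calc C1 * (y2 - y1) ≤ C1 * (1/(2*C1)) := by gcongr; linarith
        _ = 1/2 := by field_simp
    have q1 := F1s (x, y1)
    have q2 := F1s (x, y2)
    have g1 := F1g (x, y1)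
    have g2 := F1g (x, y2)
    have ec1 : Gc (F1.symm (x, y1)) = G (F1.symm (x, y1)) := by
      simp only [hGc, q1]; rw [cl_of_abs b1]; congr 1; ext <;> simp [q1]
    have ec2 : Gc (F1.symm (x, y2)) = G (F1.symm (x, y2)) := by
      simp only [hGc, q2]; rw [cl_of_abs b2]; congr 1; ext <;> simp [q2]
    obtain ⟨N, HN, na, na2, _, _, _, nd⟩ := W.LLm (F1.symm (x, y1)) (F1.symm (x, y2))
      (by rw [q1]; exact b1) (by rw [q2]; exact b2) ((d1 _ _).trans hd)
    simp only [hv]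
    rw [ec1] at g1 ⊢
    rw [ec2] at g2 ⊢
    have s1 := congrArg Prod.fst HN
    have s2 := congrArg Prod.snd HN
    simp only [Mt.ap, Prod.fst_sub, Prod.snd_sub, q1, q2, g1, g2, sub_self] at s1 s2
    rw [s2]
    have na0 : 0 < N.a := lt_of_lt_of_le c0p na
    rw [abs_of_pos na0] at na2
    set dx := (F1.symm (x, y2)).1 - (F1.symm (x, y1)).1
    have key : N.a * (N.c * dx + N.d * (y2 - y1)) = lam ^ 2 * (y2 - y1) := by
      rw [← nd]; linear_combination (-N.c) * s1
    have k2 : N.a * (lam / 3 * (y2 - y1)) ≤ lam^2 * (y2 - y1) := by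
      have : N.a * (lam / 3) ≤ lam * 3 * (lam/3) := mul_le_mul_of_nonneg_right na2 (by positivity)
      calc _ = N.a * (lam/3) * (y2 - y1) := by ring
        _ ≤ lam * 3 * (lam/3) * (y2 - y1) := mul_le_mul_of_nonneg_right this (by linarith)
        _ = _ := by ring
    rw [← key] at k2
    exact le_of_mul_le_mul_left k2 na0
  have KK : (K:ℝ)/(K-1) ≤ 2 := by rw [div_le_iff₀ (by linarith)]; linarith
  have KK0 : 0 ≤ (K:ℝ)/(K-1) := div_nonneg (by linarith) (by linarith)
  set kap : ℝ → ℝ := fun y => (K/(K-1)) * (cl (K/2) y - cl (1/2) y) + (y - cl (K/2) y) with hkap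
  have kap_lip : ∀ y z, |kap y - kap z| ≤ 6 * |y - z| := by
    intro y z
    have e : kap y - kap z = (K/(K-1)) * ((cl (K/2) y - cl (K/2) z) - (cl (1/2) y - cl (1/2) z)) +
      ((y - z) - (cl (K/2) y - cl (K/2) z)) := by simp only [hkap]; ring
    rw [e]
    have a1 := cl_lip (K/2) y z
    have a2 := cl_lip (1/2) y z
    calc _ ≤ (K/(K-1)) * |(cl (K/2) y - cl (K/2) z) - (cl (1/2) y - cl (1/2) z)| +
        |(y - z) - (cl (K/2) y - cl (K/2) z)| := by
          rw [← abs_of_nonneg KK0, ← abs_mul, abs_of_nonneg KK0]; exact abs_add_le _ _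
      _ ≤ 2 * (|y-z| + |y-z|) + (|y-z| + |y-z|) := by
        gcongr
        · exact (abs_sub _ _).trans (by gcongr)
        · exact (abs_sub _ _).trans (by gcongr)
      _ = _ := by ring
  have Khalf : (1:ℝ)/2 ≤ K/2 := by linarith
  set Y : Pl → ℝ := fun z => (1 - th K z.2) * v z + kap z.2 with hY
  have Y_lip : Lip (6 * lam * C1 + K + 6) Y := by
    intro z w
    rw [Real.dist_eq]
    have e : Y z - Y w = (1 - th K z.2) * (v z - v w) + (th K w.2 - th K z.2) * v w +
      (kap z.2 - kap w.2) := by simp only [hY]; ring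
    rw [e]
    have t1 := th_nonneg K z.2
    have t2 := th_le K z.2
    have a4 := th_lip hKR w.2 z.2
    rw [abs_sub_comm w.2 z.2] at a4
    have a2 := d2 z w
    calc _ ≤ |1 - th K z.2| * |v z - v w| + |th K w.2 - th K z.2| * |v w| + |kap z.2 - kap w.2| := by
          rw [← abs_mul, ← abs_mul]
          exact (abs_add_le _ _).trans (by gcongr; exact abs_add_le _ _)
      _ ≤ 1 * (6 * lam * C1 * dist z w) + dist z w * K + 6 * dist z w := by
        gcongr
        · rw [abs_le]; constructor <;> linarith
        · exact v_lip z w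
        · exact a4.trans a2
        · exact (v_bd w).trans (by linarith)
        · exact (kap_lip _ _).trans (by linarith)
      _ = _ := by ring
  have Y_in : ∀ x y, |y| ≤ 1/2 → Y (x, y) = v (x, y) := by
    intro x y hy
    simp only [hY, hkap]
    rw [th_in hKR hy, cl_of_abs hy, cl_of_abs (hy.trans Khalf)]; ring
  have Y_out : ∀ x y, (K:ℝ)/2 ≤ |y| → Y (x, y) = y := by
    intro x y hy
    have K1 : (K:ℝ) - 1 ≠ 0 := by linarith
    simp only [hY, hkap]
    rw [th_out hKR hy]
    rcases le_abs.1 hy with h | h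
    · rw [cl_of_ge (by linarith) h, cl_of_ge half (Khalf.trans h)]; field_simp; ring
    · rw [cl_of_le (by linarith) (by linarith), cl_of_le half (by linarith)]; field_simp; ring
  have Y_up : ∀ x y : ℝ, 1/2 ≤ y → y ≤ K/2 → Y (x, y) = v (x, 1/2) +
      ((y - 1/2) * ((K - 2 * v (x, 1/2)) / (K - 1))) := by
    intro x y hy hy2
    have K1 : (K:ℝ) - 1 ≠ 0 := by linarith
    have ya : |y| = y := abs_of_nonneg (by linarith)
    simp only [hY, hkap]
    rw [v_up x y hy, th_mid hKR (by rw [ya]; exact hy) (by rw [ya]; exact hy2), ya,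
      cl_of_abs (by rw [ya]; exact hy2), cl_of_ge half hy]
    field_simp; ring
  have Y_dn : ∀ x y : ℝ, y ≤ -(1/2) → -((K:ℝ)/2) ≤ y → Y (x, y) = v (x, -(1/2)) +
      ((y + 1/2) * ((K + 2 * v (x, -(1/2))) / (K - 1))) := by
    intro x y hy hy2
    have K1 : (K:ℝ) - 1 ≠ 0 := by linarith
    have ya : |y| = -y := abs_of_nonpos (by linarith)
    simp only [hY, hkap]
    rw [v_dn x y hy, th_mid hKR (by rw [ya]; linarith) (by rw [ya]; linarith), ya,
      cl_of_abs (by rw [ya]; linarith), cl_of_le half hy]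
    field_simp; ring
  have c3a : c3 ≤ lam/3 := (min_le_left _ _).trans (min_le_left _ _)
  have c3b : c3 ≤ 3 * lam / K := (min_le_left _ _).trans (min_le_right _ _)
  have c3c : c3 ≤ 1 := min_le_right _ _
  have c3d : ∀ t : ℝ, |t| ≤ (K - 3 * lam)/2 → c3 ≤ (K - 2 * t)/(K-1) := by
    intro t ht
    refine c3b.trans ?_
    have := abs_le.1 ht
    exact div_le_div₀ (by linarith) (by linarith) (by linarith) (by linarith)
  have Y_rate' : ∀ x, RateOn c3 (fun y => Y (x, y)) univ := by
    intro x
    refine RateOn.glue (-(K/2)) (mem_univ _) ?_ (RateOn.glue (-(1/2))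
      ⟨mem_univ _, by simp only [mem_Ici]; linarith⟩ ?_ (RateOn.glue (1/2)
      ⟨⟨mem_univ _, by simp only [mem_Ici]; linarith⟩, by simp only [mem_Ici]; linarith⟩ ?_
      (RateOn.glue (K/2) ⟨⟨⟨mem_univ _, by simp only [mem_Ici]; linarith⟩,
        by simp only [mem_Ici]; linarith⟩, by simp only [mem_Ici]; linarith⟩ ?_ ?_)))
    · rintro y1 ⟨-, h1⟩ y2 ⟨-, h2⟩ h12
      simp only [mem_Iic] at h1 h2
      simp only
      rw [Y_out x y1 (le_abs.2 (Or.inr (by linarith))), Y_out x y2 (le_abs.2 (Or.inr (by linarith)))]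
      exact (mul_le_mul_of_nonneg_right c3c (by linarith)).trans (by linarith)
    · rintro y1 ⟨⟨-, h1⟩, h1'⟩ y2 ⟨⟨-, h2⟩, h2'⟩ h12
      simp only [mem_Iic, mem_Ici] at h1 h2 h1' h2'
      simp only
      rw [Y_dn x y1 h1' h1, Y_dn x y2 h2' h2]
      have := c3d (-v (x, -(1/2))) (by rw [abs_neg]; exact v_bd _)
      rw [mul_neg, sub_neg_eq_add] at this
      have := mul_le_mul_of_nonneg_right this (by linarith : 0 ≤ y2 - y1)
      linarith
    · rintro y1 ⟨⟨⟨-, h0⟩, h1⟩, h1'⟩ y2 ⟨⟨⟨-, _⟩, h2⟩, h2'⟩ h12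
      simp only [mem_Iic, mem_Ici] at h1 h2 h1' h2'
      simp only
      rw [Y_in x y1 (abs_le.2 ⟨h1, h1'⟩), Y_in x y2 (abs_le.2 ⟨h2, h2'⟩)]
      exact (mul_le_mul_of_nonneg_right c3a (by linarith)).trans
        (v_mid x y1 ⟨h1, h1'⟩ y2 ⟨h2, h2'⟩ h12)
    · rintro y1 ⟨⟨-, h1⟩, h1'⟩ y2 ⟨⟨-, h2⟩, h2'⟩ h12
      simp only [mem_Iic, mem_Ici] at h1 h2 h1' h2'
      simp only
      rw [Y_up x y1 h1 h1', Y_up x y2 h2 h2']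
      have := mul_le_mul_of_nonneg_right (c3d (v (x, 1/2)) (v_bd _)) (by linarith : 0 ≤ y2 - y1)
      linarith
    · rintro y1 ⟨-, h1⟩ y2 ⟨-, h2⟩ h12
      simp only [mem_Ici] at h1 h2
      simp only
      rw [Y_out x y1 (le_abs.2 (Or.inl h1)), Y_out x y2 (le_abs.2 (Or.inl h2))]
      exact (mul_le_mul_of_nonneg_right c3c (by linarith)).trans (by linarith)
  obtain ⟨V, hV, Vz⟩ := H3 Y Y_lip (fun x y1 y2 h12 =>
    Y_rate' x y1 (mem_univ _) y2 (mem_univ _) h12)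
  have Fz : ∀ z, (H.trans V) z = (X z, Y (X z, z.2)) := by
    intro z; rw [Equiv.trans_apply, Hz, Vz]
  refine ⟨H.trans V, BL.trans (by linarith) (by linarith) hH hV, ?_, ?_, ?_⟩
  · intro z hz
    rw [Fz, Y_out _ _ hz]
    simp only [hX]
    rw [th_out hKR hz]; ext <;> simp
  · intro z hz
    have eX : X z = (Gc z).1 := by simp only [hX]; rw [th_in hKR hz]; ring
    have ez : Gc z = G z := by
      simp only [hGc]; rw [cl_of_abs hz]
    rw [Fz, Y_in _ _ hz, eX, ← ez]
    have : F1.symm ((Gc z).1, z.2) = z := by rw [Equiv.symm_apply_eq, F1z]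
    simp only [hv, this]
  · intro z
    rw [Fz]
    simp only [hX]
    rw [add_sub_cancel_left, abs_mul]
    have t1 := th_nonneg K z.2
    have t2 := th_le K z.2
    calc _ ≤ 1 * (K:ℝ) := by
          apply mul_le_mul _ (g1_disp z) (abs_nonneg _) zero_le_one
          rw [abs_le]; constructor <;> linarith
      _ = _ := one_mul _

end BHW

-- ===== Part 10 =====
open Set Metric Filter MeasureTheory
open scoped ENNReal Topology NNReal

namespace BHW

theorem trans_BL {C : ℝ} {F : Pl ≃ Pl} (hF : BL C F) (t : Pl) :
    ∃ F' : Pl ≃ Pl, BL C F' ∧ ∀ z, F' z = F (z - t) + t := by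
  refine ⟨(Equiv.subRight t).trans (F.trans (Equiv.addRight t)), ⟨?_, ?_⟩, ?_⟩
  · intro z w
    have := hF.1 (z - t) (w - t)
    simpa using this
  · intro z w
    have := hF.2 (z - t) (w - t)
    simpa [sub_eq_add_neg] using this
  · intro z; simp

theorem exists_Gam (h lam : ℝ) (K : ℕ) (hh : 2 * h ^ 2 < 1) (l1 : 1 ≤ lam) (hK : 3 ≤ K) :
    ∃ C, 1 ≤ C ∧ ∀ (Act : Set ℤ) (G : ℤ → Pl → Pl),
      (∀ j ∈ Act, ∃ σ D e η σ', WRow h lam K σ (G j) D e η σ') →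
      ∃ Γ : Pl ≃ Pl, BL C Γ ∧
        (∀ j ∈ Act, ∀ z : Pl, |z.2| ≤ 1/2 → Γ (z.1, K * j + z.2) = G j z + (0, (K:ℝ) * j)) ∧
        (∀ j ∉ Act, ∀ z : Pl, |z.2 - K * j| ≤ K / 2 → Γ z = z) ∧
        (∀ z, dist (Γ z) z ≤ K) ∧
        ∀ (j : ℤ) (z : Pl), |z.2 - K * j| ≤ K / 2 → |(Γ z).2 - K * j| ≤ K / 2 := by
  obtain ⟨C, hC, H⟩ := row_ext h lam K hh l1 hK
  have hKR : (3:ℝ) ≤ K := by exact_mod_cast hK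
  refine ⟨2 * C + 1, by linarith, fun Act G hG => ?_⟩
  have hrow : ∀ j : ℤ, ∃ F : Pl ≃ Pl, BL C F ∧ (∀ z : Pl, (K:ℝ)/2 ≤ |z.2 - K * j| → F z = z) ∧
      (j ∈ Act → ∀ z : Pl, |z.2| ≤ 1/2 → F (z.1, K * j + z.2) = G j z + (0, (K:ℝ) * j)) ∧
      (j ∉ Act → ∀ z, F z = z) ∧ (∀ z, |(F z).1 - z.1| ≤ K) := by
    intro j
    by_cases hj : j ∈ Act
    · obtain ⟨σ, D, e, η, σ', W⟩ := hG j hj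
      obtain ⟨F, hF, f1, f2, f3⟩ := H σ (G j) D e η σ' W
      obtain ⟨F', hF', hz⟩ := trans_BL hF (0, (K:ℝ) * j)
      refine ⟨F', hF', ?_, ?_, fun h => absurd hj h, ?_⟩
      · intro z hz2
        rw [hz, f1 _ (by simpa using hz2)]; simp
      · intro _ z hz2
        rw [hz, f2 _ (by simpa using hz2)]
        congr 2; ext <;> simp
      · intro z
        rw [hz]
        have := f3 (z - (0, (K:ℝ) * j))
        simpa using this
    · refine ⟨Equiv.refl _, ⟨fun z w => ?_, fun z w => ?_⟩, fun _ _ => rfl, fun h => absurd h hj,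
        fun _ _ => rfl, fun z => by simp⟩
      · exact le_mul_of_one_le_left dist_nonneg hC
      · exact le_mul_of_one_le_left dist_nonneg hC
  choose F hF f1 f2 f3 f4 using hrow
  obtain ⟨Γ, hΓ, gΓ⟩ := glue (by linarith : (0:ℝ) < K) F (by linarith) hF f1
  have strip : ∀ (j : ℤ) (z : Pl), |z.2 - K * j| ≤ K / 2 → |(Γ z).2 - K * j| ≤ K / 2 := by
    intro j z hz
    rw [gΓ j z hz]
    by_contra hc
    push Not at hc
    have := f1 j _ hc.le
    have := (F j).injective this
    rw [this] at hc
    linarith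
  refine ⟨Γ, hΓ, ?_, ?_, ?_, strip⟩
  · intro j hj z hz
    rw [gΓ j _ (by simp only [add_sub_cancel_left]; linarith), f2 j hj z hz]
  · intro j hj z hz
    rw [gΓ j z hz, f3 j hj]
  · intro z
    have hr : |z.2 - K * (round (z.2 / K) : ℤ)| ≤ K / 2 := by
      have := abs_sub_round (z.2 / K)
      have e : z.2 - K * (round (z.2 / K) : ℤ) = K * (z.2 / K - round (z.2 / K)) := by
        field_simp
      rw [e, abs_mul, abs_of_pos (by linarith : (0:ℝ) < K)]
      nlinarith
    have h2 := strip _ z hr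
    rw [dist_pl]
    refine max_le ?_ ?_
    · rw [gΓ _ z hr]; exact f4 _ z
    · calc |(Γ z).2 - z.2| = |((Γ z).2 - K * (round (z.2 / K) : ℤ)) - (z.2 - K * (round (z.2 / K) : ℤ))| := by
            congr 1; ring
        _ ≤ K/2 + K/2 := (abs_sub _ _).trans (by gcongr)
        _ = K := by ring

end BHW

-- ===== Part 11 =====
open Set Metric Filter MeasureTheory
open scoped ENNReal Topology NNReal

namespace BHW

theorem Mt.ext_ap {M N : Mt} (h : ∀ v, M.ap v = N.ap v) : M = N := by
  have h1 := h (1, 0)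
  have h2 := h (0, 1)
  simp only [Mt.ap, mul_one, mul_zero, add_zero, zero_add, Prod.mk.injEq] at h1 h2
  ext
  · exact h1.1
  · exact h2.1
  · exact h1.2
  · exact h2.2

theorem grow_row {h S lam : ℝ} {K : ℕ} (hK : 3 ≤ K) (l1 : 1 ≤ lam) {g G : Pl → Pl} {D D' : ℤ → Mt}
    {e e' : ℤ → ℤ} {η η' : ℤ → ℝ} {σ σ' : ℤ → Bool}
    (R : ConfRow h S g D e η σ) (W : WRow h lam K σ G D' e' η' σ') :
    ∃ D'' e'' η'', ConfRow h (S * lam / K) (fun z => g ((1/(K:ℝ)) • G z)) D'' e'' η'' σ' := by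
  have hK0 : 0 < K := by omega
  have hKR : (0:ℝ) < K := by exact_mod_cast hK0
  let D'' : ℤ → Mt := fun l => ((D (l / K)).mu (D' l)).sc (1/(K:ℝ))
  let e'' : ℤ → ℤ := fun l => if (l % K) = 0 then e (l / K) else e' l
  let η'' : ℤ → ℝ := fun l => if (l % K) = 0 then η (l / K) else η' l
  have md : ∀ (i : ℤ) (o : ℕ), o < K → ((K * i + o : ℤ) % K) = o := fun i o ho => by
    rw [Int.add_comm, Int.add_mul_emod_self_left, Int.emod_eq_of_lt (by omega) (by omega)]
  have ec : ∀ (i : ℤ), (K * i : ℤ) = K * i + (0 : ℕ) := fun i => by simp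
  have em : ∀ (i : ℤ) (o : ℕ), 1 ≤ o → (K * i + o - 1 : ℤ) = K * i + (o - 1 : ℕ) :=
    fun i o ho => by omega
  have em0 : ∀ (i : ℤ), (K * i - 1 : ℤ) = K * (i - 1) + (K - 1 : ℕ) := fun i => by
    rw [mul_sub]; omega
  have eD : ∀ (i : ℤ) (o : ℕ), o < K → D'' (K * i + o) = ((D i).mu (D' (K * i + o))).sc (1/(K:ℝ)) :=
    fun i o ho => by simp only [D'']; rw [dec_div K i o ho]
  have e0 : ∀ i : ℤ, e'' (K * i) = e i := fun i => by
    simp only [e'']; rw [if_pos (by simp), Int.mul_ediv_cancel_left _ (by omega)]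
  have η0 : ∀ i : ℤ, η'' (K * i) = η i := fun i => by
    simp only [η'']; rw [if_pos (by simp), Int.mul_ediv_cancel_left _ (by omega)]
  have e1 : ∀ (i : ℤ) (o : ℕ), 1 ≤ o → o < K → e'' (K * i + o) = e' (K * i + o) :=
    fun i o h1 h2 => by simp only [e'']; rw [if_neg]; rw [md i o h2]; omega
  have η1 : ∀ (i : ℤ) (o : ℕ), 1 ≤ o → o < K → η'' (K * i + o) = η' (K * i + o) :=
    fun i o h1 h2 => by simp only [η'']; rw [if_neg]; rw [md i o h2]; omega
  have D'1 : ∀ (i : ℤ) (v : Pl), (D' (K * i - 1)).ap v = lam • v := fun i v => by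
    have := W.row.hD (K * i)
    rw [W.hη0, Bm_zero] at this
    rw [← this, W.D0]
  have D0 : ∀ (i : ℤ) (v : Pl), (D'' (K * i)).ap v = (lam / K) • (D i).ap v := fun i v => by
    have := eD i 0 hK0
    rw [← ec] at this
    rw [this, Mt.ap_sc, Mt.ap_mu, W.D0, Mt.ap_smul, smul_smul]; congr 1; ring
  have D1 : ∀ (i : ℤ) (v : Pl), (D'' (K * i - 1)).ap v = (lam / K) • (D (i-1)).ap v := fun i v => by
    have := eD (i-1) (K-1) (by omega)
    rw [← em0] at this
    rw [this, Mt.ap_sc, Mt.ap_mu, D'1, Mt.ap_smul, smul_smul]; congr 1; ring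
  refine ⟨D'', e'', η'', ⟨?_, ?_, ?_, ?_⟩, ?_, ?_⟩
  · intro l
    simp only [e'']
    split_ifs
    · exact R.row.he _
    · exact W.row.he _
  · intro l
    obtain ⟨i, o, ho, rfl⟩ := dec K hK0 l
    rcases Nat.eq_zero_or_pos o with rfl | h1
    · rw [← ec]
      apply Mt.ext_ap
      intro v
      rw [D0, Mt.ap_mu, D1, e0, η0, R.row.hD i, Mt.ap_mu]
    · rw [eD i o ho, em i o h1, eD i _ (by omega), e1 i o h1 ho, η1 i o h1 ho, ← em i o h1,
        W.row.hD (K * i + o)]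
      apply Mt.ext_ap
      intro v
      simp only [Mt.ap_sc, Mt.ap_mu]
  · intro l
    obtain ⟨i, o, ho, rfl⟩ := dec K hK0 l
    rcases Nat.eq_zero_or_pos o with rfl | h1
    · right
      have := η1 i 1 le_rfl (by omega)
      rw [← ec]
      push_cast at this
      rw [this, (W.ηn i).1]
    · rcases Nat.lt_or_ge (o+1) K with h2 | h2
      · have := η1 i (o+1) (by omega) h2
        push_cast at this
        rw [η1 i o h1 ho, add_assoc, this, ← add_assoc]
        exact W.row.hadj _
      · left
        rw [η1 i o h1 ho]
        have : (K * i + o : ℤ) = K * (i + 1) - 1 := by rw [mul_add]; omega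
        rw [this, (W.ηn _).2]
  · intro m w hw1 hw2
    obtain ⟨i, o, ho, rfl⟩ := dec K hK0 m
    rcases Nat.eq_zero_or_pos o with rfl | h1
    · rw [← ec, D1, e0, η0]
      have t := W.row.tile (K * i) w hw1 hw2
      rw [W.hη0, bd_zero, D'1] at t
      push_cast at t ⊢
      rw [W.cen] at t
      rw [t, W.cen]
      have lK : lam / K ≤ 1 := by
        rw [div_le_one hKR]; linarith [W.lK]
      have l0 : 0 ≤ lam / K := by positivity
      have q : ∀ x : ℝ, |x| ≤ 1/2 → |lam / K * x| ≤ 1/2 := fun x hx => by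
        rw [abs_mul, abs_of_nonneg l0]
        calc _ ≤ 1 * |x| := by gcongr
          _ ≤ _ := by linarith
      have t2 := R.row.tile i ((lam / K) • w) (q _ hw1) (q _ hw2)
      have ea : (1/(K:ℝ)) • (((K:ℝ) * (i:ℝ), (0:ℝ)) + lam • w) = ((i:ℝ) + ((lam / K) • w).1, ((lam / K) • w).2) := by
        ext
        · simp; field_simp
        · simp; field_simp
      have eb : (1/(K:ℝ)) • (((K:ℝ) * (i:ℝ), (0:ℝ)) : Pl) = ((i:ℝ), (0:ℝ)) := by
        ext
        · simp; field_simp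
        · simp
      rw [ea, t2, eb, bd_smul _ _ l0, Mt.ap_smul]
    · rw [em i o h1, eD i _ (by omega), e1 i o h1 ho, η1 i o h1 ho, ← em i o h1]
      have rg := W.reg i o h1 ho
      have aff : ∀ w : Pl, |w.1| ≤ 1/2 → |w.2| ≤ 1/2 →
          g ((1/(K:ℝ)) • G (K * i + o + w.1, w.2)) = g (i, 0) +
            (D i).ap ((1/(K:ℝ)) • G (K * i + o + w.1, w.2) - ((i:ℝ), (0:ℝ))) := by
        intro w hw1 hw2
        obtain ⟨r1, r2⟩ := rg w hw1 hw2
        set p := G (K * i + o + w.1, w.2)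
        have a2 : ((1/(K:ℝ)) • p - ((i:ℝ), (0:ℝ))).2 = p.2 / K := by simp; ring
        have a1 : ((1/(K:ℝ)) • p - ((i:ℝ), (0:ℝ))).1 = (p.1 - K * i) / K := by simp; field_simp
        have := R.row.seg i ((1/(K:ℝ)) • p - ((i:ℝ), (0:ℝ))) (by
          rw [a1, a2, abs_div, abs_of_pos hKR]; gcongr) (by
          rw [a1, a2, abs_div, abs_of_pos hKR, show 1 - (p.1 - K * i)/K = (K * i + K - p.1)/K by
            field_simp; ring]; gcongr)
        rw [← this]
        congr 1; ext <;> simp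
      have z1 := aff w hw1 hw2
      have z0 := aff (0, 0) (by norm_num) (by norm_num)
      have t := W.row.tile (K * i + o) w hw1 hw2
      push_cast at t ⊢
      rw [add_zero] at z0
      simp only at z0 ⊢
      rw [z1, z0, t, add_assoc (g _), Mt.ap_sc, Mt.ap_mu, ← Mt.ap_smul, ← Mt.ap_add,
        smul_add]
      congr 2
      abel
  · intro l
    obtain ⟨i, o, ho, rfl⟩ := dec K hK0 l
    rcases Nat.eq_zero_or_pos o with rfl | h1
    · rw [← ec, η0, W.s0, W.s1]; exact R.hη i
    · rw [η1 i o h1 ho]; exact W.hη i o h1 ho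
  · intro l v
    obtain ⟨i, o, ho, rfl⟩ := dec K hK0 l
    rw [eD i o ho, Mt.ap_sc, Mt.ap_mu, qf_smul, R.hq, W.hq i o ho]
    ring

theorem stay_row {h S : ℝ} {m : ℕ} {K : ℕ} (hK : K = 2 * m + 1) (hm : 1 ≤ m) {g : Pl → Pl}
    {D : ℤ → Mt} {e : ℤ → ℤ} {η : ℤ → ℝ} {σ : ℤ → Bool} (R : ConfRow h S g D e η σ)
    (k : ℤ) (hk : |k| < m) :
    ∃ D'' e'' η'' σ'', ConfRow h (S / K) (fun z => g ((1/(K:ℝ)) • (z + (0, (k:ℝ))))) D'' e'' η'' σ'' := by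
  have hK0 : 0 < K := by omega
  have hKR : (0:ℝ) < K := by exact_mod_cast hK0
  have hKm : (K:ℝ) = 2 * m + 1 := by rw [hK]; push_cast; ring
  let I : ℤ → ℤ := fun l => (l + m) / K
  let t : ℤ → ℤ := fun l => l - K * I l - e (I l) * k
  let J : ℤ → ℤ := fun l => if 0 ≤ t l then I l else I l - 1
  have hI : ∀ l, -(m:ℤ) ≤ l - K * I l ∧ l - K * I l ≤ m := by
    intro l
    have h1 := Int.emod_nonneg (l + m) (show (K:ℤ) ≠ 0 by omega)
    have h2 := Int.emod_lt_of_pos (l + m) (show (0:ℤ) < K by omega)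
    have h3 := Int.mul_ediv_add_emod (l + m) K
    simp only [I]
    constructor <;> omega
  have hI' : ∀ l i : ℤ, -(m:ℤ) ≤ l - K * i → l - K * i ≤ m → I l = i := by
    intro l i h1 h2
    simp only [I]
    rw [show l + m = (l - K * i + m) + K * i by ring, Int.add_mul_ediv_left _ _ (by omega),
      Int.ediv_eq_zero_of_lt (by omega) (by omega)]
    simp
  have hek : ∀ i, -(m:ℤ) < e i * k ∧ e i * k < m := by
    intro i
    have := abs_lt.1 hk
    rcases R.row.he i with h | h <;> rw [h] <;> constructor <;> omega
  have hJ1 : ∀ l, J (l - 1) = if 1 ≤ t l then I l else I l - 1 := by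
    intro l
    have a := hI l
    have b := hek (I l)
    by_cases c : l - K * I l = -m
    · have i1 : I (l - 1) = I l - 1 := hI' _ _ (by rw [mul_sub]; omega) (by rw [mul_sub]; omega)
      have t0 : ¬ 1 ≤ t l := by simp only [t]; omega
      have b' := hek (I l - 1)
      have t1 : 0 ≤ t (l - 1) := by simp only [t]; rw [i1, mul_sub]; omega
      simp only [J]; rw [if_pos t1, if_neg t0, i1]
    · have i1 : I (l - 1) = I l := hI' _ _ (by omega) (by omega)
      have : t (l - 1) = t l - 1 := by simp only [t]; rw [i1]; ring
      simp only [J]; rw [this, i1]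
      by_cases d : 1 ≤ t l
      · rw [if_pos (by omega), if_pos d]
      · rw [if_neg (by omega), if_neg d]
  have hJm : ∀ l, t l = 0 → J (l-1) = I l - 1 ∧ J l = I l := by
    intro l h
    rw [hJ1]
    simp only [J]
    rw [if_neg (by omega), if_pos (by omega)]; exact ⟨rfl, rfl⟩
  have hJe : ∀ l, t l ≠ 0 → J (l-1) = J l := by
    intro l h
    rw [hJ1]
    simp only [J]
    by_cases d : 1 ≤ t l
    · rw [if_pos d, if_pos (by omega)]
    · rw [if_neg d, if_neg (by omega)]
  let D'' : ℤ → Mt := fun l => (D (J l)).sc (1/(K:ℝ))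
  let e'' : ℤ → ℤ := fun l => e (I l)
  let η'' : ℤ → ℝ := fun l => if t l = 0 then η (I l) else 0
  refine ⟨D'', e'', η'', fun l => σ (J l), ⟨?_, ?_, ?_, ?_⟩, ?_, ?_⟩
  · intro l; exact R.row.he _
  · intro l
    simp only [D'', e'', η'']
    split_ifs with c
    · obtain ⟨j1, j2⟩ := hJm l c
      rw [j1, j2]
      apply Mt.ext_ap; intro v
      rw [R.row.hD (I l)]
      simp only [Mt.ap_sc, Mt.ap_mu]
    · rw [Bm_zero, hJe l c]
  · intro l
    by_cases c : t l = 0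
    · right
      have a := hI l
      have b := hek (I l)
      have i1 : I (l + 1) = I l := hI' _ _ (by simp only [t] at c; omega) (by simp only [t] at c; omega)
      have : t (l + 1) = 1 := by simp only [t] at c ⊢; rw [i1]; omega
      simp only [η'']; rw [if_neg (by omega)]
    · left; simp only [η'']; rw [if_neg c]
  · intro l w hw1 hw2
    have a := hI l
    set i := I l with hi
    set r : ℝ := (l:ℝ) - K * i with hr
    have hra : |r| ≤ m := by
      rw [hr, abs_le]
      constructor
      · have := a.1; have : ((-(m:ℤ) : ℤ):ℝ) ≤ ((l - K * i : ℤ) : ℝ) := by exact_mod_cast this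
        push_cast at this; exact this
      · have := a.2; have : ((l - K * i : ℤ) : ℝ) ≤ ((m:ℤ):ℝ) := by exact_mod_cast this
        push_cast at this; exact this
    have hka : |(k:ℝ)| ≤ m := by
      have : |k| ≤ m := hk.le
      exact_mod_cast this
    have aff : ∀ w : Pl, |w.1| ≤ 1/2 → |w.2| ≤ 1/2 →
        g ((1/(K:ℝ)) • (((l:ℝ) + w.1, w.2) + (0, (k:ℝ)))) = g (i, 0) + (D (i-1)).ap
          (bd (e i) (η i) ((1/(K:ℝ)) • ((r, (k:ℝ)) + w))) := by
      intro w hw1 hw2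
      have u : ∀ x y : ℝ, |x| ≤ m → |y| ≤ 1/2 → |(1/(K:ℝ)) * (x + y)| ≤ 1/2 := by
        intro x y hx hy
        rw [abs_mul, abs_of_pos (by positivity : 0 < 1/(K:ℝ)), one_div, inv_mul_le_iff₀ hKR]
        refine (abs_add_le _ _).trans ?_
        rw [hKm]; linarith
      have := R.row.tile i ((1/(K:ℝ)) • ((r, (k:ℝ)) + w)) (u _ _ hra hw1) (u _ _ hka hw2)
      rw [← this]
      congr 1
      ext
      · simp [hr]; field_simp; ring
      · simp; ring
    have z1 := aff w hw1 hw2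
    have z0 := aff (0, 0) (by norm_num) (by norm_num)
    simp only [add_zero] at z0 ⊢
    rw [z1, z0, show ((0:ℝ),(0:ℝ)) = 0 from rfl, add_zero, bd_smul _ _ (by positivity),
      bd_smul _ _ (by positivity)]
    simp only [D'', e'', η'']
    have htr : ((t l : ℤ):ℝ) = r - e i * k := by simp only [t, hr, ← hi]; push_cast; ring
    have hw' := abs_le.1 hw1
    have ew := R.row.emul i hw2
    rcases lt_trichotomy (t l) 0 with c | c | c
    · have : J (l - 1) = i - 1 := by rw [hJ1, if_neg (by omega)]
      rw [this, if_neg (by omega), bd_zero]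
      have c' : ((t l : ℤ):ℝ) ≤ -1 := by exact_mod_cast (by omega : t l ≤ -1)
      rw [htr] at c'
      rw [bd_inact (by simp only [Prod.fst_add, Prod.snd_add]; linarith), bd_inact (by simp only; linarith),
        Mt.ap_sc, smul_add, Mt.ap_add, Mt.ap_smul (D (i-1)) _ w, add_assoc]
    · obtain ⟨j1, j2⟩ := hJm l c
      rw [j1, if_pos c]
      have c' : r - e i * k = 0 := by rw [← htr, c]; simp
      rw [Mt.ap_sc, add_assoc, ← Mt.ap_smul, ← hi, ← Mt.ap_add, ← smul_add]
      congr 3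
      have q1 : r + w.1 - e i * (k + w.2) = w.1 - e i * w.2 := by linear_combination c'
      ext
      · simp only [bd, Prod.fst_add, Prod.snd_add]; rw [q1, c', max_self]; ring
      · simp only [bd, Prod.fst_add, Prod.snd_add]; rw [q1, c', max_self]; ring
    · have : J (l - 1) = i := by rw [hJ1, if_pos (by omega)]
      rw [this, if_neg (by omega), bd_zero]
      have c' : (1:ℝ) ≤ ((t l : ℤ):ℝ) := by exact_mod_cast (by omega : 1 ≤ t l)
      rw [htr] at c'
      rw [bd_act (R.row.heR i) (by simp only [Prod.fst_add, Prod.snd_add]; linarith),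
        bd_act (R.row.heR i) (by simp only; linarith), Mt.ap_smul, Mt.ap_smul, ← Mt.ap_mu, ← Mt.ap_mu,
        ← R.row.hD, Mt.ap_sc, Mt.ap_add, smul_add, add_assoc]
  · intro l
    simp only [η'']
    split_ifs with c
    · obtain ⟨j1, j2⟩ := hJm l c
      simp only [j1, j2]; exact R.hη _
    · left; exact ⟨rfl, by rw [hJe l c]⟩
  · intro l v
    simp only [D'']
    rw [Mt.ap_sc, qf_smul, R.hq]; ring

end BHW

-- ===== Part 12 =====
open Set Metric Filter MeasureTheory
open scoped ENNReal Topology NNReal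

namespace BHW

def IsCR (h S : ℝ) (g : Pl → Pl) : Prop := ∃ D e η σ, ConfRow h S g D e η σ

theorem IsCR.congr {h S : ℝ} {g g' : Pl → Pl} (H : IsCR h S g)
    (hg : ∀ z : Pl, |z.2| ≤ 1/2 → g' z = g z) : IsCR h S g' := by
  obtain ⟨D, e, η, σ, R⟩ := H
  refine ⟨D, e, η, σ, ⟨R.row.he, R.row.hD, R.row.hadj, ?_⟩, R.hη, R.hq⟩
  intro m w h1 h2
  rw [hg (m + w.1, w.2) h2, hg (m, 0) (by norm_num)]
  exact R.row.tile m w h1 h2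

theorem IsCR_id (h : ℝ) : IsCR h 1 (fun z => z) := by
  refine ⟨fun _ => ⟨1, 0, 0, 1⟩, fun _ => 1, fun _ => 0, fun _ => true, ⟨?_, ?_, ?_, ?_⟩, ?_, ?_⟩
  · intro l; left; rfl
  · intro l; rw [Bm_zero]
  · intro l; left; rfl
  · intro m w _ _
    rw [bd_zero]; ext <;> simp [Mt.ap]
  · intro l; left; exact ⟨rfl, rfl⟩
  · intro l v; simp [Mt.ap, qf]

theorem scale_BL {C μ : ℝ} (hμ : 0 < μ) {F : Pl ≃ Pl} (hF : BL C F) :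
    ∃ F' : Pl ≃ Pl, BL C F' ∧ ∀ z, F' z = (1/μ) • F (μ • z) := by
  have e1 : ∀ z : Pl, μ • (1/μ) • z = z := fun z => by
    rw [smul_smul, mul_one_div_cancel hμ.ne', one_smul]
  have e2 : ∀ z : Pl, (1/μ) • μ • z = z := fun z => by
    rw [smul_smul, one_div_mul_cancel hμ.ne', one_smul]
  have key : ∀ f : Pl → Pl, Lip C f → Lip C (fun z => (1/μ) • f (μ • z)) := by
    intro f hf z w
    have := hf (μ • z) (μ • w)
    rw [dist_smul₀, Real.norm_of_nonneg hμ.le] at this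
    simp only
    rw [dist_smul₀, Real.norm_of_nonneg (by positivity), one_div, inv_mul_le_iff₀ hμ]
    linarith
  refine ⟨⟨fun z => (1/μ) • F (μ • z), fun z => (1/μ) • F.symm (μ • z), ?_, ?_⟩, ⟨?_, ?_⟩, ?_⟩
  · intro z; simp only [e1, Equiv.symm_apply_apply, e2]
  · intro z; simp only [e1, Equiv.apply_symm_apply, e2]
  · exact key _ hF.1
  · exact key _ hF.2
  · intro z; rfl

def GamC (h lam : ℝ) (K : ℕ) (C : ℝ) : Prop := ∀ (Act : Set ℤ) (G : ℤ → Pl → Pl),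
      (∀ j ∈ Act, ∃ σ D e η σ', WRow h lam K σ (G j) D e η σ') →
      ∃ Γ : Pl ≃ Pl, BL C Γ ∧
        (∀ j ∈ Act, ∀ z : Pl, |z.2| ≤ 1/2 → Γ (z.1, K * j + z.2) = G j z + (0, (K:ℝ) * j)) ∧
        (∀ j ∉ Act, ∀ z : Pl, |z.2 - K * j| ≤ K / 2 → Γ z = z) ∧
        (∀ z, dist (Γ z) z ≤ K) ∧
        ∀ (j : ℤ) (z : Pl), |z.2 - K * j| ≤ K / 2 → |(Γ z).2 - K * j| ≤ K / 2

theorem grow_step {h lam C κ S : ℝ} {K : ℕ} (hK : 3 ≤ K) (l1 : 1 ≤ lam) (hκ : 0 < κ)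
    (hW : ∀ σ, ∃ G D e η σ', WRow h lam K σ G D e η σ') (hG : GamC h lam K C)
    (f : Pl ≃ Pl) (Act : Set ℤ)
    (hf : ∀ j ∈ Act, IsCR h S (fun z => f ((1/κ) • (z + (0, (j:ℝ)))))) :
    ∃ Γ : Pl ≃ Pl, BL C Γ ∧ (∀ j ∉ Act, ∀ z : Pl, |κ * z.2 - j| ≤ 1/2 → Γ z = z) ∧
      (∀ (j : ℤ) (z : Pl), |κ * z.2 - j| ≤ 1/2 → |κ * (Γ z).2 - j| ≤ 1/2) ∧
      (∀ z, dist (Γ z) z ≤ 1/κ) ∧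
      ∀ j ∈ Act, IsCR h (S * lam / K)
        (fun z => f (Γ ((1/(κ * K)) • (z + (0, ((K * j : ℤ):ℝ)))))) := by
  have hKR : (0:ℝ) < K := by exact_mod_cast (by omega : 0 < K)
  have hμ : 0 < κ * K := by positivity
  classical
  have hex : ∀ j : ℤ, ∃ G : Pl → Pl, j ∈ Act → ((∃ σ D e η σ', WRow h lam K σ G D e η σ') ∧
      IsCR h (S * lam / K) (fun z => f ((1/κ) • ((1/(K:ℝ)) • G z + (0, (j:ℝ)))))) := by
    intro j
    by_cases hj : j ∈ Act
    · obtain ⟨D, e, η, σ, R⟩ := hf j hj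
      obtain ⟨G, D', e', η', σ', W⟩ := hW σ
      obtain ⟨D2, e2, η2, R2⟩ := grow_row hK l1 R W
      exact ⟨G, fun _ => ⟨⟨_, _, _, _, _, W⟩, _, _, _, _, R2⟩⟩
    · exact ⟨id, fun h => (hj h).elim⟩
  choose G hGG using hex
  obtain ⟨Γ, b1, b2, b3, b4, b5⟩ := hG Act G (fun j hj => (hGG j hj).1)
  obtain ⟨Γ', c1, c2⟩ := scale_BL hμ b1
  have e1 : ∀ z : Pl, (κ * K) • (1/(κ * K)) • z = z := fun z => by
    rw [smul_smul, mul_one_div_cancel hμ.ne', one_smul]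
  have e2 : ∀ z : Pl, (1/(κ * K)) • (κ * K) • z = z := fun z => by
    rw [smul_smul, one_div_mul_cancel hμ.ne', one_smul]
  have q : ∀ (j : ℤ) (z : Pl), |κ * z.2 - j| ≤ 1/2 ↔ |((κ * K) • z).2 - K * j| ≤ K/2 := by
    intro j z
    have : ((κ * K) • z).2 - K * j = K * (κ * z.2 - j) := by simp; ring
    rw [this, abs_mul, abs_of_pos hKR, show (K:ℝ)/2 = K * (1/2) by ring,
      mul_le_mul_iff_right₀ hKR]
  refine ⟨Γ', c1, ?_, ?_, ?_, ?_⟩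
  · intro j hj z hz
    rw [c2, b3 j hj _ ((q j z).1 hz), e2]
  · intro j z hz
    rw [q, c2, e1]
    exact b5 j _ ((q j z).1 hz)
  · intro z
    have := b4 ((κ * K) • z)
    rw [c2]
    have e3 : z = (1/(κ * K)) • (κ * K) • z := (e2 z).symm
    conv_lhs => rw [e3]; rw [e1]
    rw [dist_smul₀, Real.norm_of_nonneg (by positivity)]
    calc _ ≤ 1/(κ*K) * K := by gcongr
      _ = _ := by field_simp
  · intro j hj
    refine (hGG j hj).2.congr ?_
    intro z hz
    have : z + (0, ((K * j : ℤ):ℝ)) = (z.1, K * j + z.2) := by ext <;> simp; ring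
    rw [c2, e1, this, b2 j hj z hz]
    congr 1
    ext
    · simp; field_simp
    · simp; field_simp

/-- The abstract tower used for the estimates. -/
structure Tower (K : ℕ) (lam C : ℝ) (Act : ℕ → Set ℤ) (Λ : ℕ → ℝ) (f Γ : ℕ → Pl ≃ Pl) : Prop where
  K64 : 64 ≤ K
  l1 : 1 ≤ lam
  lK : 4 * lam ≤ K
  C1 : 1 ≤ C
  f0 : ∀ z, f 0 z = z
  fs : ∀ n z, f (n+1) z = f n (Γ n z)
  bl : ∀ n, BL C (Γ n)
  off : ∀ n, ∀ j ∉ Act n, ∀ z : Pl, |(K:ℝ)^n * z.2 - j| ≤ 1/2 → Γ n z = z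
  strip : ∀ n (j : ℤ) (z : Pl), |(K:ℝ)^n * z.2 - j| ≤ 1/2 → |(K:ℝ)^n * (Γ n z).2 - j| ≤ 1/2
  disp : ∀ n z, dist (Γ n z) z ≤ 1/(K:ℝ)^n
  loc : ∀ n, ∀ j ∈ Act n, ∀ z w : Pl, |(K:ℝ)^n * z.2 - j| ≤ 1/2 → |(K:ℝ)^n * w.2 - j| ≤ 1/2 →
    |z.1 - w.1| ≤ 1/(K:ℝ)^n/2 → dist (f n z) (f n w) ≤ 12 * Λ n * dist z w ∧
      Λ n * dist z w ≤ 12 * dist (f n z) (f n w)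
  up : ∀ n, ∀ j ∈ Act n, ∀ z w : Pl, |(K:ℝ)^n * z.2 - j| ≤ 1/2 → |(K:ℝ)^n * w.2 - j| ≤ 1/2 →
    dist (f n z) (f n w) ≤ 12 * Λ n * dist z w
  L0 : Λ 0 = 1
  L1 : ∀ n, Λ n ≤ Λ (n+1)
  L2 : ∀ n, Λ (n+1) ≤ lam * Λ n
  nest : ∀ n, ∀ j' ∈ Act (n+1), ∃ j ∈ Act n, |((j' - K * j : ℤ):ℝ)| + 1/2 ≤ 7/16 * K

theorem exists_tower {h lam C : ℝ} {K m : ℕ} (hK : K = 2 * m + 1) (K64 : 64 ≤ K) (l1 : 1 ≤ lam)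
    (lK : 4 * lam ≤ K) (h0 : 0 ≤ h) (hh : 2 * h ^ 2 < 1) (C1 : 1 ≤ C)
    (hW : ∀ σ, ∃ G D e η σ', WRow h lam K σ G D e η σ') (hG : GamC h lam K C)
    (m2 : ℕ) (hm2 : (m2:ℝ) + 1/2 ≤ 7/16 * K) (gr : ℕ → Prop) (Act : ℕ → Set ℤ) (Λ : ℕ → ℝ)
    (A0 : Act 0 = {0}) (A1 : ∀ n, gr n → ∀ j' ∈ Act (n+1), ∃ j ∈ Act n, j' = K * j)
    (A2 : ∀ n, ¬ gr n → ∀ j' ∈ Act (n+1), ∃ j ∈ Act n, ∃ d : ℤ, |d| ≤ m2 ∧ j' = K * j + d)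
    (L0 : Λ 0 = 1) (L1 : ∀ n, gr n → Λ (n+1) = lam * Λ n) (L2 : ∀ n, ¬ gr n → Λ (n+1) = Λ n) :
    ∃ f Γ : ℕ → Pl ≃ Pl, Tower K lam C Act Λ f Γ := by
  have hKR : (0:ℝ) < K := by exact_mod_cast (by omega : 0 < K)
  have Lpos : ∀ n, 0 < Λ n := by
    intro n
    induction n with
    | zero => rw [L0]; norm_num
    | succ n ih =>
      by_cases g : gr n
      · rw [L1 n g]; positivity
      · rw [L2 n g]; exact ih
  let P : ℕ → (Pl ≃ Pl) → Prop := fun n f => ∀ j ∈ Act n,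
    IsCR h (Λ n / (K:ℝ)^n) (fun z => f ((1/(K:ℝ)^n) • (z + (0, (j:ℝ)))))
  let Q : ℕ → (Pl ≃ Pl) → Prop := fun n Γ => BL C Γ ∧
    (∀ j ∉ Act n, ∀ z : Pl, |(K:ℝ)^n * z.2 - j| ≤ 1/2 → Γ z = z) ∧
    (∀ (j : ℤ) (z : Pl), |(K:ℝ)^n * z.2 - j| ≤ 1/2 → |(K:ℝ)^n * (Γ z).2 - j| ≤ 1/2) ∧
    (∀ z, dist (Γ z) z ≤ 1/(K:ℝ)^n)
  have step : ∀ n f, P n f → ∃ Γ, Q n Γ ∧ P (n+1) (Γ.trans f) := by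
    intro n f hP
    by_cases g : gr n
    · obtain ⟨Γ, b1, b2, b3, b4, b5⟩ := grow_step (by omega) l1 (by positivity) hW hG f (Act n) hP
      refine ⟨Γ, ⟨b1, b2, b3, b4⟩, ?_⟩
      intro j' hj'
      obtain ⟨j, hj, rfl⟩ := A1 n g j' hj'
      have := b5 j hj
      have e : Λ (n+1) / (K:ℝ)^(n+1) = Λ n / (K:ℝ)^n * lam / K := by
        rw [L1 n g, pow_succ]; field_simp
      rw [e, pow_succ]
      exact this
    · refine ⟨Equiv.refl _, ⟨⟨?_, ?_⟩, fun _ _ _ _ => rfl, fun _ _ h => h, ?_⟩, ?_⟩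
      · intro z w; simp only [Equiv.refl_apply]; nlinarith [dist_nonneg (x := z) (y := w)]
      · intro z w; simp only [Equiv.refl_symm, Equiv.refl_apply]; nlinarith [dist_nonneg (x := z) (y := w)]
      · intro z; simp only [Equiv.refl_apply, dist_self]; positivity
      · intro j' hj'
        obtain ⟨j, hj, d, hd, rfl⟩ := A2 n g j' hj'
        obtain ⟨D, e, η, σ, R⟩ := hP j hj
        have hdm : |d| < m := by
          have : (m2:ℝ) < m := by
            have : (K:ℝ) = 2 * m + 1 := by rw [hK]; push_cast; ring
            have : (64:ℝ) ≤ K := by exact_mod_cast K64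
            linarith
          have : m2 < m := by exact_mod_cast this
          omega
        obtain ⟨D', e', η', σ', R'⟩ := stay_row hK (by omega) R d hdm
        have e : Λ (n+1) / (K:ℝ)^(n+1) = Λ n / (K:ℝ)^n / K := by
          rw [L2 n g, pow_succ]; field_simp
        rw [e]
        refine IsCR.congr ⟨D', e', η', σ', R'⟩ ?_
        intro z _
        simp only [Equiv.refl_trans]
        congr 1
        ext
        · simp; field_simp; ring
        · simp; field_simp; ring
  choose! Γ hΓ using step
  have base : P 0 (Equiv.refl _) := by
    intro j hj
    rw [A0] at hj
    rw [mem_singleton_iff] at hj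
    subst hj
    rw [L0]
    rw [pow_zero, div_one]
    refine (IsCR_id h).congr ?_
    intro z _
    ext <;> simp
  let F : ∀ n, {f : Pl ≃ Pl // P n f} := fun n => Nat.rec ⟨Equiv.refl _, base⟩
    (fun n x => ⟨(Γ n x.1).trans x.1, (hΓ n x.1 x.2).2⟩) n
  have Fs : ∀ n, (F (n+1)).1 = (Γ n (F n).1).trans (F n).1 := fun n => rfl
  have hQ : ∀ n, Q n (Γ n (F n).1) := fun n => (hΓ n _ (F n).2).1
  have h34 : h ≤ 3/4 := by nlinarith
  have conv : ∀ n (j:ℤ) (z : Pl), ((1/(K:ℝ)^n) • (((K:ℝ)^n • z - (0, (j:ℝ))) + (0, (j:ℝ)))) = z := by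
    intro n j z
    rw [sub_add_cancel, smul_smul, one_div_mul_cancel (by positivity), one_smul]
  have dd : ∀ n (j:ℤ) (z w : Pl), dist ((K:ℝ)^n • z - (0, (j:ℝ))) ((K:ℝ)^n • w - (0, (j:ℝ))) =
      (K:ℝ)^n * dist z w := by
    intro n j z w
    rw [dist_sub_right, dist_smul₀, Real.norm_of_nonneg (by positivity)]
  refine ⟨fun n => (F n).1, fun n => Γ n (F n).1, ⟨K64, l1, lK, C1, fun z => rfl, fun n z => ?_,
    fun n => (hQ n).1, fun n => (hQ n).2.1, fun n => (hQ n).2.2.1, fun n => (hQ n).2.2.2, ?_, ?_, L0,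
    ?_, ?_, ?_⟩⟩
  · simp only [Fs]; rfl
  · intro n j hj z w hz hw hzw
    obtain ⟨D, e, η, σ, R⟩ := (F n).2 j hj
    have kp : 0 < (K:ℝ)^n := by positivity
    have := R.loc h0 h34 (div_pos (Lpos n) kp) ((K:ℝ)^n • z - (0, (j:ℝ))) ((K:ℝ)^n • w - (0, (j:ℝ)))
      (by simpa using hz) (by simpa using hw) (by
        simp only [Prod.fst_sub, Prod.smul_fst, smul_eq_mul, sub_zero]
        rw [← mul_sub, abs_mul, abs_of_pos kp]
        calc _ ≤ (K:ℝ)^n * (1/(K:ℝ)^n/2) := by gcongr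
          _ = _ := by field_simp)
    simp only [conv, dd] at this
    have e : Λ n / (K:ℝ)^n * ((K:ℝ)^n * dist z w) = Λ n * dist z w := by field_simp
    rw [mul_assoc 12, ← e]
    rw [mul_assoc 12] at this
    exact this
  · intro n j hj z w hz hw
    obtain ⟨D, e, η, σ, R⟩ := (F n).2 j hj
    have kp : 0 < (K:ℝ)^n := by positivity
    have := R.up h0 h34 (div_pos (Lpos n) kp) ((K:ℝ)^n • z - (0, (j:ℝ))) ((K:ℝ)^n • w - (0, (j:ℝ)))
      (by simpa using hz) (by simpa using hw)
    simp only [conv, dd] at this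
    have e : Λ n / (K:ℝ)^n * ((K:ℝ)^n * dist z w) = Λ n * dist z w := by field_simp
    rw [mul_assoc 12 (Λ n), ← e]
    rw [mul_assoc 12] at this
    exact this
  · intro n
    by_cases g : gr n
    · rw [L1 n g]; nlinarith [Lpos n]
    · rw [L2 n g]
  · intro n
    by_cases g : gr n
    · rw [L1 n g]
    · rw [L2 n g]; nlinarith [Lpos n]
  · intro n j' hj'
    have K64' : (64:ℝ) ≤ K := by exact_mod_cast K64
    by_cases g : gr n
    · obtain ⟨j, hj, rfl⟩ := A1 n g j' hj'
      refine ⟨j, hj, ?_⟩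
      simp only [sub_self, Int.cast_zero, abs_zero]; linarith
    · obtain ⟨j, hj, d, hd, rfl⟩ := A2 n g j' hj'
      refine ⟨j, hj, ?_⟩
      rw [add_sub_cancel_left]
      have : |(d:ℝ)| ≤ m2 := by exact_mod_cast hd
      linarith

end BHW

-- ===== Part 13 =====
open Set Metric Filter MeasureTheory
open scoped ENNReal Topology NNReal

namespace BHW

noncomputable def ep (K n : ℕ) : ℝ := 1/(K:ℝ)^n

def Row (K : ℕ) (Act : ℕ → Set ℤ) (n : ℕ) (z : Pl) : Prop :=
  ∃ j ∈ Act n, |(K:ℝ)^n * z.2 - j| ≤ 1/2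

def GoodP (K : ℕ) (Act : ℕ → Set ℤ) (m : ℕ) (p : Pl) : Prop :=
  m = 0 ∨ ∃ n, m = n + 1 ∧ ∃ j ∈ Act n, |(K:ℝ)^n * p.2 - j| ≤ 15/32

def gk (Γ : ℕ → Pl ≃ Pl) (n : ℕ) : ℕ → (Pl ≃ Pl)
  | 0 => Equiv.refl _
  | k+1 => (Γ (n+k)).trans (gk Γ n k)

namespace Tower
variable {K : ℕ} {lam C : ℝ} {Act : ℕ → Set ℤ} {Λ : ℕ → ℝ} {f Γ : ℕ → Pl ≃ Pl}

theorem KR (T : Tower K lam C Act Λ f Γ) : (64:ℝ) ≤ K := by exact_mod_cast T.K64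

theorem Kp (T : Tower K lam C Act Λ f Γ) : (0:ℝ) < K := by linarith [T.KR]

theorem ep_pos (T : Tower K lam C Act Λ f Γ) (n : ℕ) : 0 < ep K n := by
  have := T.Kp
  unfold ep; positivity

theorem ep_succ (T : Tower K lam C Act Λ f Γ) (n : ℕ) : ep K n = K * ep K (n+1) := by
  have := T.Kp
  unfold ep; rw [pow_succ]; field_simp

theorem ep_add (n k : ℕ) : ep K (n + k) = ep K n * ep K k := by
  unfold ep; rw [pow_add, one_div_mul_one_div]

theorem Kep (T : Tower K lam C Act Λ f Γ) (n : ℕ) : (K:ℝ)^n * ep K n = 1 := by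
  have := T.Kp
  unfold ep; field_simp

theorem ep_anti (T : Tower K lam C Act Λ f Γ) (n : ℕ) : ep K (n+1) ≤ ep K n := by
  have := T.ep_succ n
  nlinarith [T.KR, T.ep_pos (n+1)]

theorem Lpos (T : Tower K lam C Act Λ f Γ) (n : ℕ) : 0 < Λ n := by
  induction n with
  | zero => rw [T.L0]; norm_num
  | succ n ih => exact ih.trans_le (T.L1 n)

theorem Lmono (T : Tower K lam C Act Λ f Γ) : Monotone Λ := monotone_nat_of_le_succ T.L1

theorem Lep (T : Tower K lam C Act Λ f Γ) (n : ℕ) : Λ (n+1) * ep K (n+1) ≤ Λ n * ep K n / 4 := by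
  have h1 := T.L2 n
  have h2 := T.ep_pos (n+1)
  have h3 := T.Lpos n
  calc Λ (n+1) * ep K (n+1) ≤ (lam * Λ n) * ep K (n+1) := by gcongr
    _ = lam * (Λ n * ep K (n+1)) := by ring
    _ ≤ (K/4) * (Λ n * ep K (n+1)) := by
      have := T.lK
      gcongr; linarith
    _ = _ := by rw [T.ep_succ n]; ring

theorem Lep' (T : Tower K lam C Act Λ f Γ) (n k : ℕ) :
    Λ (n+k) * ep K (n+k) ≤ Λ n * ep K n * (1/4)^k := by
  induction k with
  | zero => simp
  | succ k ih =>
    have := T.Lep (n+k)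
    rw [← add_assoc, pow_succ]; linarith

theorem row_nest (T : Tower K lam C Act Λ f Γ) {n : ℕ} {z : Pl} (h : Row K Act (n+1) z) :
    ∃ j ∈ Act n, |(K:ℝ)^n * z.2 - j| ≤ 7/16 := by
  obtain ⟨j', hj', h1⟩ := h
  obtain ⟨j, hj, h2⟩ := T.nest n j' hj'
  refine ⟨j, hj, ?_⟩
  have hK := T.Kp
  have : |K * ((K:ℝ)^n * z.2 - j)| ≤ 7/16 * K := by
    have e : K * ((K:ℝ)^n * z.2 - j) = ((K:ℝ)^(n+1) * z.2 - j') + ((j' - K * j : ℤ):ℝ) := by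
      push_cast; ring
    rw [e]; refine (abs_add_le _ _).trans ?_; linarith
  rw [abs_mul, abs_of_pos hK] at this
  nlinarith

theorem row_step (T : Tower K lam C Act Λ f Γ) {n : ℕ} {z : Pl} (h : Row K Act (n+1) z) :
    Row K Act n z := by
  obtain ⟨j, hj, h1⟩ := T.row_nest h
  exact ⟨j, hj, by linarith⟩

theorem row_mono (T : Tower K lam C Act Λ f Γ) {m n : ℕ} (hmn : m ≤ n) {z : Pl} (h : Row K Act n z) :
    Row K Act m z := by
  induction n, hmn using Nat.le_induction with
  | base => exact h
  | succ n _ ih => exact ih (T.row_step h)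

theorem off' (T : Tower K lam C Act Λ f Γ) {n : ℕ} {z : Pl} (h : ¬ Row K Act n z) : Γ n z = z := by
  have h1 := abs_sub_round ((K:ℝ)^n * z.2)
  by_cases hj : round ((K:ℝ)^n * z.2) ∈ Act n
  · exact (h ⟨_, hj, h1⟩).elim
  · exact T.off n _ hj z h1

theorem fdiff (T : Tower K lam C Act Λ f Γ) (n : ℕ) (z : Pl) :
    dist (f n z) (f (n+1) z) ≤ 12 * (Λ n * ep K n) := by
  have h1 := T.Lpos n
  have h2 := T.ep_pos n
  rw [T.fs, dist_comm]
  by_cases h : Row K Act n z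
  · obtain ⟨j, hj, hz⟩ := h
    have := T.up n j hj (Γ n z) z (T.strip n j z hz) hz
    have d : dist (Γ n z) z ≤ ep K n := T.disp n z
    calc _ ≤ _ := this
      _ ≤ 12 * Λ n * ep K n := by gcongr
      _ = _ := by ring
  · rw [T.off' h, dist_self]; positivity

theorem exists_lim (T : Tower K lam C Act Λ f Γ) :
    ∃ F : Pl → Pl, (∀ z, Tendsto (fun n => f n z) atTop (𝓝 (F z))) ∧
      ∀ n z, dist (f n z) (F z) ≤ 16 * (Λ n * ep K n) := by
  have key : ∀ n z k, dist (f (n+k) z) (f (n+(k+1)) z) ≤ 12 * (Λ n * ep K n) * (1/4)^k := by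
    intro n z k
    have := T.fdiff (n+k) z
    have := T.Lep' n k
    rw [← add_assoc n]; linarith
  have cau : ∀ z, ∃ w, Tendsto (fun n => f n z) atTop (𝓝 w) := by
    intro z
    have := cauchySeq_of_le_geometric (1/4) _ (by norm_num) (fun k => key 0 z k)
    simp only [zero_add] at this
    exact cauchySeq_tendsto_of_complete this
  choose F hF using cau
  refine ⟨F, hF, fun n z => ?_⟩
  have t : Tendsto (fun k => f (n+k) z) atTop (𝓝 (F z)) := by
    have := (tendsto_add_atTop_iff_nat n).2 (hF z)
    simpa [add_comm] using this
  have := dist_le_of_le_geometric_of_tendsto₀ (1/4) _ (by norm_num) (fun k => key n z k) t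
  simp only [add_zero] at this
  refine this.trans (le_of_eq ?_)
  ring

theorem f_gk (T : Tower K lam C Act Λ f Γ) (n k : ℕ) (z : Pl) : f (n+k) z = f n (gk Γ n k z) := by
  induction k generalizing z with
  | zero => rfl
  | succ k ih => rw [← add_assoc, T.fs, ih]; rfl

theorem gk_disp (T : Tower K lam C Act Λ f Γ) (n k : ℕ) (z : Pl) :
    dist (gk Γ n k z) z ≤ 2 * (ep K n - ep K (n+k)) := by
  induction k generalizing z with
  | zero => simp [gk]
  | succ k ih =>
    have h1 := ih (Γ (n+k) z)
    have h2 : dist (Γ (n+k) z) z ≤ ep K (n+k) := T.disp _ z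
    have h3 := T.ep_succ (n+k)
    have h4 : dist (gk Γ n (k+1) z) z ≤ _ := dist_triangle _ (Γ (n+k) z) _
    change _ ≤ dist (gk Γ n k (Γ (n+k) z)) (Γ (n+k) z) + _ at h4
    have h5 := T.ep_pos (n+k+1)
    rw [← add_assoc]
    nlinarith [T.KR]

theorem gk_BL (T : Tower K lam C Act Λ f Γ) (n k : ℕ) : BL (C^k) (gk Γ n k) := by
  have := T.C1
  induction k with
  | zero =>
    constructor
    · intro z w; simp [gk]
    · intro z w; simp [gk]
  | succ k ih =>
    have := BL.trans (by linarith) (by positivity) (T.bl (n+k)) ih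
    rw [pow_succ']; exact this

theorem good_of (T : Tower K lam C Act Λ f Γ) {m : ℕ} {p p' : Pl} (h : m = 0 ∨ Row K Act m p)
    (hd : dist p' p ≤ 2 * ep K m) : GoodP K Act m p' := by
  rcases m with _ | n
  · left; rfl
  · right
    rcases h with h | h
    · omega
    obtain ⟨j, hj, h1⟩ := T.row_nest h
    refine ⟨n, rfl, j, hj, ?_⟩
    have h2 : |p'.2 - p.2| ≤ dist p' p := by
      rw [← Real.dist_eq]; exact le_max_right _ _
    have hk : (0:ℝ) < (K:ℝ)^n := by have := T.Kp; positivity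
    have h3 : |(K:ℝ)^n * (p'.2 - p.2)| ≤ 1/32 := by
      rw [abs_mul, abs_of_pos hk]
      have e := T.Kep n
      have e1 := T.ep_succ n
      have : ep K (n+1) ≤ ep K n / 64 := by nlinarith [T.KR, T.ep_pos (n+1)]
      calc _ ≤ (K:ℝ)^n * (ep K n / 32) := by gcongr; linarith
        _ = ((K:ℝ)^n * ep K n) / 32 := by ring
        _ = _ := by rw [e]
    have e : (K:ℝ)^n * p'.2 - j = ((K:ℝ)^n * p.2 - j) + (K:ℝ)^n * (p'.2 - p.2) := by ring
    rw [e]; refine (abs_add_le _ _).trans ?_; linarith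

theorem E2 (T : Tower K lam C Act Λ f Γ) {m : ℕ} {p q : Pl} (h : GoodP K Act m p)
    (hd : dist p q ≤ 1/(32*C) * ep K m) :
    dist (f m p) (f m q) ≤ 12 * C * lam * (Λ m * dist p q) ∧
      Λ m * dist p q ≤ 12 * C * lam * dist (f m p) (f m q) := by
  have C1 := T.C1
  have l1 := T.l1
  have A1 : 1 ≤ 12 * C * lam := by nlinarith
  rcases h with rfl | ⟨n, rfl, j, hj, h1⟩
  · rw [T.f0, T.f0, T.L0]
    have := dist_nonneg (x := p) (y := q)
    constructor <;> nlinarith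
  · have hk : (0:ℝ) < (K:ℝ)^n := by have := T.Kp; positivity
    have e := T.Kep n
    have en := T.ep_anti n
    have e0 := T.ep_pos (n+1)
    have hC : C * dist p q ≤ ep K n / 32 := by
      calc _ ≤ C * (1/(32*C) * ep K (n+1)) := by gcongr
        _ = ep K (n+1) / 32 := by field_simp
        _ ≤ _ := by linarith
    have d0 := dist_nonneg (x := p) (y := q)
    have hd2 : dist p q ≤ ep K n / 32 := by nlinarith
    have h2 : |q.2 - p.2| ≤ dist p q := by
      rw [← Real.dist_eq, dist_comm]; exact le_max_right _ _
    have h3 : |(K:ℝ)^n * (q.2 - p.2)| ≤ 1/32 := by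
      rw [abs_mul, abs_of_pos hk]
      calc _ ≤ (K:ℝ)^n * (ep K n / 32) := by gcongr; linarith
        _ = ((K:ℝ)^n * ep K n) / 32 := by ring
        _ = _ := by rw [e]
    have hq : |(K:ℝ)^n * q.2 - j| ≤ 1/2 := by
      have e : (K:ℝ)^n * q.2 - j = ((K:ℝ)^n * p.2 - j) + (K:ℝ)^n * (q.2 - p.2) := by ring
      rw [e]; refine (abs_add_le _ _).trans ?_; linarith
    have dG := (T.bl n).1 p q
    have dG' := (T.bl n).low p q
    have := T.loc n j hj (Γ n p) (Γ n q) (T.strip n j p (by linarith)) (T.strip n j q hq) (by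
      have : |(Γ n p).1 - (Γ n q).1| ≤ dist (Γ n p) (Γ n q) := by
        rw [← Real.dist_eq]; exact le_max_left _ _
      change _ ≤ ep K n / 2
      linarith [T.ep_pos n])
    rw [← T.fs, ← T.fs] at this
    have L1 := T.L1 n
    have L2 := T.L2 n
    have Lp := T.Lpos n
    have D0 := dist_nonneg (x := Γ n p) (y := Γ n q)
    constructor
    · calc _ ≤ _ := this.1
        _ ≤ 12 * Λ (n+1) * (C * dist p q) := by
          have := T.Lpos (n+1)
          gcongr
        _ = 12 * C * 1 * (Λ (n+1) * dist p q) := by ring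
        _ ≤ _ := by
          have := T.Lpos (n+1)
          gcongr
    · calc Λ (n+1) * dist p q ≤ (lam * Λ n) * (C * dist (Γ n p) (Γ n q)) := by gcongr
        _ = lam * C * (Λ n * dist (Γ n p) (Γ n q)) := by ring
        _ ≤ lam * C * (12 * dist (f (n+1) p) (f (n+1) q)) :=
          mul_le_mul_of_nonneg_left this.2 (by positivity)
        _ = _ := by ring

theorem f_cont (T : Tower K lam C Act Λ f Γ) (n : ℕ) : Continuous (f n) ∧ Continuous (f n).symm := by
  have h := T.gk_BL 0 n
  have e : f n = gk Γ 0 n := by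
    ext1 z
    have := T.f_gk 0 n z
    rw [zero_add, T.f0] at this; exact this
  rw [e]
  exact ⟨h.1.continuous, h.2.continuous⟩

theorem E2low (T : Tower K lam C Act Λ f Γ) {m : ℕ} {p : Pl} (h : GoodP K Act m p) (q : Pl) :
    Λ m * min (dist p q) (1/(32*C) * ep K m) ≤ 12 * C * lam * dist (f m p) (f m q) := by
  have C1 := T.C1
  have l1 := T.l1
  rcases le_or_gt (dist p q) (1/(32*C) * ep K m) with hd | hd
  · rw [min_eq_left hd]; exact (T.E2 h hd).2
  · rw [min_eq_right hd.le]
    let γ : ℝ → Pl := fun t => (f m).symm (AffineMap.lineMap (f m p) (f m q) t)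
    have hγ : Continuous γ := (T.f_cont m).2.comp AffineMap.lineMap_continuous
    have g0 : γ 0 = p := by simp [γ]
    have g1 : γ 1 = q := by simp [γ]
    have e0 := T.ep_pos m
    have ivt := intermediate_value_Icc (zero_le_one' ℝ)
      (f := fun t => dist p (γ t)) (by fun_prop)
    have hm : 1/(32*C) * ep K m ∈ Icc (dist p (γ 0)) (dist p (γ 1)) := by
      rw [g0, g1, dist_self]; exact ⟨by positivity, hd.le⟩
    obtain ⟨t, ht, he⟩ := ivt hm
    simp only at he
    have := (T.E2 h he.le).2
    rw [he] at this
    refine this.trans ?_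
    gcongr
    simp only [γ, Equiv.apply_symm_apply]
    rw [dist_left_lineMap, Real.norm_of_nonneg ht.1]
    have := dist_nonneg (x := f m p) (y := f m q)
    nlinarith [ht.2]

end Tower
end BHW

-- ===== Part 14 =====
open Set Metric Filter MeasureTheory
open scoped ENNReal Topology NNReal

namespace BHW
namespace Tower
variable {K : ℕ} {lam C : ℝ} {Act : ℕ → Set ℤ} {Λ : ℕ → ℝ} {f Γ : ℕ → Pl ≃ Pl}

theorem low (T : Tower K lam C Act Λ f Γ) {F : Pl → Pl}
    (hF : ∀ z, Tendsto (fun n => f n z) atTop (𝓝 (F z))) {c1 : ℝ} (hc : 0 < c1) :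
    ∃ c, 0 < c ∧ ∀ m p q, (m = 0 ∨ Row K Act m p) → c1 * ep K (m+1) ≤ dist p q →
      c * (Λ m * min (dist p q) (ep K m)) ≤ dist (F p) (F q) := by
  have C1 := T.C1
  have l1 := T.l1
  have hK := T.Kp
  obtain ⟨N, hN⟩ : ∃ N, 8 * ep K N * K ≤ c1 := by
    obtain ⟨N, hN⟩ := exists_pow_lt_of_lt_one (show 0 < c1 / (8 * K) by positivity)
      (show (1/(K:ℝ)) < 1 by rw [div_lt_one hK]; linarith [T.KR])
    refine ⟨N, ?_⟩
    rw [lt_div_iff₀ (by positivity)] at hN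
    unfold ep
    rw [one_div_pow] at hN
    linarith
  set c4 := min (1/(2*C^N)) (1/(32*C)) with hc4
  have c4p : 0 < c4 := lt_min (by positivity) (by positivity)
  refine ⟨c4 / (12 * C * lam), by positivity, ?_⟩
  intro m p q hm hr
  have em := T.ep_pos m
  have key : ∀ k, c4 / (12 * C * lam) * (Λ m * min (dist p q) (ep K m)) ≤
      dist (f (m + N + k) p) (f (m + N + k) q) := by
    intro k
    rw [T.f_gk (m+N) k, T.f_gk (m+N) k, T.f_gk m N, T.f_gk m N]
    have dp := T.gk_disp (m+N) k p
    have dq := T.gk_disp (m+N) k q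
    set p' := gk Γ (m+N) k p
    set q' := gk Γ (m+N) k q
    have dp' := T.gk_disp m N p'
    have low := (T.gk_BL m N).low p' q'
    set p'' := gk Γ m N p'
    set q'' := gk Γ m N q'
    have g : GoodP K Act m p'' := T.good_of hm (by
      have := dist_triangle p'' p' p
      have := T.ep_pos (m+N+k)
      linarith)
    have h1 := T.E2low g q''
    have eN : 8 * ep K (m+N) ≤ dist p q := by
      refine le_trans ?_ hr
      rw [ep_add, ← mul_le_mul_iff_right₀ hK]
      have : K * (c1 * ep K (m+1)) = c1 * ep K m := by rw [T.ep_succ m]; ring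
      rw [this]
      calc K * (8 * (ep K m * ep K N)) = (8 * ep K N * K) * ep K m := by ring
        _ ≤ _ := by gcongr
    have hpq : dist p q / 2 ≤ dist p' q' := by
      have t1 := dist_triangle4 p p' q' q
      rw [dist_comm p p'] at t1
      have := T.ep_pos (m+N+k)
      linarith
    have hmin : c4 * min (dist p q) (ep K m) ≤ min (dist p'' q'') (1/(32*C) * ep K m) := by
      have d0 := dist_nonneg (x := p) (y := q)
      apply le_min
      · calc c4 * min (dist p q) (ep K m) ≤ (1/(2*C^N)) * dist p q := by
              gcongr
              · exact min_le_left _ _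
              · exact min_le_left _ _
          _ = (dist p q / 2) / C^N := by field_simp
          _ ≤ dist p'' q'' := by
            rw [div_le_iff₀ (by positivity)]; linarith
      · gcongr
        · exact min_le_right _ _
        · exact min_le_right _ _
    rw [div_mul_eq_mul_div, div_le_iff₀ (by positivity)]
    have := T.Lpos m
    calc c4 * (Λ m * min (dist p q) (ep K m)) = Λ m * (c4 * min (dist p q) (ep K m)) := by ring
      _ ≤ Λ m * min (dist p'' q'') (1/(32*C) * ep K m) := by gcongr
      _ ≤ _ := h1
      _ = _ := by ring
  have t : ∀ z, Tendsto (fun k => f (m+N+k) z) atTop (𝓝 (F z)) := by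
    intro z
    have := (tendsto_add_atTop_iff_nat (m+N)).2 (hF z)
    simpa [add_comm] using this
  exact ge_of_tendsto' ((t p).dist (t q)) key

theorem F_eq (T : Tower K lam C Act Λ f Γ) {F : Pl → Pl}
    (hF : ∀ z, Tendsto (fun n => f n z) atTop (𝓝 (F z))) {n : ℕ} {z : Pl} (h : ¬ Row K Act n z) :
    F z = f n z := by
  have : ∀ k, n ≤ k → f k z = f n z := by
    intro k hk
    induction k, hk using Nat.le_induction with
    | base => rfl
    | succ k hk ih => rw [T.fs, T.off' (fun h' => h (T.row_mono hk h')), ih]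
  refine tendsto_nhds_unique (hF z) ?_
  apply tendsto_const_nhds.congr'
  filter_upwards [eventually_ge_atTop n] with k hk
  exact (this k hk).symm

theorem caseA (T : Tower K lam C Act Λ f Γ) {F : Pl → Pl}
    (hF : ∀ z, Tendsto (fun n => f n z) atTop (𝓝 (F z))) {m : ℕ} {p q : Pl}
    (hm : m = 0 ∨ Row K Act m p) (hp : ¬ Row K Act (m+1) p)
    (hr : dist p q ≤ 1/(32*C^3) * ep K (m+1)) :
    dist (F p) (F q) ≤ 12 * C * lam * C^2 * (Λ m * dist p q) ∧
      Λ m * dist p q ≤ 12 * C * lam * C^2 * dist (F p) (F q) := by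
  have C1 := T.C1
  have l1 := T.l1
  have hK := T.Kp
  have C3 : 1 ≤ C^3 := one_le_pow₀ C1
  have e1 := T.ep_pos (m+1)
  have hr2 : dist p q ≤ ep K (m+1) / 16 := by
    refine hr.trans ?_
    rw [one_div_mul_eq_div]
    gcongr
    linarith
  have hp2 : ¬ Row K Act (m+2) p := fun h => hp (T.row_step h)
  have hq2 : ¬ Row K Act (m+2) q := by
    intro h
    obtain ⟨j, hj, hj2⟩ := T.row_nest h
    apply hp
    refine ⟨j, hj, ?_⟩
    have h2 : |p.2 - q.2| ≤ dist p q := by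
      rw [← Real.dist_eq]; exact le_max_right _ _
    have hk : (0:ℝ) < (K:ℝ)^(m+1) := by positivity
    have h3 : |(K:ℝ)^(m+1) * (p.2 - q.2)| ≤ 1/16 := by
      rw [abs_mul, abs_of_pos hk]
      have e := T.Kep (m+1)
      calc _ ≤ (K:ℝ)^(m+1) * (ep K (m+1) / 16) := by gcongr; linarith
        _ = ((K:ℝ)^(m+1) * ep K (m+1)) / 16 := by ring
        _ = _ := by rw [e]
    have e : (K:ℝ)^(m+1) * p.2 - j = ((K:ℝ)^(m+1) * q.2 - j) + (K:ℝ)^(m+1) * (p.2 - q.2) := by ring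
    rw [e]; refine (abs_add_le _ _).trans ?_; linarith
  rw [T.F_eq hF hp2, T.F_eq hF hq2, T.f_gk m 2, T.f_gk m 2]
  have dp := T.gk_disp m 2 p
  have g : GoodP K Act m (gk Γ m 2 p) := T.good_of hm (by
      have := T.ep_pos (m+2)
      linarith)
  have b1 := (T.gk_BL m 2).1 p q
  have b2 := (T.gk_BL m 2).low p q
  have em := T.ep_anti m
  have := T.E2 g (q := gk Γ m 2 q) (by
    calc _ ≤ _ := b1
      _ ≤ C^2 * (1/(32*C^3) * ep K (m+1)) := by gcongr
      _ = 1/(32*C) * ep K (m+1) := by field_simp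
      _ ≤ _ := by gcongr)
  have Lp := T.Lpos m
  constructor
  · calc _ ≤ _ := this.1
      _ ≤ 12 * C * lam * (Λ m * (C^2 * dist p q)) := by gcongr
      _ = _ := by ring
  · calc _ ≤ Λ m * (C^2 * dist (gk Γ m 2 p) (gk Γ m 2 q)) := by gcongr
      _ = C^2 * (Λ m * dist (gk Γ m 2 p) (gk Γ m 2 q)) := by ring
      _ ≤ C^2 * (12 * C * lam * dist (f m (gk Γ m 2 p)) (f m (gk Γ m 2 q))) :=
        mul_le_mul_of_nonneg_left this.2 (by positivity)
      _ = _ := by ring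

theorem E3 (T : Tower K lam C Act Λ f Γ) {F : Pl → Pl}
    (hF : ∀ z, Tendsto (fun n => f n z) atTop (𝓝 (F z)))
    (hF2 : ∀ n z, dist (f n z) (F z) ≤ 16 * (Λ n * ep K n)) :
    ∃ c1 B, 0 < c1 ∧ c1 ≤ 1 ∧ 1 ≤ B ∧ ∀ p q, p ≠ q → ∃ m,
      (m = 0 ∨ (Row K Act m p ∧ dist p q ≤ c1 * ep K m)) ∧
      (¬ Row K Act (m+1) p ∨ c1 * ep K (m+1) < dist p q) ∧
      Λ m * dist p q ≤ B * dist (F p) (F q) ∧ dist (F p) (F q) ≤ B * (Λ m * dist p q) := by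
  have C1 := T.C1
  have l1 := T.l1
  have hK := T.Kp
  have C3 : 1 ≤ C^3 := one_le_pow₀ C1
  set c1 := 1/(32*C^3) with hc1
  have c1p : 0 < c1 := by positivity
  have c11 : c1 ≤ 1 := by rw [hc1, div_le_one (by positivity)]; linarith
  have c12 : c1 ≤ 1/(32*C) := by
    rw [hc1]; apply one_div_le_one_div_of_le (by positivity)
    have : C ≤ C^3 := le_self_pow₀ C1 (by norm_num)
    linarith
  obtain ⟨c, cp, low⟩ := T.low hF c1p
  have B0 : 0 < 12 * C * lam * C^2 := by positivity
  have B0' : 0 < 12 * C * lam := by positivity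
  set B := 1 + 12 * C * lam * C^2 + 64 / c + 12 * C * lam + 32 * K / c1 + 2 with hB
  have t1 : 0 < 64 / c := by positivity
  have t2 : 0 < 32 * K / c1 := by positivity
  refine ⟨c1, B, c1p, c11, by linarith, ?_⟩
  intro p q hpq
  have r0 : 0 < dist p q := dist_pos.2 hpq
  have hex : ∃ m, ¬ (Row K Act (m+1) p ∧ dist p q ≤ c1 * ep K (m+1)) := by
    obtain ⟨N, hN⟩ := exists_pow_lt_of_lt_one (show 0 < dist p q by positivity)
      (show (1/(K:ℝ)) < 1 by rw [div_lt_one hK]; linarith [T.KR])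
    refine ⟨N, fun h => ?_⟩
    have h1 := h.2
    rw [one_div_pow] at hN
    change ep K N < _ at hN
    have := T.ep_anti N
    have := T.ep_pos (N+1)
    nlinarith
  classical
  obtain ⟨m, hm0, hm1⟩ : ∃ m, (m = 0 ∨ (Row K Act m p ∧ dist p q ≤ c1 * ep K m)) ∧
      ¬ (Row K Act (m+1) p ∧ dist p q ≤ c1 * ep K (m+1)) := by
    refine ⟨Nat.find hex, ?_, Nat.find_spec hex⟩
    rcases h : Nat.find hex with _ | n
    · left; rfl
    · right
      have := Nat.find_min hex (m := n) (by omega)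
      simpa using this
  have hm1' : ¬ Row K Act (m+1) p ∨ c1 * ep K (m+1) < dist p q := by
    by_cases h : Row K Act (m+1) p
    · right; by_contra h'; exact hm1 ⟨h, not_lt.1 h'⟩
    · left; exact h
  refine ⟨m, hm0, hm1', ?_⟩
  have hm : m = 0 ∨ Row K Act m p := hm0.imp id And.left
  have Lp := T.Lpos m
  have D0 := dist_nonneg (x := F p) (y := F q)
  have em := T.ep_pos m
  rcases le_or_gt (dist p q) (c1 * ep K (m+1)) with hr | hr
  · have hp : ¬ Row K Act (m+1) p := fun h => hm1 ⟨h, hr⟩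
    obtain ⟨a, b⟩ := T.caseA hF hm hp hr
    constructor
    · refine b.trans ?_; gcongr; linarith
    · refine a.trans ?_; gcongr; linarith
  · have lo := low m p q hm hr.le
    have up : 32 * (Λ m * ep K m) ≤ 32 * K / c1 * (Λ m * dist p q) := by
      rw [T.ep_succ m]
      calc 32 * (Λ m * (K * ep K (m+1))) = 32 * K / c1 * (Λ m * (c1 * ep K (m+1))) := by field_simp
        _ ≤ _ := by gcongr
    have tri : dist (F p) (F q) ≤ dist (f m p) (f m q) + 32 * (Λ m * ep K m) := by
      have h1 := hF2 m p
      have h2 := hF2 m q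
      have := dist_triangle4 (F p) (f m p) (f m q) (F q)
      rw [dist_comm (F p) (f m p)] at this
      linarith
    have tri2 : dist (f m p) (f m q) ≤ dist (F p) (F q) + 32 * (Λ m * ep K m) := by
      have h1 := hF2 m p
      have h2 := hF2 m q
      have := dist_triangle4 (f m p) (F p) (F q) (f m q)
      rw [dist_comm (F q) (f m q)] at this
      linarith
    have LR : 0 < Λ m * dist p q := by positivity
    have w : Λ m * dist p q = (1/c) * (c * (Λ m * dist p q)) := by field_simp
    rcases le_or_gt (dist p q) (c1 * ep K m) with hr2 | hr2
    · have e2 := (T.E2 (T.good_of hm (by rw [dist_self]; positivity) : GoodP K Act m p)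
        (hr2.trans (by gcongr))).1
      have : dist p q ≤ ep K m := hr2.trans (by nlinarith)
      rw [min_eq_left this] at lo
      constructor
      · calc Λ m * dist p q = (1/c) * (c * (Λ m * dist p q)) := w
          _ ≤ (64/c) * dist (F p) (F q) := by
            gcongr; norm_num
          _ ≤ _ := by gcongr; linarith
      · have : (12 * C * lam + 32 * K / c1) * (Λ m * dist p q) ≤ B * (Λ m * dist p q) := by
          gcongr; linarith
        linarith
    · have m0 : m = 0 := by
        rcases hm0 with h | h
        · exact h
        · exact (not_lt.2 h.2 hr2).elim
      subst m0
      have e0 : ep K 0 = 1 := by simp [ep]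
      rw [T.f0, T.f0] at tri tri2
      rw [T.L0, e0] at lo up tri tri2
      rw [T.L0]
      simp only [one_mul, mul_one] at lo up tri tri2 ⊢
      constructor
      · rcases le_or_gt (dist p q) 64 with h | h
        · have : dist p q / 64 ≤ min (dist p q) 1 := le_min (by linarith) (by linarith)
          have : c * (dist p q / 64) ≤ dist (F p) (F q) := le_trans (by gcongr) lo
          calc dist p q = (64/c) * (c * (dist p q / 64)) := by field_simp
            _ ≤ (64/c) * dist (F p) (F q) := by gcongr
            _ ≤ _ := by gcongr; linarith
        · calc dist p q ≤ 2 * dist (F p) (F q) := by linarith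
            _ ≤ _ := by gcongr; linarith
      · have : (1 + 32 * K / c1) * dist p q ≤ B * dist p q := by
          gcongr; linarith
        linarith

theorem main (T : Tower K lam C Act Λ f Γ) :
    ∃ (F : Pl ≃ₜ Pl) (B c1 : ℝ), 1 ≤ B ∧ 0 < c1 ∧
      (∀ p q z, dist p q ≤ 2 * dist p z → dist (F p) (F q) ≤ B * dist (F p) (F z)) ∧
      ∀ p q, (∀ n, Row K Act n p) → p ≠ q → dist p q ≤ c1 → ∃ m, c1 * ep K (m+1) < dist p q ∧
        dist p q ≤ c1 * ep K m ∧ Λ m * dist p q ≤ B * dist (F p) (F q) ∧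
        dist (F p) (F q) ≤ B * (Λ m * dist p q) := by
  obtain ⟨F, hF, hF2⟩ := T.exists_lim
  obtain ⟨c1, B, c1p, c11, B1, e3⟩ := T.E3 hF hF2
  have hK := T.Kp
  have hK64 := T.KR
  have Ltend : Tendsto (fun n => 16 * (Λ n * ep K n)) atTop (𝓝 0) := by
    have h0 : ∀ n, 16 * (Λ n * ep K n) ≤ 16 * (1/4)^n := by
      intro n
      have := T.Lep' 0 n
      rw [zero_add, T.L0] at this
      have e0 : ep K 0 = 1 := by simp [ep]
      rw [e0] at this; linarith
    refine squeeze_zero (fun n => ?_) h0 ?_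
    · have := T.Lpos n; have := T.ep_pos n; positivity
    · have := (tendsto_pow_atTop_nhds_zero_of_lt_one (r := (1/4:ℝ)) (by norm_num) (by norm_num)).const_mul 16
      simpa using this
  have cont : Continuous F := by
    have : TendstoUniformly (fun n z => f n z) F atTop := by
      rw [Metric.tendstoUniformly_iff]
      intro ε hε
      filter_upwards [(Ltend.eventually_lt_const hε)] with n hn z
      rw [dist_comm]; exact (hF2 n z).trans_lt hn
    exact this.continuous (Eventually.frequently (Eventually.of_forall fun n => (T.f_cont n).1))
  have inj : Function.Injective F := by
    intro p q h
    by_contra hpq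
    obtain ⟨m, _, _, h1, _⟩ := e3 p q hpq
    rw [h, dist_self] at h1
    have := T.Lpos m
    have := dist_pos.2 hpq
    have : 0 < Λ m * dist p q := by positivity
    linarith
  have e0 : ep K 0 = 1 := by simp [ep]
  have d16 : ∀ z, dist z (F z) ≤ 16 := by
    intro z
    have := hF2 0 z
    rw [T.f0, T.L0, e0] at this; linarith
  have surj : Function.Surjective F := by
    intro w
    let u : ℕ → Pl := fun n => (f n).symm w
    have hu : ∀ n, dist (F (u n)) w ≤ 16 * (Λ n * ep K n) := by
      intro n
      have := hF2 n (u n)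
      simp only [u, Equiv.apply_symm_apply] at this
      rw [dist_comm]; exact this
    have hb : ∀ n, u n ∈ closedBall w 32 := by
      intro n
      rw [mem_closedBall]
      have h1 := hu n
      have h2 := T.Lep' 0 n
      rw [zero_add, T.L0, e0] at h2
      have h3 : ((1:ℝ)/4)^n ≤ 1 := pow_le_one₀ (by norm_num) (by norm_num)
      have := dist_triangle (u n) (F (u n)) w
      have := d16 (u n)
      linarith
    obtain ⟨a, _, φ, hφ, hlim⟩ := (isCompact_closedBall w 32).tendsto_subseq hb
    refine ⟨a, ?_⟩
    have h1 : Tendsto (fun n => F (u (φ n))) atTop (𝓝 (F a)) := (cont.tendsto a).comp hlim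
    have h2 : Tendsto (fun n => F (u (φ n))) atTop (𝓝 w) := by
      rw [tendsto_iff_dist_tendsto_zero]
      exact squeeze_zero (fun _ => dist_nonneg) (fun n => hu (φ n)) (Ltend.comp hφ.tendsto_atTop)
    exact tendsto_nhds_unique h1 h2
  have closed : IsClosedMap F := by
    refine IsProperMap.isClosedMap ?_
    rw [isProperMap_iff_tendsto_cocompact]
    refine ⟨cont, ?_⟩
    rw [← Metric.cobounded_eq_cocompact]
    rw [← Metric.tendsto_dist_right_atTop_iff (0:Pl)] at *
    have h := tendsto_dist_right_cobounded_atTop (0:Pl)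
    refine tendsto_atTop_mono (f := fun z => dist z 0 - 16) (fun z => ?_) (tendsto_atTop_add_const_right _ _ h)
    have := dist_triangle z (F z) 0
    have := d16 z
    linarith
  let G : Pl ≃ₜ Pl := (Equiv.ofBijective F ⟨inj, surj⟩).toHomeomorphOfContinuousClosed cont closed
  have hG : ∀ z, G z = F z := fun z => rfl
  refine ⟨G, B * B * K, c1, by nlinarith [mul_le_mul B1 B1 zero_le_one (by linarith)], c1p, ?_, ?_⟩
  · intro p q z h
    rw [hG, hG, hG]
    rcases eq_or_ne p q with rfl | hpq
    · rw [dist_self]; positivity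
    have r0 : 0 < dist p q := dist_pos.2 hpq
    have hpz : p ≠ z := dist_pos.1 (by linarith)
    obtain ⟨m, a1, a2, a3, a4⟩ := e3 p q hpq
    obtain ⟨m', b1, b2, b3, b4⟩ := e3 p z hpz
    have Lp := T.Lpos m'
    have key : Λ m * dist p q ≤ K * (Λ m' * dist p z) := by
      rcases le_or_gt m m' with hm | hm
      · calc Λ m * dist p q ≤ Λ m' * (2 * dist p z) := by
              have := T.Lmono hm
              gcongr
          _ ≤ _ := by
            have : 0 ≤ Λ m' * dist p z := by positivity
            nlinarith
      · rcases a1 with a1 | ⟨a1, a1'⟩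
        · omega
        rcases b2 with b2 | b2
        · exact (b2 (T.row_mono hm a1)).elim
        obtain ⟨k, rfl⟩ : ∃ k, m = m' + k := ⟨m - m', by omega⟩
        have h1 := T.Lep' m' k
        have h3 : ((1:ℝ)/4)^k ≤ 1 := pow_le_one₀ (by norm_num) (by norm_num)
        have h4 := T.ep_pos m'
        have h5 : Λ m' * ep K m' * (1/4)^k ≤ Λ m' * ep K m' * 1 := by gcongr
        have h6 := T.Lpos (m'+k)
        calc Λ (m'+k) * dist p q ≤ Λ (m'+k) * (c1 * ep K (m'+k)) := by gcongr
          _ = c1 * (Λ (m'+k) * ep K (m'+k)) := by ring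
          _ ≤ c1 * (Λ m' * ep K m') := mul_le_mul_of_nonneg_left (by linarith) c1p.le
          _ = K * (Λ m' * (c1 * ep K (m'+1))) := by rw [T.ep_succ m']; ring
          _ ≤ _ := by gcongr
    calc dist (F p) (F q) ≤ B * (Λ m * dist p q) := a4
      _ ≤ B * (K * (Λ m' * dist p z)) := by gcongr
      _ ≤ B * (K * (B * dist (F p) (F z))) := by gcongr
      _ = _ := by ring
  · intro p q hp hpq hr
    obtain ⟨m, a1, a2, a3, a4⟩ := e3 p q hpq
    have BB : B ≤ B * B * K := by nlinarith [mul_le_mul B1 B1 zero_le_one (by linarith)]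
    have Lp := T.Lpos m
    refine ⟨m, ?_, ?_, ?_, ?_⟩
    · rcases a2 with a2 | a2
      · exact (a2 (hp _)).elim
      · exact a2
    · rcases a1 with rfl | a1
      · rw [e0, mul_one]; exact hr
      · exact a1.2
    · rw [hG, hG]; exact a3.trans (by gcongr)
    · rw [hG, hG]; exact a4.trans (by gcongr)

end Tower
end BHW

-- ===== Part 15 =====
open Set Metric Filter MeasureTheory
open scoped ENNReal Topology NNReal

namespace BHW

noncomputable def Nn (θ : ℝ) (n : ℕ) : ℕ := ⌊θ * n⌋₊

def grw (θ : ℝ) (n : ℕ) : Prop := Nn θ (n+1) = Nn θ n + 1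

theorem Nn_step {θ : ℝ} (h0 : 0 ≤ θ) (h1 : θ < 1) (n : ℕ) (hn : ¬ grw θ n) : Nn θ (n+1) = Nn θ n := by
  have a : Nn θ n ≤ Nn θ (n+1) := by
    apply Nat.floor_mono; push_cast; nlinarith
  have b : Nn θ (n+1) ≤ Nn θ n + 1 := by
    unfold Nn
    rw [← Nat.floor_add_one (by positivity)]
    apply Nat.floor_mono; push_cast; nlinarith
  unfold grw at hn
  omega

theorem Nn_le {θ : ℝ} (h0 : 0 ≤ θ) (n : ℕ) : (Nn θ n : ℝ) ≤ θ * n :=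
  Nat.floor_le (by positivity)

theorem Nn_lt (θ : ℝ) (n : ℕ) : θ * n < Nn θ n + 1 := Nat.lt_floor_add_one _

theorem Nn_le' {θ : ℝ} (h0 : 0 ≤ θ) (h1 : θ < 1) (n : ℕ) : Nn θ n ≤ n := by
  have := Nn_le h0 n
  have : (Nn θ n : ℝ) ≤ n := by nlinarith [(Nat.cast_nonneg n : (0:ℝ) ≤ n)]
  exact_mod_cast this

noncomputable def bn (θ : ℝ) (n : ℕ) : ℕ := n - Nn θ n

theorem bn_ge {θ : ℝ} (h0 : 0 ≤ θ) (h1 : θ < 1) (n : ℕ) : (1 - θ) * n ≤ bn θ n := by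
  have := Nn_le h0 n
  unfold bn
  rw [Nat.cast_sub (Nn_le' h0 h1 n)]
  linarith

/-- value of a digit sequence -/
noncomputable def yv (K : ℕ) (d : ℕ → ℤ) : ℝ := ∑' i, (d i : ℝ) * ep K (i+1)

def av (K : ℕ) (d : ℕ → ℤ) : ℕ → ℤ
  | 0 => 0
  | n+1 => K * av K d n + d n

theorem yv_bd {K : ℕ} (K64 : 64 ≤ K) {d : ℕ → ℤ} (hd : ∀ i, |(d i : ℝ)| ≤ 3/8 * K) (i : ℕ) : |(d i : ℝ) * ep K (i+1)| ≤ 3/8 * (1/(K:ℝ))^i := by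
  have hK : (64:ℝ) ≤ K := by exact_mod_cast K64
  have e : ep K (i+1) = (1/(K:ℝ))^i / K := by unfold ep; rw [pow_succ, div_pow, one_pow]; field_simp
  have p : 0 ≤ ep K (i+1) := by unfold ep; positivity
  rw [abs_mul, abs_of_nonneg p]
  calc _ ≤ 3/8 * (K:ℝ) * ep K (i+1) := by gcongr; exact hd i
    _ = _ := by rw [e]; field_simp

theorem yv_gs {K : ℕ} (K64 : 64 ≤ K) : HasSum (fun i => 3/8 * (1/(K:ℝ))^i) (3/8 * (1 - 1/(K:ℝ))⁻¹) := by
  have hK : (64:ℝ) ≤ K := by exact_mod_cast K64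
  have h1 : 1/(K:ℝ) < 1 := by rw [div_lt_one (by linarith)]; linarith
  exact (hasSum_geometric_of_lt_one (by positivity) h1).mul_left _

theorem yv_summable {K : ℕ} (K64 : 64 ≤ K) {d : ℕ → ℤ} (hd : ∀ i, |(d i : ℝ)| ≤ 3/8 * K) : Summable (fun i => (d i : ℝ) * ep K (i+1)) :=
  Summable.of_norm_bounded (yv_gs K64).summable (fun i => by
    rw [Real.norm_eq_abs]; exact yv_bd K64 hd i)

theorem yv_le {K : ℕ} (K64 : 64 ≤ K) {d : ℕ → ℤ} (hd : ∀ i, |(d i : ℝ)| ≤ 3/8 * K) : |yv K d| ≤ 2/5 := by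
  have hK : (64:ℝ) ≤ K := by exact_mod_cast K64
  have h := tsum_of_norm_bounded (yv_gs K64) (f := fun i => (d i : ℝ) * ep K (i+1)) (fun i => by
    rw [Real.norm_eq_abs]; exact yv_bd K64 hd i)
  rw [Real.norm_eq_abs] at h
  refine h.trans ?_
  have h1 : 1/(K:ℝ) ≤ 1/64 := one_div_le_one_div_of_le (by norm_num) hK
  have : (1 - 1/(K:ℝ))⁻¹ ≤ (63/64)⁻¹ := inv_anti₀ (by norm_num) (by linarith)
  nlinarith

theorem yv_shift {K : ℕ} (K64 : 64 ≤ K) {d : ℕ → ℤ} (hd : ∀ i, |(d i : ℝ)| ≤ 3/8 * K) : K * yv K d = d 0 + yv K (fun i => d (i+1)) := by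
  have hK : (64:ℝ) ≤ K := by exact_mod_cast K64
  unfold yv
  rw [(yv_summable K64 hd).tsum_eq_zero_add, mul_add, ← tsum_mul_left]
  congr 1
  · unfold ep; field_simp; ring
  · congr 1; ext i; unfold ep; rw [pow_succ (K:ℝ) (i+1)]; field_simp

theorem yv_pow {K : ℕ} (K64 : 64 ≤ K) {d : ℕ → ℤ} (hd : ∀ i, |(d i : ℝ)| ≤ 3/8 * K) (n : ℕ) : (K:ℝ)^n * yv K d = av K d n + yv K (fun i => d (n+i)) := by
  induction n with
  | zero => simp [av]
  | succ n ih =>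
    have h := yv_shift K64 (d := fun i => d (n+i)) (fun i => hd _)
    rw [pow_succ, mul_right_comm, ih]
    simp only [av]
    push_cast
    have e : (fun i => d (n + (i+1))) = fun i => d (n+1+i) := by ext i; congr 1; ring
    rw [e] at h
    simp only [add_zero] at h
    linarith

theorem yv_sep {K : ℕ} (K64 : 64 ≤ K) {d : ℕ → ℤ} (hd : ∀ i, |(d i : ℝ)| ≤ 3/8 * K)
    {d' : ℕ → ℤ} (hd' : ∀ i, |(d' i : ℝ)| ≤ 3/8 * K) (n : ℕ) (h : ∀ i < n, d i = d' i) (hn : d n ≠ d' n) :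
    1/5 * ep K (n+1) ≤ |yv K d - yv K d'| := by
  have hK : (64:ℝ) ≤ K := by exact_mod_cast K64
  have h1 := yv_pow K64 hd (n+1)
  have h2 := yv_pow K64 hd' (n+1)
  have h3 := yv_le K64 (d := fun i => d (n+1+i)) (fun i => hd _)
  have h4 := yv_le K64 (d := fun i => d' (n+1+i)) (fun i => hd' _)
  have h5 : ∀ k ≤ n, av K d k = av K d' k := by
    intro k
    induction k with
    | zero => intro; rfl
    | succ k ih => intro hk; simp only [av]; rw [ih (by omega), h k (by omega)]
  simp only [av, h5 n le_rfl] at h1 h2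
  push_cast at h1 h2
  have h6 : (1:ℝ) ≤ |(d n:ℝ) - d' n| := by
    have : (1:ℤ) ≤ |d n - d' n| := Int.one_le_abs (sub_ne_zero.2 hn)
    exact_mod_cast this
  have h7 : (K:ℝ)^(n+1) * (yv K d - yv K d') = (d n - d' n) + (yv K (fun i => d (n+1+i)) - yv K (fun i => d' (n+1+i))) := by
    linarith
  have h8 : 1/5 ≤ |(K:ℝ)^(n+1) * (yv K d - yv K d')| := by
    rw [h7]
    have := abs_sub_abs_le_abs_sub ((d n:ℝ) - d' n) (-(yv K (fun i => d (n+1+i)) - yv K (fun i => d' (n+1+i))))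
    rw [sub_neg_eq_add, abs_neg] at this
    have := abs_sub (yv K (fun i => d (n+1+i))) (yv K (fun i => d' (n+1+i)))
    linarith
  rw [abs_mul, abs_of_nonneg (by positivity)] at h8
  unfold ep
  rw [mul_one_div, div_le_iff₀ (by positivity)]
  linarith

end BHW

-- ===== Part 16 =====
open Set Metric Filter MeasureTheory
open scoped ENNReal Topology NNReal

namespace BHW

open Classical in
noncomputable def Dt (θ : ℝ) (m2 : ℕ) (t : ℝ) (n : ℕ) : ℤ :=
  if grw θ n then 0 else ((Real.digits t (2*m2+1) (bn θ n) : ℕ) : ℤ) - m2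

theorem Dt_le (θ : ℝ) (m2 : ℕ) (t : ℝ) (n : ℕ) : |Dt θ m2 t n| ≤ m2 := by
  unfold Dt
  split_ifs
  · simp
  · have := (Real.digits t (2*m2+1) (bn θ n)).2
    rw [abs_le]; omega

theorem Dt_gr {θ : ℝ} (m2 : ℕ) (t : ℝ) {n : ℕ} (h : grw θ n) : Dt θ m2 t n = 0 := by
  simp [Dt, h]

theorem Dt_agree {θ : ℝ} (h0 : 0 ≤ θ) (h1 : θ < 1) (m2 : ℕ) (t t' : ℝ) (n : ℕ)
    (h : ∀ i < n, Dt θ m2 t i = Dt θ m2 t' i) :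
    ∀ k < bn θ n, Real.digits t (2*m2+1) k = Real.digits t' (2*m2+1) k := by
  induction n with
  | zero => intro k hk; simp [bn] at hk
  | succ n ih =>
    intro k hk
    have ih' := ih (fun i hi => h i (by omega))
    have hN := Nn_le' h0 h1 n
    by_cases hg : grw θ n
    · apply ih'
      unfold grw at hg
      unfold bn at hk ⊢
      omega
    · have h2 := Nn_step h0 h1 n hg
      rcases Nat.lt_or_ge k (bn θ n) with h3 | h3
      · exact ih' k h3
      · have : k = bn θ n := by unfold bn at *; omega
        subst this
        have h4 := h n (by omega)
        simp only [Dt, hg, if_false] at h4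
        apply Fin.ext
        omega

theorem Dt_main {θ : ℝ} (h0 : 0 ≤ θ) (h1 : θ < 1) {m2 K : ℕ} (m1 : 1 ≤ m2) (K64 : 64 ≤ K)
    (hm : (m2:ℝ) ≤ 3/8 * K) {t t' : ℝ} (ht : t ∈ Ico (0:ℝ) 1) (ht' : t' ∈ Ico (0:ℝ) 1)
    (hne : t ≠ t') : ∃ n, 1/5 * ep K (n+1) ≤ |yv K (Dt θ m2 t) - yv K (Dt θ m2 t')| ∧
      |t - t'| ≤ (((2*m2+1 : ℕ):ℝ)^(bn θ n))⁻¹ := by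
  have hD : ∀ t i, |(Dt θ m2 t i : ℝ)| ≤ 3/8 * K := by
    intro t i
    have : ((|Dt θ m2 t i| : ℤ):ℝ) ≤ ((m2:ℤ):ℝ) := by exact_mod_cast Dt_le θ m2 t i
    push_cast at this; linarith
  have hb : 1 < 2*m2+1 := by omega
  have tt : ∀ n, (∀ i < n, Dt θ m2 t i = Dt θ m2 t' i) → |t - t'| ≤ (((2*m2+1 : ℕ):ℝ)^(bn θ n))⁻¹ := by
    intro n hn
    have := Real.abs_ofDigits_sub_ofDigits_le (Dt_agree h0 h1 m2 t t' n hn)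
    rwa [Real.ofDigits_digits hb ht, Real.ofDigits_digits hb ht'] at this
  have ex : ∃ n, Dt θ m2 t n ≠ Dt θ m2 t' n := by
    by_contra! hall
    have p : 0 < |t - t'| := abs_pos.2 (sub_ne_zero.2 hne)
    have hM : (3:ℝ) ≤ ((2*m2+1 : ℕ):ℝ) := by
      have : 3 ≤ 2*m2+1 := by omega
      exact_mod_cast this
    obtain ⟨k, hk⟩ := exists_pow_lt_of_lt_one p (show (((2*m2+1 : ℕ):ℝ))⁻¹ < 1 from inv_lt_one_of_one_lt₀ (by linarith))
    obtain ⟨n, hn⟩ := exists_nat_ge ((k:ℝ)/(1-θ))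
    have h2 : (k:ℝ) ≤ bn θ n := by
      rw [div_le_iff₀ (by linarith)] at hn
      have := bn_ge h0 h1 n
      linarith
    have h2 : k ≤ bn θ n := by exact_mod_cast h2
    have h3 := tt n (fun i _ => hall i)
    rw [← inv_pow] at h3
    have : (((2*m2+1 : ℕ):ℝ))⁻¹ ^ bn θ n ≤ (((2*m2+1 : ℕ):ℝ))⁻¹ ^ k :=
      pow_le_pow_of_le_one (by positivity) (inv_le_one_of_one_le₀ (by linarith)) h2
    linarith
  classical
  refine ⟨Nat.find ex, ?_, ?_⟩
  · exact yv_sep K64 (hD t) (hD t') _ (fun i hi => not_not.1 (Nat.find_min ex hi)) (Nat.find_spec ex)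
  · exact tt _ (fun i hi => not_not.1 (Nat.find_min ex hi))

theorem Dt_holder {θ : ℝ} (h0 : 0 ≤ θ) (h1 : θ < 1) {m2 K : ℕ} (m1 : 1 ≤ m2) (K64 : 64 ≤ K)
    (hm : (m2:ℝ) ≤ 3/8 * K) {t t' : ℝ} (ht : t ∈ Ico (0:ℝ) 1) (ht' : t' ∈ Ico (0:ℝ) 1) :
    |t - t'| ≤ (5 * K * |yv K (Dt θ m2 t) - yv K (Dt θ m2 t')|) ^
      ((1-θ) * Real.log ((2*m2+1 : ℕ):ℝ) / Real.log K) := by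
  rcases eq_or_ne t t' with rfl | hne
  · rw [sub_self, abs_zero]; positivity
  obtain ⟨n, a, b⟩ := Dt_main h0 h1 m1 K64 hm ht ht' hne
  have hK : (64:ℝ) ≤ K := by exact_mod_cast K64
  have hM : (3:ℝ) ≤ ((2*m2+1 : ℕ):ℝ) := by
    have : 3 ≤ 2*m2+1 := by omega
    exact_mod_cast this
  set M := ((2*m2+1 : ℕ):ℝ)
  have lK : 0 < Real.log K := Real.log_pos (by linarith)
  have lM : 0 < Real.log M := Real.log_pos (by linarith)
  have hγ : 0 ≤ (1-θ) * Real.log M / Real.log K := by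
    have : 0 ≤ 1 - θ := by linarith
    positivity
  refine b.trans ?_
  have e1 : ep K n ≤ 5 * K * |yv K (Dt θ m2 t) - yv K (Dt θ m2 t')| := by
    have : ep K n = K * ep K (n+1) := by unfold ep; rw [pow_succ]; field_simp
    rw [this]; nlinarith
  have e0 : 0 < ep K n := by unfold ep; positivity
  refine le_trans ?_ (Real.rpow_le_rpow e0.le e1 hγ)
  have e2 : ep K n = Real.exp (-(n * Real.log K)) := by
    unfold ep; rw [Real.exp_neg, Real.exp_nat_mul, Real.exp_log (by linarith), one_div]
  have e3 : (M ^ bn θ n)⁻¹ = Real.exp (-(bn θ n * Real.log M)) := by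
    rw [Real.exp_neg, Real.exp_nat_mul, Real.exp_log (by linarith)]
  rw [e2, e3, ← Real.exp_mul, Real.exp_le_exp]
  have h3 := bn_ge h0 h1 n
  have : -(n * Real.log K) * ((1-θ) * Real.log M / Real.log K) = -((1-θ) * n * Real.log M) := by
    field_simp
  rw [this, neg_le_neg_iff]
  gcongr

theorem exists_digits {θ : ℝ} (h0 : 0 ≤ θ) (h1 : θ < 1) {K : ℕ} (K64 : 64 ≤ K) :
    ∃ (m2 : ℕ) (Act : ℕ → Set ℤ) (E : Set ℝ), (m2:ℝ) + 1/2 ≤ 7/16 * K ∧ Act 0 = {0} ∧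
      (∀ n, grw θ n → ∀ j' ∈ Act (n+1), ∃ j ∈ Act n, j' = K * j) ∧
      (∀ n, ¬grw θ n → ∀ j' ∈ Act (n+1), ∃ j ∈ Act n, ∃ d : ℤ, |d| ≤ m2 ∧ j' = K * j + d) ∧
      (∀ y ∈ E, ∀ n x, Row K Act n (x, y)) ∧
      ENNReal.ofReal ((1-θ) * Real.log (K/2) / Real.log K) ≤ dimH E := by
  have hK : (64:ℝ) ≤ K := by exact_mod_cast K64
  obtain ⟨m2, hm2⟩ : ∃ m2, m2 = 3 * K / 8 := ⟨_, rfl⟩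
  have a1 : 8 * m2 ≤ 3 * K := by omega
  have a2 : 3 * K ≤ 8 * m2 + 7 := by omega
  have m1 : 1 ≤ m2 := by omega
  have a1' : 8 * (m2:ℝ) ≤ 3 * K := by exact_mod_cast a1
  have a2' : 3 * (K:ℝ) ≤ 8 * m2 + 7 := by exact_mod_cast a2
  have hm : (m2:ℝ) ≤ 3/8 * K := by linarith
  have hD : ∀ t i, |(Dt θ m2 t i : ℝ)| ≤ 3/8 * K := by
    intro t i
    have : ((|Dt θ m2 t i| : ℤ):ℝ) ≤ ((m2:ℤ):ℝ) := by exact_mod_cast Dt_le θ m2 t i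
    push_cast at this; linarith
  let y : ℝ → ℝ := fun t => yv K (Dt θ m2 t)
  refine ⟨m2, fun n => range fun t => av K (Dt θ m2 t) n, y '' Ico 0 1, by linarith, ?_, ?_, ?_, ?_, ?_⟩
  · ext j; simp [av]
  · rintro n hn _ ⟨t, rfl⟩
    exact ⟨_, ⟨t, rfl⟩, by simp [av, Dt_gr m2 t hn]⟩
  · rintro n hn _ ⟨t, rfl⟩
    exact ⟨_, ⟨t, rfl⟩, _, Dt_le θ m2 t n, rfl⟩
  · rintro _ ⟨t, ht, rfl⟩ n x
    refine ⟨_, ⟨t, rfl⟩, ?_⟩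
    have h2 := yv_pow K64 (hD t) n
    have h3 := yv_le K64 (d := fun i => Dt θ m2 t (n+i)) (fun i => hD t _)
    simp only [y]
    rw [h2, add_sub_cancel_left]; linarith
  · have hM : (K:ℝ)/2 ≤ ((2*m2+1 : ℕ):ℝ) := by push_cast; linarith
    set M := ((2*m2+1 : ℕ):ℝ) with hMd
    have lK : 0 < Real.log K := Real.log_pos (by linarith)
    have lM : 0 < Real.log M := Real.log_pos (by linarith)
    set γ := (1-θ) * Real.log M / Real.log K with hγd
    have hγ : 0 < γ := by
      have : 0 < 1 - θ := by linarith
      positivity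
    have H : ∀ t ∈ Ico (0:ℝ) 1, ∀ t' ∈ Ico (0:ℝ) 1, |t - t'| ≤ (5 * K * |y t - y t'|) ^ γ :=
      fun t ht t' ht' => Dt_holder h0 h1 m1 K64 hm ht ht'
    have inj : InjOn y (Ico 0 1) := by
      intro t ht t' ht' h
      have := H t ht t' ht'
      rw [h, sub_self, abs_zero, mul_zero, Real.zero_rpow hγ.ne'] at this
      exact sub_eq_zero.1 (abs_nonpos_iff.1 this)
    have im : Function.invFunOn y (Ico 0 1) '' (y '' Ico 0 1) = Ico 0 1 := by
      rw [← image_comp]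
      conv_rhs => rw [← image_id (Ico (0:ℝ) 1)]
      exact image_congr (fun t ht => inj.leftInvOn_invFunOn ht)
    have hol : HolderOnWith (((5 * K : ℝ) ^ γ).toNNReal) γ.toNNReal (Function.invFunOn y (Ico 0 1)) (y '' Ico 0 1) := by
      rintro _ ⟨t, ht, rfl⟩ _ ⟨t', ht', rfl⟩
      rw [inj.leftInvOn_invFunOn ht, inj.leftInvOn_invFunOn ht']
      rw [edist_dist, edist_dist, Real.coe_toNNReal _ hγ.le, ENNReal.ofReal_rpow_of_nonneg dist_nonneg hγ.le]
      rw [ENNReal.ofNNReal_toNNReal, ← ENNReal.ofReal_mul (by positivity)]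
      apply ENNReal.ofReal_le_ofReal
      rw [Real.dist_eq, Real.dist_eq]
      refine (H t ht t' ht').trans ?_
      rw [Real.mul_rpow (by positivity) (by positivity)]
    have h5 := hol.dimH_image_le (by simpa using hγ)
    rw [im, Real.dimH_of_nonempty_interior (by rw [interior_Ico]; exact nonempty_Ioo.2 one_pos)] at h5
    have h6 : ENNReal.ofReal γ ≤ dimH (y '' Ico 0 1) := by
      have hp : (ENNReal.ofReal γ) ≠ 0 := by simpa using hγ
      have : (Module.finrank ℝ ℝ : ℝ≥0∞) = 1 := by simp
      rw [this] at h5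
      rw [ENNReal.le_div_iff_mul_le (Or.inl (by simpa using hγ)) (Or.inl (by simp))] at h5
      rw [one_mul] at h5
      exact h5
    refine le_trans (ENNReal.ofReal_le_ofReal ?_) h6
    rw [hγd]
    gcongr

end BHW

-- ===== Part 17 =====
open Set Metric Filter MeasureTheory
open scoped ENNReal Topology NNReal

namespace BHW

theorem params {s β : ℝ} (s0 : 0 ≤ s) (s1 : s < 1/2) (hβ : β < 1 - 2*s) :
    ∃ Q : ℝ, 64 ≤ Q ∧ ∀ lam K : ℝ, Q ≤ lam → lam ≤ K → K ≤ 32400 * lam^2 →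
      0 ≤ s * Real.log K / Real.log lam ∧ s * Real.log K / Real.log lam < 1 ∧
      β < (1 - s * Real.log K / Real.log lam) * Real.log (K/2) / Real.log K := by
  have c1 : Real.log 2 ≤ Real.log 32400 := Real.log_le_log (by norm_num) (by norm_num)
  have c2 : 0 < Real.log 2 := Real.log_pos (by norm_num)
  obtain ⟨δ, hδ, d1, d2⟩ : ∃ δ : ℝ, 0 < δ ∧ 2 * δ ≤ 1 - 2*s ∧ 2 * δ < 1 - 2*s - β := by
    refine ⟨min ((1-2*s)/2) ((1-2*s-β)/4), lt_min (by linarith) (by linarith), ?_, ?_⟩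
    · have := min_le_left ((1-2*s)/2) ((1-2*s-β)/4); linarith
    · have := min_le_right ((1-2*s)/2) ((1-2*s-β)/4); linarith
  refine ⟨max 64 (Real.exp (Real.log 32400 / δ)), le_max_left _ _, fun lam K hQ h1 h2 => ?_⟩
  have l64 := (le_max_left _ _).trans hQ
  have hx : Real.log 32400 / δ ≤ Real.log lam := by
    rw [Real.le_log_iff_exp_le (by linarith)]; exact (le_max_right _ _).trans hQ
  set c := Real.log 32400
  set x := Real.log lam
  have xp : 0 < x := lt_of_lt_of_le (by positivity) hx
  have cx : c ≤ δ * x := by rw [div_le_iff₀ hδ] at hx; linarith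
  have k1 : x ≤ Real.log K := Real.log_le_log (by linarith) h1
  have k2 : Real.log K ≤ c + 2 * x := by
    have := Real.log_le_log (by linarith) h2
    rwa [Real.log_mul (by norm_num) (by nlinarith), Real.log_pow] at this
  have k3 : Real.log (K/2) = Real.log K - Real.log 2 := Real.log_div (by linarith) (by norm_num)
  rw [k3]
  set k := Real.log K
  have kp : 0 < k := by linarith
  have t1 : s * k / x ≤ 2 * s + δ := by
    rw [div_le_iff₀ xp]; nlinarith
  have t2 : 1 - δ ≤ (k - Real.log 2)/k := by
    rw [le_div_iff₀ kp]; nlinarith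
  refine ⟨by positivity, by linarith, ?_⟩
  rw [mul_div_assoc]
  set θ := s * k / x
  have : 0 ≤ 1 - θ := by linarith
  calc β < (1 - 2*s - δ) * (1 - δ) := by nlinarith
    _ ≤ (1 - θ) * (1 - δ) := mul_le_mul_of_nonneg_right (by linarith) (by linarith)
    _ ≤ _ := by gcongr

theorem plane_map {s β : ℝ} (s0 : 0 ≤ s) (s1 : s < 1/2) (hβ : β < 1 - 2*s) :
    ∃ (F : Pl ≃ₜ Pl) (E : Set ℝ) (B c1 : ℝ), 1 ≤ B ∧ 0 < c1 ∧ β < (dimH E).toReal ∧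
      (∀ p q z, dist p q ≤ 2 * dist p z → dist (F p) (F q) ≤ B * dist (F p) (F z)) ∧
      ∀ p q : Pl, p.2 ∈ E → dist p q ≤ c1 →
        dist (F p) (F q) ≤ B * dist p q ^ (1 - s) ∧ dist p q ^ (1-s) ≤ B * dist (F p) (F q) := by
  obtain ⟨Q, Q64, hQ⟩ := params s0 s1 hβ
  obtain ⟨h, lam, b, Kp, A, st, h0, hh, hWD, hlam, odd, hK2, hlK⟩ := exists_words Q
  obtain ⟨K, hK⟩ : ∃ K, K = 3 * Kp := ⟨_, rfl⟩
  have hKR : (K:ℝ) = 3 * Kp := by rw [hK]; push_cast; ring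
  have hW : ∀ σ, ∃ G D e η σ', WRow h lam K σ G D e η σ' := by
    intro σ; rw [hK]; exact exists_WRow hh hWD (by linarith) σ
  have lK : 4 * lam ≤ K := by
    obtain ⟨G, D, e, η, σ', W⟩ := hW (fun _ => true)
    exact W.lK
  have K64R : (64:ℝ) ≤ K := by linarith
  have K64 : 64 ≤ K := by exact_mod_cast K64R
  obtain ⟨m, hm⟩ : ∃ m, K = 2 * m + 1 := by
    obtain ⟨j, hj⟩ := odd
    exact ⟨3 * j + 1, by omega⟩
  obtain ⟨C, C1, hG⟩ := exists_Gam h lam K hh (by linarith) (by omega)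
  obtain ⟨q1, q2, q3⟩ := hQ lam K hlam (by linarith) (by linarith)
  set θ := s * Real.log K / Real.log lam with hθ
  have llam : 0 < Real.log lam := Real.log_pos (by linarith)
  have hθl : θ * Real.log lam = s * Real.log K := by rw [hθ]; field_simp
  obtain ⟨m2, Act, E, hm2, A0, A1, A2, hE, hdim⟩ := exists_digits q1 q2 K64
  obtain ⟨f, Γ, T⟩ := exists_tower hm K64 (by linarith) lK h0 hh C1 hW hG m2 hm2 (grw θ) Act
    (fun n => lam ^ (Nn θ n)) A0 A1 A2 (by simp [Nn])
    (fun n hn => by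
      unfold grw at hn
      simp only [hn, pow_succ]; ring) (fun n hn => by simp only [Nn_step q1 q2 n hn])
  obtain ⟨F, B, c1, B1, c1p, qs, hF⟩ := T.main
  have lamp : 0 < lam := by linarith
  have Kpos : (0:ℝ) < K := by linarith
  have Lu : ∀ n, lam ^ (Nn θ n) ≤ (ep K n) ^ (-s) := by
    intro n
    have e2 : ep K n = Real.exp (-(n * Real.log K)) := by
      unfold ep; rw [Real.exp_neg, Real.exp_nat_mul, Real.exp_log (by linarith), one_div]
    have e3 : lam ^ (Nn θ n) = Real.exp (Nn θ n * Real.log lam) := by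
      rw [Real.exp_nat_mul, Real.exp_log lamp]
    rw [e2, e3, ← Real.exp_mul, Real.exp_le_exp]
    calc Nn θ n * Real.log lam ≤ θ * n * Real.log lam := by gcongr; exact Nn_le q1 n
      _ = θ * Real.log lam * n := by ring
      _ = _ := by rw [hθl]; ring
  have Ll : ∀ n, (ep K n) ^ (-s) ≤ lam * lam ^ (Nn θ n) := by
    intro n
    have e2 : ep K n = Real.exp (-(n * Real.log K)) := by
      unfold ep; rw [Real.exp_neg, Real.exp_nat_mul, Real.exp_log (by linarith), one_div]
    have e3 : lam * lam ^ (Nn θ n) = Real.exp ((Nn θ n + 1) * Real.log lam) := by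
      rw [add_mul, one_mul, Real.exp_add, Real.exp_nat_mul, Real.exp_log lamp]; ring
    rw [e2, e3, ← Real.exp_mul, Real.exp_le_exp]
    calc _ = s * Real.log K * n := by ring
      _ = θ * n * Real.log lam := by rw [← hθl]; ring
      _ ≤ _ := by gcongr; exact (Nn_lt θ n).le
  have P1 : 0 < c1 ^ s := by positivity
  have P2 : 0 < (K/c1) ^ s := by positivity
  refine ⟨F, E, B + B * c1 ^ s + (K/c1)^s * lam * B, c1, ?_, c1p, ?_, ?_, ?_⟩
  · have : 0 ≤ B * c1 ^ s + (K/c1)^s * lam * B := by positivity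
    linarith
  · refine q3.trans_le ?_
    have fin : dimH E ≠ ⊤ := by
      have : dimH E ≤ dimH (univ : Set ℝ) := dimH_mono (subset_univ _)
      rw [Real.dimH_univ] at this
      exact ne_top_of_le_ne_top ENNReal.one_ne_top this
    rw [← ENNReal.ofReal_le_iff_le_toReal fin]
    exact hdim
  · intro p q z hpq
    refine (qs p q z hpq).trans ?_
    have : 0 ≤ B * c1 ^ s + (K/c1)^s * lam * B := by positivity
    gcongr; linarith
  · intro p q hp hr
    rcases eq_or_ne p q with rfl | hpq
    · rw [dist_self, dist_self, Real.zero_rpow (by linarith)]; simp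
    have r0 : 0 < dist p q := dist_pos.2 hpq
    obtain ⟨m, a1, a2, a3, a4⟩ := hF p q (fun n => hE p.2 hp n p.1) hpq hr
    set r := dist p q
    have e0 : 0 < ep K m := by unfold ep; positivity
    have eK : ep K m = K * ep K (m+1) := by unfold ep; rw [pow_succ]; field_simp
    have split : r ^ (1 - s) = r ^ (-s) * r := by
      rw [show 1 - s = -s + 1 by ring, Real.rpow_add_one r0.ne']
    have u : ep K m ^ (-s) ≤ c1 ^ s * r ^ (-s) := by
      have : r / c1 ≤ ep K m := by rw [div_le_iff₀ c1p]; linarith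
      have := Real.rpow_le_rpow_of_nonpos (by positivity) this (show -s ≤ 0 by linarith)
      rw [Real.div_rpow r0.le c1p.le, Real.rpow_neg c1p.le, div_inv_eq_mul] at this
      linarith
    have v : r ^ (-s) ≤ (K/c1)^s * ep K m ^ (-s) := by
      have : ep K m ≤ K/c1 * r := by
        rw [eK, div_mul_eq_mul_div, le_div_iff₀ c1p]
        nlinarith
      have := Real.rpow_le_rpow_of_nonpos e0 this (show -s ≤ 0 by linarith)
      rw [Real.mul_rpow (by positivity) r0.le, Real.rpow_neg (by positivity : 0 ≤ K/c1)] at this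
      calc r ^ (-s) = (K/c1)^s * (((K/c1)^s)⁻¹ * r ^ (-s)) := by field_simp
        _ ≤ _ := by gcongr
    have rp : 0 < r ^ (-s) := by positivity
    constructor
    · calc dist (F p) (F q) ≤ B * (lam ^ Nn θ m * r) := a4
        _ ≤ B * (c1 ^ s * r ^ (-s) * r) := by gcongr; exact (Lu m).trans u
        _ = B * c1 ^ s * r ^ (1-s) := by rw [split]; ring
        _ ≤ _ := by
          gcongr
          have : 0 ≤ (K/c1)^s * lam * B := by positivity
          linarith
    · calc r ^ (1-s) = r ^ (-s) * r := split
        _ ≤ (K/c1)^s * (lam * lam ^ (Nn θ m)) * r := by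
          gcongr
          exact v.trans (by gcongr; exact Ll m)
        _ = (K/c1)^s * lam * (lam ^ (Nn θ m) * r) := by ring
        _ ≤ (K/c1)^s * lam * (B * dist (F p) (F q)) := by gcongr
        _ = (K/c1)^s * lam * B * dist (F p) (F q) := by ring
        _ ≤ _ := by
          gcongr
          have : 0 ≤ B * c1 ^ s := by positivity
          linarith

end BHW

-- ===== Part 18 =====
namespace BHW

theorem dim_local {X : Type*} [MetricSpace X] [SecondCountableTopology X] (f : X ≃ₜ X) {α B c : ℝ} (α1 : 1 ≤ α) (B1 : 1 ≤ B) (c0 : 0 < c)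
    (F : Set X) (h : ∀ p ∈ F, ∀ q, dist p q ≤ c → dist (f p) (f q) ≤ B * dist p q ^ α⁻¹ ∧
      dist p q ^ α⁻¹ ≤ B * dist (f p) (f q)) :
    (dimH (f '' F)).toReal = α * (dimH F).toReal := by
  have α0 : 0 < α := by linarith
  have B0 : 0 ≤ B := by linarith
  obtain ⟨a, rfl⟩ : ∃ a : ℝ≥0, (a:ℝ) = α := ⟨⟨α, α0.le⟩, rfl⟩
  have a0 : 0 < a := by exact_mod_cast α0
  have clos : ∀ x p q : X, p ∈ ball x (c/2) → q ∈ ball x (c/2) → dist p q ≤ c := by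
    intro x p q hp hq
    rw [mem_ball] at hp hq
    have := dist_triangle_right p q x
    linarith
  have u : dimH (f '' F) ≤ dimH F / (a⁻¹ : ℝ≥0) := by
    refine dimH_image_le_of_locally_holder_on (by positivity) (fun x hx => ?_)
    refine ⟨B.toNNReal, F ∩ ball x (c/2), inter_mem_nhdsWithin _ (ball_mem_nhds _ (by linarith)), ?_⟩
    intro p hp q hq
    have h1 := (h p hp.1 q (clos x p q hp.2 hq.2)).1
    rw [edist_dist, edist_dist, ENNReal.ofReal_rpow_of_nonneg dist_nonneg (by positivity),
      ENNReal.ofNNReal_toNNReal, ← ENNReal.ofReal_mul B0]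
    exact ENNReal.ofReal_le_ofReal (by push_cast; exact h1)
  have v : dimH F ≤ dimH (f '' F) / a := by
    have : dimH (f.symm '' (f '' F)) ≤ dimH (f '' F) / a := by
      refine dimH_image_le_of_locally_holder_on a0 ?_
      rintro _ ⟨x, hx, rfl⟩
      refine ⟨(B ^ (a:ℝ)).toNNReal, f '' F ∩ f '' ball x (c/2), inter_mem_nhdsWithin _
        (f.isOpenMap.image_mem_nhds (ball_mem_nhds _ (by linarith))), ?_⟩
      rintro _ ⟨⟨p, hp, rfl⟩, p', hp', hpp⟩ _ ⟨⟨q, hq, rfl⟩, q', hq', hqq⟩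
      obtain rfl := f.injective hpp
      obtain rfl := f.injective hqq
      have h1 := (h _ hp _ (clos x _ _ hp' hq')).2
      rw [f.symm_apply_apply, f.symm_apply_apply]
      rw [edist_dist, edist_dist, ENNReal.ofReal_rpow_of_nonneg dist_nonneg (by positivity),
        ENNReal.ofNNReal_toNNReal, ← ENNReal.ofReal_mul (by positivity)]
      apply ENNReal.ofReal_le_ofReal
      have h2 := Real.rpow_le_rpow (by positivity) h1 α0.le
      rwa [← Real.rpow_mul dist_nonneg, inv_mul_cancel₀ α0.ne', Real.rpow_one,
        Real.mul_rpow B0 dist_nonneg] at h2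
    rwa [← image_comp, f.symm_comp_self, image_id] at this
  have e1 : dimH F / ((a⁻¹ : ℝ≥0) : ℝ≥0∞) = dimH F * a := by
    rw [ENNReal.coe_inv a0.ne', div_eq_mul_inv, inv_inv]
  rw [e1] at u
  rw [ENNReal.le_div_iff_mul_le (Or.inl (by exact_mod_cast a0.ne')) (Or.inl (by simp))] at v
  rw [le_antisymm u v, ENNReal.toReal_mul, mul_comm]; simp

theorem qc_of {X : Type*} [MetricSpace X] (f : X → X) {H : ℝ} (H1 : 1 ≤ H)
    (h : ∀ p q z, dist p q ≤ dist p z → dist (f p) (f q) ≤ H * dist (f p) (f z)) :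
    QuasiconformalOn Set.univ f := by
  refine ⟨H, H1, fun x _ => ?_⟩
  unfold qcH
  refine Filter.limsup_le_of_le (h := Eventually.of_forall fun r => ?_)
  apply ENNReal.div_le_of_le_mul
  have Hp : ENNReal.ofReal H ≠ 0 := by simp; linarith
  rw [mul_comm, ← ENNReal.div_le_iff_le_mul (Or.inl Hp) (Or.inl (by simp))]
  unfold linCon
  refine le_iInf₂ fun z hz => ?_
  rw [ENNReal.div_le_iff_le_mul (Or.inl Hp) (Or.inl (by simp))]
  unfold linDil
  refine iSup₂_le fun y hy => ?_
  rw [edist_dist, edist_dist, ← ENNReal.ofReal_mul dist_nonneg]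
  apply ENNReal.ofReal_le_ofReal
  rw [mul_comm]
  exact h _ _ _ (hy.2.trans hz.2)

abbrev E2 := EuclideanSpace ℝ (Fin 2)

theorem coords (L : Submodule ℝ E2) (hL : Module.finrank ℝ L = 1) :
    ∃ (e : Pl ≃ₜ E2) (w : E2), w ∈ Lᗮ ∧ (∀ y, e (0, y) = y • w) ∧
      (∀ v ∈ L, ∀ y, (e.symm (y • w + v)).2 = y) ∧
      ∀ p q, dist p q ≤ dist (e p) (e q) ∧ dist (e p) (e q) ≤ 2 * dist p q := by
  have hL2 : Module.finrank ℝ Lᗮ = 1 := by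
    have := L.finrank_add_finrank_orthogonal
    rw [hL, finrank_euclideanSpace_fin] at this
    omega
  have unit : ∀ M : Submodule ℝ E2, Module.finrank ℝ M = 1 → ∃ v ∈ M, ‖v‖ = 1 ∧ ∀ u ∈ M, ∃ c : ℝ, u = c • v := by
    intro M hM
    obtain ⟨v, v0, hv⟩ := finrank_eq_one_iff'.1 hM
    have n0 : ‖(v:E2)‖ ≠ 0 := by simpa using v0
    refine ⟨‖(v:E2)‖⁻¹ • (v:E2), M.smul_mem _ v.2, ?_, fun u hu => ?_⟩
    · rw [norm_smul, norm_inv, norm_norm, inv_mul_cancel₀ n0]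
    · obtain ⟨c, hc⟩ := hv ⟨u, hu⟩
      refine ⟨c * ‖(v:E2)‖, ?_⟩
      rw [smul_smul, mul_assoc, mul_inv_cancel₀ n0, mul_one]
      exact (congrArg Subtype.val hc).symm
  obtain ⟨v, vL, vn, vs⟩ := unit L hL
  obtain ⟨w, wL, wn, ws⟩ := unit Lᗮ hL2
  have vw : inner ℝ v w = 0 := wL v vL
  have wv : inner ℝ w v = 0 := by rw [real_inner_comm]; exact vw
  have vv : inner ℝ v v = (1:ℝ) := by rw [real_inner_self_eq_norm_sq, vn]; norm_num
  have ww : inner ℝ w w = (1:ℝ) := by rw [real_inner_self_eq_norm_sq, wn]; norm_num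
  have left : ∀ z : Pl, (inner ℝ v (z.1 • v + z.2 • w), inner ℝ w (z.1 • v + z.2 • w)) = z := by
    intro z
    simp [inner_add_right, inner_smul_right, vw, wv, vn, wn]
  let e : Pl ≃ₜ E2 :=
    { toFun := fun z => z.1 • v + z.2 • w
      invFun := fun u => (inner ℝ v u, inner ℝ w u)
      left_inv := left
      right_inv := by
        intro u
        obtain ⟨c, hc⟩ := vs _ (L.starProjection_apply_mem u)
        obtain ⟨c', hc'⟩ := ws _ (Lᗮ.starProjection_apply_mem u)
        have hu : u = c • v + c' • w := by
          rw [← hc, ← hc']; exact (L.starProjection_add_starProjection_orthogonal u).symm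
        have := left (c, c')
        simp only at this
        rw [← hu] at this
        simp only [Prod.ext_iff] at this
        simp only [this.1, this.2]
        exact hu.symm
      continuous_toFun := by fun_prop
      continuous_invFun := by fun_prop }
  have he : ∀ z : Pl, e z = z.1 • v + z.2 • w := fun _ => rfl
  refine ⟨e, w, wL, fun y => by simp [he], ?_, ?_⟩
  · intro u hu y
    show inner ℝ w (y • w + u) = y
    have : inner ℝ w u = 0 := by rw [real_inner_comm]; exact wL u hu
    simp [inner_add_right, inner_smul_right, wn, this]
  · intro p q
    have e1 : dist (e p) (e q) ^ 2 = (p.1 - q.1)^2 + (p.2 - q.2)^2 := by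
      have : e p - e q = (p.1 - q.1) • v + (p.2 - q.2) • w := by rw [he, he]; module
      rw [dist_eq_norm, this, ← real_inner_self_eq_norm_sq]
      simp only [inner_add_right, inner_add_left, real_inner_smul_right, real_inner_smul_left, vw, wv, vv, ww]
      ring
    have d0 : 0 ≤ dist (e p) (e q) := dist_nonneg
    have d1 : 0 ≤ dist p q := dist_nonneg
    constructor
    · rw [Prod.dist_eq, Real.dist_eq, Real.dist_eq]
      refine max_le ?_ ?_ <;> · apply abs_le_of_sq_le_sq _ d0; nlinarith
    · have a1 : |p.1 - q.1| ≤ dist p q := by rw [Prod.dist_eq, Real.dist_eq]; exact le_max_left _ _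
      have a2 : |p.2 - q.2| ≤ dist p q := by rw [Prod.dist_eq, Real.dist_eq, Real.dist_eq]; exact le_max_right _ _
      have b1 := sq_le_sq' (abs_le.1 a1).1 (abs_le.1 a1).2
      have b2 := sq_le_sq' (abs_le.1 a2).1 (abs_le.1 a2).2
      apply le_of_sq_le_sq _ (by positivity)
      nlinarith

theorem final (α : ℝ) (hα₁ : 1 ≤ α) (hα₂ : α < 2)
    (L : Submodule ℝ E2) (hL : Module.finrank ℝ L = 1)
    (β : ℝ) (hβ : β < 2 / α - 1) :
    ∃ (E : Set E2) (f : E2 ≃ₜ E2),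
      E ⊆ (Lᗮ : Set E2) ∧
      β < (dimH E).toReal ∧
      QuasiconformalOn Set.univ ⇑f ∧
      ∀ a ∈ E, ∀ F : Set E2,
        F ⊆ {x | ∃ v ∈ L, x = a + v} → MeasurableSet F →
        (dimH (⇑f '' F)).toReal = α * (dimH F).toReal := by
  have α0 : 0 < α := by linarith
  obtain ⟨s, hs⟩ : ∃ s, s = 1 - α⁻¹ := ⟨_, rfl⟩
  have i1 : α⁻¹ ≤ 1 := inv_le_one_of_one_le₀ hα₁
  have i2 : 1/2 < α⁻¹ := by rw [one_div]; exact inv_strictAnti₀ α0 hα₂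
  have e1 : 2 / α - 1 = 1 - 2 * s := by rw [hs, div_eq_mul_inv]; ring
  obtain ⟨F, E, B, c1, B1, c1p, hdim, qs, hol⟩ := plane_map (s := s) (β := β) (by linarith) (by linarith) (by linarith)
  have e2 : 1 - s = α⁻¹ := by rw [hs]; ring
  rw [e2] at hol
  obtain ⟨e, w, wL, ew, es, ed⟩ := coords L hL
  let f : E2 ≃ₜ E2 := e.symm.trans (F.trans e)
  have hf : ∀ p, f p = e (F (e.symm p)) := fun _ => rfl
  have ed' : ∀ p q, dist (e.symm p) (e.symm q) ≤ dist p q ∧ dist p q ≤ 2 * dist (e.symm p) (e.symm q) := by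
    intro p q
    have := ed (e.symm p) (e.symm q)
    rwa [e.apply_symm_apply, e.apply_symm_apply] at this
  refine ⟨(fun y : ℝ => y • w) '' E, f, ?_, ?_, ?_, ?_⟩
  · rintro _ ⟨y, _, rfl⟩
    exact Lᗮ.smul_mem _ wL
  · refine hdim.trans_le ?_
    have h1 : dimH E ≤ dimH ((fun y : ℝ => y • w) '' E) := by
      have : LipschitzOnWith 1 (fun u : E2 => (e.symm u).2) ((fun y : ℝ => y • w) '' E) := by
        refine LipschitzWith.lipschitzOnWith (LipschitzWith.of_dist_le_mul fun p q => ?_)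
        simp only [NNReal.coe_one, one_mul]
        refine le_trans ?_ (ed' p q).1
        rw [Prod.dist_eq (x := e.symm p)]; exact le_max_right _ _
      have h2 := this.dimH_image_le
      rw [← image_comp] at h2
      have h3 : ((fun u : E2 => (e.symm u).2) ∘ fun y : ℝ => y • w) = id := by
        ext y
        have := es 0 L.zero_mem y
        rw [add_zero] at this
        simpa using this
      rwa [h3, image_id] at h2
    refine ENNReal.toReal_mono ?_ h1
    have : dimH ((fun y : ℝ => y • w) '' E) ≤ dimH (univ : Set E2) := dimH_mono (subset_univ _)
    rw [Real.dimH_univ_eq_finrank] at this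
    exact ne_top_of_le_ne_top (ENNReal.natCast_ne_top _) this
  · refine qc_of f (H := 2 * B) (by linarith) (fun p q z h => ?_)
    rw [hf, hf, hf]
    have h1 := qs (e.symm p) (e.symm q) (e.symm z) (by linarith [(ed' p q).1, (ed' p z).2])
    have h2 := (ed (F (e.symm p)) (F (e.symm q))).2
    have h3 := (ed (F (e.symm p)) (F (e.symm z))).1
    nlinarith
  · rintro _ ⟨y, hy, rfl⟩ S hS -
    refine dim_local f (B := 2 * B) (c := c1) hα₁ (by linarith) c1p S (fun p hp q hpq => ?_)
    obtain ⟨v, hv, hpv⟩ := hS hp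
    have hy2 : (e.symm p).2 ∈ E := by rw [hpv, es v hv y]; exact hy
    obtain ⟨u1, u2⟩ := hol (e.symm p) (e.symm q) hy2 ((ed' p q).1.trans hpq)
    rw [hf, hf]
    have a0 : 0 ≤ α⁻¹ := by positivity
    have h2 := ed (F (e.symm p)) (F (e.symm q))
    constructor
    · have := Real.rpow_le_rpow dist_nonneg (ed' p q).1 a0
      calc _ ≤ 2 * dist (F (e.symm p)) (F (e.symm q)) := h2.2
        _ ≤ 2 * (B * dist (e.symm p) (e.symm q) ^ α⁻¹) := by gcongr
        _ ≤ 2 * (B * dist p q ^ α⁻¹) := by gcongr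
        _ = _ := by ring
    · have h3 := Real.rpow_le_rpow dist_nonneg (ed' p q).2 a0
      rw [Real.mul_rpow (by norm_num) dist_nonneg] at h3
      have h4 : (2:ℝ) ^ α⁻¹ ≤ 2 := by
        calc (2:ℝ) ^ α⁻¹ ≤ 2 ^ (1:ℝ) := Real.rpow_le_rpow_of_exponent_le (by norm_num) i1
          _ = 2 := Real.rpow_one 2
      calc dist p q ^ α⁻¹ ≤ 2 ^ α⁻¹ * dist (e.symm p) (e.symm q) ^ α⁻¹ := h3
        _ ≤ 2 * (B * dist (F (e.symm p)) (F (e.symm q))) := by gcongr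
        _ ≤ 2 * (B * dist (e (F (e.symm p))) (e (F (e.symm q)))) := by gcongr; exact h2.1
        _ = _ := by ring

end BHW

/-- **Bishop–Hakobyan–Williams (strong form).** Fix `α ∈ [1,2)` and a one-dimensional
linear subspace `L ⊂ ℝ²`. For any `β < 2/α - 1` there are a set `E ⊆ L^⊥` with
`dim E > β` and a quasiconformal homeomorphism `f : ℝ² → ℝ²` such that
`dim f(F) = α · dim F` for every `a ∈ E` and every Borel subset `F` of `a + L`. -/
theorem BHW_qc_line_dimension_multiplier
    (α : ℝ) (hα₁ : 1 ≤ α) (hα₂ : α < 2)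
    (L : Submodule ℝ (EuclideanSpace ℝ (Fin 2))) (hL : Module.finrank ℝ L = 1)
    (β : ℝ) (hβ : β < 2 / α - 1) :
    ∃ (E : Set (EuclideanSpace ℝ (Fin 2)))
      (f : EuclideanSpace ℝ (Fin 2) ≃ₜ EuclideanSpace ℝ (Fin 2)),
      E ⊆ (Lᗮ : Set (EuclideanSpace ℝ (Fin 2))) ∧
      β < (dimH E).toReal ∧
      QuasiconformalOn Set.univ ⇑f ∧
      ∀ a ∈ E, ∀ F : Set (EuclideanSpace ℝ (Fin 2)),
        F ⊆ {x | ∃ v ∈ L, x = a + v} → MeasurableSet F →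
        (dimH (⇑f '' F)).toReal = α * (dimH F).toReal := by
  exact BHW.final α hα₁ hα₂ L hL β hβ
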